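/- Let p be a prime with p ≥ 5, k an even integer, and Γ an arbitrary congruence subgroup of Γ_2 = Sp_2(Z) of index t := [Γ_2 : Γ]. If f is a Siegel modular form of degree 2 and weight k for Γ with p-integral rational Fourier coefficients, and a_f([[m, r/2],[r/2, n]]) ≡ 0 (mod p) for all m, n, r with 0 ≤ m ≤ (kt+2)/10, 0 ≤ n ≤ (3kt+1)/30 and mn − r²/4 ≥ 0, then all Fourier coefficients of f are ≡ 0 (mod p). -/

import Mathlib

open Complex Matrix
open scoped ComplexOrder

noncomputable section

/-- `√d_K` for an imaginary quadratic discriminant `d < 0`,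
taken as `√|d| · i` in the upper half plane. -/
def sqrtD (d : ℤ) : ℂ := Real.sqrt (-d) * Complex.I

/-- The ring of integers `O_K = ℤ[(d + √d)/2]` of the imaginary quadratic field of
discriminant `d`, viewed as a subset of `ℂ`. -/
def ringInt (d : ℤ) : Set ℂ :=
  {z | ∃ a b : ℤ, z = (a : ℂ) + (b : ℂ) * (((d : ℂ) + sqrtD d) / 2)}

/-- The inverse different `D_K⁻¹ = O_K / √d_K`. -/
def invDiff (d : ℤ) : Set ℂ := {z | sqrtD d * z ∈ ringInt d}

/-- The Hermitian upper half-space of degree 2: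
`Z` with `(Z - ᵗZ̄)/(2i)` positive definite. -/
def HermitianUpperHalfSpace : Set (Matrix (Fin 2) (Fin 2) ℂ) :=
  {Z | ((Z - Zᴴ).map (fun w => w / (2 * Complex.I))).PosDef}

/-- The lattice `Λ₂(K)`: Hermitian matrices with integral diagonal and
`√d_K ·`(off-diagonal entries) in `O_K`. -/
def LambdaH (d : ℤ) : Set (Matrix (Fin 2) (Fin 2) ℂ) :=
  {H | H.IsHermitian ∧ (∀ i, ∃ n : ℤ, H i i = (n : ℂ)) ∧
    ∀ i j, sqrtD d * H i j ∈ ringInt d}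

/-- Semi-positive elements of `Λ₂(K)`, the index set of Fourier expansions. -/
def HermLattice (d : ℤ) : Set (Matrix (Fin 2) (Fin 2) ℂ) :=
  {H | H ∈ LambdaH d ∧ H.PosSemidef}

/-- The symplectic-form matrix `J₂ = [[0, -1], [1, 0]]` (2×2 blocks). -/
def J2 : Matrix (Fin 2 ⊕ Fin 2) (Fin 2 ⊕ Fin 2) ℂ :=
  Matrix.fromBlocks 0 (-1) 1 0

/-- The Hermitian modular group `U₂(O_K)`:
matrices with entries in `O_K` satisfying `ᵗM̄ J₂ M = J₂`. -/
def HermitianModularGroup (d : ℤ) : Set (Matrix (Fin 2 ⊕ Fin 2) (Fin 2 ⊕ Fin 2) ℂ) :=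
  {M | (∀ i j, M i j ∈ ringInt d) ∧ Mᴴ * J2 * M = J2}

/-- The fractional-linear action `Z ↦ (AZ + B)(CZ + D)⁻¹`. -/
def matAct (M : Matrix (Fin 2 ⊕ Fin 2) (Fin 2 ⊕ Fin 2) ℂ)
    (Z : Matrix (Fin 2) (Fin 2) ℂ) : Matrix (Fin 2) (Fin 2) ℂ :=
  (M.toBlocks₁₁ * Z + M.toBlocks₁₂) * (M.toBlocks₂₁ * Z + M.toBlocks₂₂)⁻¹

/-- The character `ν_k`: `det^{k/2}` for `K = ℚ(√-1)` (i.e. `d = -4`, `k` even),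
and `det^k` for `K = ℚ(√-3)` (i.e. `d = -3`). -/
def nuChar (d k : ℤ) (M : Matrix (Fin 2 ⊕ Fin 2) (Fin 2 ⊕ Fin 2) ℂ) : ℂ :=
  if d = -4 then M.det ^ (k / 2) else M.det ^ k

/-- A Hermitian modular form of degree 2, weight `k` and character `ν_k` for `U₂(O_K)`,
bundled with its Fourier expansion over the semi-positive part of `Λ₂(K)`. -/
structure HermitianModularForm (d k : ℤ) where
  toFun : Matrix (Fin 2) (Fin 2) ℂ → ℂ
  coeff : Matrix (Fin 2) (Fin 2) ℂ → ℂ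
  holo : DifferentiableOn ℂ (fun Z : Fin 2 → Fin 2 → ℂ => toFun (Matrix.of Z))
    {Z | Matrix.of Z ∈ HermitianUpperHalfSpace}
  transform : ∀ M ∈ HermitianModularGroup d, ∀ Z ∈ HermitianUpperHalfSpace,
    toFun (matAct M Z) =
      nuChar d k M * (M.toBlocks₂₁ * Z + M.toBlocks₂₂).det ^ k * toFun Z
  coeff_supported : ∀ H, coeff H ≠ 0 → H ∈ HermLattice d
  expansion : ∀ Z ∈ HermitianUpperHalfSpace,
    HasSum (fun H : HermLattice d =>
      coeff H * Complex.exp (2 * Real.pi * Complex.I * ((H : Matrix (Fin 2) (Fin 2) ℂ) * Z).trace))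
      (toFun Z)

/-- A Hermitian modular form is symmetric if `f(ᵗZ) = f(Z)`. -/
def IsSymmetricHMF {d k : ℤ} (f : HermitianModularForm d k) : Prop :=
  ∀ Z ∈ HermitianUpperHalfSpace, f.toFun Zᵀ = f.toFun Z

/-- `z` is a `p`-integral rational number: `z = a/b` with `p ∤ b`. -/
def IsPIntegral (p : ℕ) (z : ℂ) : Prop :=
  ∃ a b : ℤ, ¬ (p : ℤ) ∣ b ∧ (b : ℂ) * z = (a : ℂ)

/-- `z ≡ w (mod p^l)` in the local ring `ℤ_(p)`, i.e. `(z - w)/p^l` is `p`-integral. -/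
def ModCongr (p l : ℕ) (z w : ℂ) : Prop :=
  IsPIntegral p ((z - w) / (p : ℂ) ^ l)


/-- The lexicographic order on `Λ₂(K)` used to define `ord_p`:
compare first `tr H`, then the `(1,1)`-entry `m`, then (for off-diagonal entry
`(a + b i)/2`) first `a`, then `b`. -/
def lexLt (H H' : Matrix (Fin 2) (Fin 2) ℂ) : Prop :=
  H.trace.re < H'.trace.re ∨
    (H.trace = H'.trace ∧
      ((H 0 0).re < (H' 0 0).re ∨
        (H 0 0 = H' 0 0 ∧
          ((H 0 1).re < (H' 0 1).re ∨
            ((H 0 1).re = (H' 0 1).re ∧ (H 0 1).im < (H' 0 1).im)))))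

/-- The Siegel upper half-space of degree `n`: symmetric complex matrices with
positive definite imaginary part. -/
def SiegelUpperHalfSpace (n : ℕ) : Set (Matrix (Fin n) (Fin n) ℂ) :=
  {Z | Z.IsSymm ∧ ((Z - Zᴴ).map (fun w => w / (2 * Complex.I))).PosDef}

/-- The symplectic-form matrix over `ℤ` in degree `n`. -/
def Jn (n : ℕ) : Matrix (Fin n ⊕ Fin n) (Fin n ⊕ Fin n) ℤ :=
  Matrix.fromBlocks 0 (-1) 1 0

/-- The Siegel modular group `Γ_n = Sp_n(ℤ)` (as a set of `2n × 2n` integer matrices). -/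
def SiegelModularGroup (n : ℕ) : Set (Matrix (Fin n ⊕ Fin n) (Fin n ⊕ Fin n) ℤ) :=
  {M | Mᵀ * Jn n * M = Jn n}

/-- The fractional-linear action of an integral symplectic matrix on the Siegel
upper half-space. -/
def matActS {n : ℕ} (M : Matrix (Fin n ⊕ Fin n) (Fin n ⊕ Fin n) ℤ)
    (Z : Matrix (Fin n) (Fin n) ℂ) : Matrix (Fin n) (Fin n) ℂ :=
  ((M.map (fun a => (a : ℂ))).toBlocks₁₁ * Z + (M.map (fun a => (a : ℂ))).toBlocks₁₂) *
    ((M.map (fun a => (a : ℂ))).toBlocks₂₁ * Z + (M.map (fun a => (a : ℂ))).toBlocks₂₂)⁻¹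

/-- The index lattice of Fourier expansions of Siegel modular forms of level `N`:
semi-positive symmetric rational matrices `T` with `N·T` half-integral,
i.e. `T ∈ (1/N)Λ_n`. -/
def SiegelLattice (n : ℕ) (N : ℕ) : Set (Matrix (Fin n) (Fin n) ℚ) :=
  {T | T.IsSymm ∧ (∀ i, ∃ a : ℤ, (N : ℚ) * T i i = (a : ℚ)) ∧
    (∀ i j, ∃ a : ℤ, 2 * (N : ℚ) * T i j = (a : ℚ)) ∧
    (T.map (fun q => (q : ℝ))).PosSemidef}

/-- A Siegel modular form of degree `n` and weight `k` for a subgroup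
`Γ ⊆ Γ_n = Sp_n(ℤ)` of level `N`, bundled with its Fourier expansion. For the
full modular group take `Γ = SiegelModularGroup n` and `N = 1`. -/
structure SiegelModularForm (n : ℕ) (k : ℤ)
    (Γ : Set (Matrix (Fin n ⊕ Fin n) (Fin n ⊕ Fin n) ℤ)) (N : ℕ) where
  toFun : Matrix (Fin n) (Fin n) ℂ → ℂ
  coeff : Matrix (Fin n) (Fin n) ℚ → ℂ
  holo : DifferentiableOn ℂ (fun Z : Fin n → Fin n → ℂ => toFun (Matrix.of Z))
    {Z | Matrix.of Z ∈ SiegelUpperHalfSpace n}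
  transform : ∀ M ∈ Γ, ∀ Z ∈ SiegelUpperHalfSpace n,
    toFun (matActS M Z) =
      ((M.map (fun a => (a : ℂ))).toBlocks₂₁ * Z +
        (M.map (fun a => (a : ℂ))).toBlocks₂₂).det ^ k * toFun Z
  coeff_supported : ∀ T, coeff T ≠ 0 → T ∈ SiegelLattice n N
  expansion : ∀ Z ∈ SiegelUpperHalfSpace n,
    HasSum (fun T : SiegelLattice n N =>
      coeff T * Complex.exp (2 * Real.pi * Complex.I *
        (((T : Matrix (Fin n) (Fin n) ℚ).map (fun q => (q : ℂ))) * Z).trace))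
      (toFun Z)


/-- A Hermitian cusp form (degree 2, class number one field): the Fourier
coefficients vanish off the positive definite part of the lattice. -/
def IsCuspHMF {d k : ℤ} (f : HermitianModularForm d k) : Prop :=
  ∀ H, ¬ H.PosDef → f.coeff H = 0

/-- `H0 = ord_p f`: `H0` is the minimal element of `Λ₂(K)`, in the lexicographic
order `lexLt`, whose Fourier coefficient is not divisible by `p`. -/
def IsOrdP (p : ℕ) {d k : ℤ} (f : HermitianModularForm d k)
    (H0 : Matrix (Fin 2) (Fin 2) ℂ) : Prop :=
  H0 ∈ HermLattice d ∧ ¬ ModCongr p 1 (f.coeff H0) 0 ∧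
    ∀ H ∈ HermLattice d, lexLt H H0 → ModCongr p 1 (f.coeff H) 0

namespace SiegelSturm

section

/-! ### Evaluation of formal power series in several variables -/

section Eval

variable {σ : Type*}

section Evaluation

variable [Fintype σ]

/-- The monomial `x ^ α`. -/
def monom (x : σ → ℂ) (α : σ →₀ ℕ) : ℂ := ∏ i, x i ^ α i

/-- The formal power series `F` converges absolutely at `x`, with sum `v`. -/
def EvalsTo (F : MvPowerSeries σ ℂ) (x : σ → ℂ) (v : ℂ) : Prop :=
  HasSum (fun α => MvPowerSeries.coeff α F * monom x α) v

/-- The sum of the absolute values of the terms of `F` at `x`. -/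
def absSum (F : MvPowerSeries σ ℂ) (x : σ → ℂ) : ℝ :=
  ∑' α, ‖MvPowerSeries.coeff α F * monom x α‖

/-- The formal power series `F` converges absolutely at `x`. -/
def AbsConv (F : MvPowerSeries σ ℂ) (x : σ → ℂ) : Prop :=
  Summable fun α => ‖MvPowerSeries.coeff α F * monom x α‖

lemma monom_add (x : σ → ℂ) (α β : σ →₀ ℕ) : monom x (α + β) = monom x α * monom x β := by
  simp [monom, pow_add, Finset.prod_mul_distrib]

lemma monom_zero (x : σ → ℂ) : monom x 0 = 1 := by simp [monom]

lemma EvalsTo.absConv {F : MvPowerSeries σ ℂ} {x : σ → ℂ} {v : ℂ} (h : EvalsTo F x v) :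
    AbsConv F x := h.summable.norm

lemma AbsConv.evalsTo {F : MvPowerSeries σ ℂ} {x : σ → ℂ} (h : AbsConv F x) :
    ∃ v, EvalsTo F x v := ⟨_, (Summable.of_norm h).hasSum⟩

lemma EvalsTo.unique {F : MvPowerSeries σ ℂ} {x : σ → ℂ} {v w : ℂ} (h : EvalsTo F x v)
    (h' : EvalsTo F x w) : v = w := HasSum.unique h h'

lemma EvalsTo.add {F G : MvPowerSeries σ ℂ} {x : σ → ℂ} {v w : ℂ} (hF : EvalsTo F x v)
    (hG : EvalsTo G x w) : EvalsTo (F + G) x (v + w) := by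
  simpa [EvalsTo, add_mul] using HasSum.add hF hG

lemma EvalsTo.neg {F : MvPowerSeries σ ℂ} {x : σ → ℂ} {v : ℂ} (hF : EvalsTo F x v) :
    EvalsTo (-F) x (-v) := by
  simpa [EvalsTo] using HasSum.neg hF

lemma EvalsTo.sub {F G : MvPowerSeries σ ℂ} {x : σ → ℂ} {v w : ℂ} (hF : EvalsTo F x v)
    (hG : EvalsTo G x w) : EvalsTo (F - G) x (v - w) := by
  simpa [sub_eq_add_neg] using hF.add hG.neg

lemma EvalsTo.smul {F : MvPowerSeries σ ℂ} {x : σ → ℂ} {v : ℂ} (c : ℂ) (hF : EvalsTo F x v) :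
    EvalsTo (c • F) x (c * v) := by
  simpa [EvalsTo, mul_assoc] using HasSum.mul_left c hF

lemma evalsTo_monomial (α : σ →₀ ℕ) (c : ℂ) (x : σ → ℂ) :
    EvalsTo (MvPowerSeries.monomial α c) x (c * monom x α) := by
  classical
  have := hasSum_single (f := fun β => MvPowerSeries.coeff β (MvPowerSeries.monomial α c) *
    monom x β) α (fun β hβ => by simp [MvPowerSeries.coeff_monomial, hβ])
  simpa [EvalsTo, MvPowerSeries.coeff_monomial] using this

lemma evalsTo_zero (x : σ → ℂ) : EvalsTo (0 : MvPowerSeries σ ℂ) x 0 := by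
  simp [EvalsTo, hasSum_zero]

lemma evalsTo_one (x : σ → ℂ) : EvalsTo (1 : MvPowerSeries σ ℂ) x 1 := by
  have := evalsTo_monomial 0 1 x
  rwa [monom_zero, mul_one] at this

lemma evalsTo_X (i : σ) (x : σ → ℂ) : EvalsTo (MvPowerSeries.X i) x (x i) := by
  classical
  have := evalsTo_monomial (Finsupp.single i 1) 1 x
  have h : monom x (Finsupp.single i 1) = x i := by
    rw [monom, Finset.prod_eq_single i] <;> simp +contextual [eq_comm]
  rwa [h, one_mul] at this

lemma hasSum_mul_antidiagonal {f g : (σ →₀ ℕ) → ℂ} {v w : ℂ} [DecidableEq σ]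
    (hf : HasSum f v) (hg : HasSum g w) :
    HasSum (fun α => ∑ p ∈ Finset.HasAntidiagonal.antidiagonal α, f p.1 * g p.2) (v * w) ∧
    Summable (fun α => ∑ p ∈ Finset.HasAntidiagonal.antidiagonal α, ‖f p.1‖ * ‖g p.2‖) ∧
    ∑' α, ∑ p ∈ Finset.HasAntidiagonal.antidiagonal α, ‖f p.1‖ * ‖g p.2‖ =
      (∑' α, ‖f α‖) * ∑' α, ‖g α‖ := by
  have key : ∀ {R : Type} [NormedRing R] [CompleteSpace R] {f g : (σ →₀ ℕ) → R} {v w : R},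
      HasSum f v → HasSum g w → Summable (fun x => ‖f x‖) → Summable (fun x => ‖g x‖) →
      HasSum (fun α => ∑ p ∈ Finset.HasAntidiagonal.antidiagonal α, f p.1 * g p.2) (v * w) := by
    intro R _ _ f g v w hf hg hf' hg'
    have h1 : HasSum (fun p : (σ →₀ ℕ) × (σ →₀ ℕ) => f p.1 * g p.2) (v * w) :=
      hf.mul hg (summable_mul_of_summable_norm hf' hg')
    rw [← Finset.HasAntidiagonal.sigmaAntidiagonalEquivProd.hasSum_iff] at h1
    have h2 := h1.sigma
      (g := fun α => ∑ p ∈ Finset.HasAntidiagonal.antidiagonal α, f p.1 * g p.2) ?_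
    · exact h2
    · intro α
      have := hasSum_fintype (fun p : Finset.HasAntidiagonal.antidiagonal α => f p.1.1 * g p.1.2)
      rw [Finset.sum_coe_sort (Finset.HasAntidiagonal.antidiagonal α)
        (fun p => f p.1 * g p.2)] at this
      exact this
  have hf' := hf.summable.norm
  have hg' := hg.summable.norm
  refine ⟨key hf hg hf' hg', ?_⟩
  have := key hf'.hasSum hg'.hasSum (by simpa using hf') (by simpa using hg')
  exact ⟨this.summable, this.tsum_eq⟩

lemma coeff_mul_monom (F G : MvPowerSeries σ ℂ) (x : σ → ℂ) (α : σ →₀ ℕ) [DecidableEq σ] :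
    MvPowerSeries.coeff α (F * G) * monom x α =
      ∑ p ∈ Finset.HasAntidiagonal.antidiagonal α, (MvPowerSeries.coeff p.1 F * monom x p.1) *
        (MvPowerSeries.coeff p.2 G * monom x p.2) := by
  rw [MvPowerSeries.coeff_mul, Finset.sum_mul]
  refine Finset.sum_congr rfl fun p hp => ?_
  rw [← Finset.HasAntidiagonal.mem_antidiagonal.mp hp, monom_add]
  ring

lemma EvalsTo.mul {F G : MvPowerSeries σ ℂ} {x : σ → ℂ} {v w : ℂ} (hF : EvalsTo F x v)
    (hG : EvalsTo G x w) : EvalsTo (F * G) x (v * w) := by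
  classical
  simpa [EvalsTo, coeff_mul_monom] using (hasSum_mul_antidiagonal hF hG).1

lemma absSum_mul_le {F G : MvPowerSeries σ ℂ} {x : σ → ℂ} (hF : AbsConv F x)
    (hG : AbsConv G x) : absSum (F * G) x ≤ absSum F x * absSum G x := by
  classical
  obtain ⟨v, hv⟩ := hF.evalsTo
  obtain ⟨w, hw⟩ := hG.evalsTo
  have h := hasSum_mul_antidiagonal hv hw
  have hFG := (hv.mul hw).absConv
  rw [absSum, absSum, absSum, ← h.2.2]
  refine Summable.tsum_le_tsum (fun α => ?_) hFG h.2.1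
  rw [coeff_mul_monom]
  refine (norm_sum_le _ _).trans (le_of_eq ?_)
  simp

lemma EvalsTo.pow {F : MvPowerSeries σ ℂ} {x : σ → ℂ} {v : ℂ} (hF : EvalsTo F x v) (n : ℕ) :
    EvalsTo (F ^ n) x (v ^ n) := by
  induction n with
  | zero => simpa using evalsTo_one x
  | succ n ih => simpa [pow_succ] using ih.mul hF

lemma evalsTo_sum {ι : Type*} (s : Finset ι) {F : ι → MvPowerSeries σ ℂ} {x : σ → ℂ}
    {v : ι → ℂ} (h : ∀ i ∈ s, EvalsTo (F i) x (v i)) :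
    EvalsTo (∑ i ∈ s, F i) x (∑ i ∈ s, v i) := by
  have := hasSum_sum (f := fun i α => MvPowerSeries.coeff α (F i) * monom x α) (s := s) h
  simpa [EvalsTo, Finset.sum_mul] using this

lemma evalsTo_prod {ι : Type*} (s : Finset ι) {F : ι → MvPowerSeries σ ℂ} {x : σ → ℂ}
    {v : ι → ℂ} (h : ∀ i ∈ s, EvalsTo (F i) x (v i)) :
    EvalsTo (∏ i ∈ s, F i) x (∏ i ∈ s, v i) := by
  classical
  induction s using Finset.induction_on with
  | empty => simpa using evalsTo_one x
  | insert a s ha ih =>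
    rw [Finset.prod_insert ha, Finset.prod_insert ha]
    exact (h a (by simp)).mul (ih fun i hi => h i (by simp [hi]))

lemma absSum_prod_le {ι : Type*} (s : Finset ι) {F : ι → MvPowerSeries σ ℂ} {x : σ → ℂ}
    (h : ∀ i, AbsConv (F i) x) :
    absSum (∏ i ∈ s, F i) x ≤ ∏ i ∈ s, absSum (F i) x := by
  classical
  choose v hv using fun i => (h i).evalsTo
  induction s using Finset.induction_on with
  | empty =>
    have h1 : absSum (1 : MvPowerSeries σ ℂ) x = 1 := by
      rw [absSum, tsum_eq_single 0]
      · simp [monom_zero]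
      · intro α hα
        simp [MvPowerSeries.coeff_one, hα]
    simp [h1]
  | insert a s ha ih =>
    rw [Finset.prod_insert ha, Finset.prod_insert ha]
    refine (absSum_mul_le (h a) (evalsTo_prod s fun i _ => hv i).absConv).trans ?_
    exact mul_le_mul_of_nonneg_left ih (tsum_nonneg fun _ => norm_nonneg _)

/-- Absolute convergence is inherited by points of smaller absolute value. -/
lemma AbsConv.mono {F : MvPowerSeries σ ℂ} {x y : σ → ℂ} (h : AbsConv F x)
    (hxy : ∀ i, ‖y i‖ ≤ ‖x i‖) : AbsConv F y := by
  refine Summable.of_nonneg_of_le (fun _ => norm_nonneg _) (fun α => ?_) h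
  rw [norm_mul, norm_mul]
  refine mul_le_mul_of_nonneg_left ?_ (norm_nonneg _)
  rw [monom, monom, norm_prod, norm_prod]
  refine Finset.prod_le_prod (fun _ _ => norm_nonneg _) fun i _ => ?_
  rw [norm_pow, norm_pow]
  exact pow_le_pow_left₀ (norm_nonneg _) (hxy i) _

end Evaluation

/-! ### Infinite products -/

/-- The formal infinite product `∏ (1 + u n)`. -/
def formalProd (u : ℕ → MvPowerSeries σ ℂ) : MvPowerSeries σ ℂ :=
  fun α => ∑' s : Finset ℕ, MvPowerSeries.coeff α (∏ n ∈ s, u n)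

lemma coeff_formalProd (u : ℕ → MvPowerSeries σ ℂ) (α : σ →₀ ℕ) :
    MvPowerSeries.coeff α (formalProd u) =
      ∑' s : Finset ℕ, MvPowerSeries.coeff α (∏ n ∈ s, u n) := rfl

lemma coeff_prod_mem (R : Subring ℂ) {ι : Type*} (s : Finset ι) (F : ι → MvPowerSeries σ ℂ)
    (h : ∀ i ∈ s, ∀ α, MvPowerSeries.coeff α (F i) ∈ R) (α : σ →₀ ℕ) :
    MvPowerSeries.coeff α (∏ i ∈ s, F i) ∈ R := by
  classical
  rw [MvPowerSeries.coeff_prod]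
  exact R.sum_mem fun l _ => R.prod_mem fun i hi => h i hi _

lemma coeff_formalProd_mem (R : Subring ℂ) (u : ℕ → MvPowerSeries σ ℂ) (i₀ : σ)
    (hu : ∀ n α, MvPowerSeries.coeff α (u n) ∈ R)
    (hsupp : ∀ n α, α i₀ ≤ n → MvPowerSeries.coeff α (u n) = 0) (α : σ →₀ ℕ) :
    MvPowerSeries.coeff α (formalProd u) ∈ R := by
  classical
  have hz : ∀ s ∉ (Finset.range (α i₀)).powerset,
      MvPowerSeries.coeff α (∏ n ∈ s, u n) = 0 := by
    intro s hs
    rw [Finset.mem_powerset, Finset.not_subset] at hs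
    obtain ⟨n, hn, hn'⟩ := hs
    rw [Finset.mem_range, not_lt] at hn'
    rw [← Finset.mul_prod_erase s u hn, MvPowerSeries.coeff_mul]
    refine Finset.sum_eq_zero fun p hp => ?_
    rw [hsupp n p.1, zero_mul]
    have : p.1 i₀ + p.2 i₀ = α i₀ := by
      rw [← Finset.HasAntidiagonal.mem_antidiagonal.mp hp]; rfl
    omega
  change ∑' s : Finset ℕ, MvPowerSeries.coeff α (∏ n ∈ s, u n) ∈ R
  rw [tsum_eq_sum hz]
  exact R.sum_mem fun s _ => coeff_prod_mem R s u (fun i _ => hu i) α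

lemma evalsTo_formalProd [Fintype σ] {u : ℕ → MvPowerSeries σ ℂ} {x : σ → ℂ} {v : ℕ → ℂ}
    (hv : ∀ n, EvalsTo (u n) x (v n)) (hs : Summable fun n => absSum (u n) x) :
    EvalsTo (formalProd u) x (∏' n, (1 + v n)) := by
  have hS : Summable fun s : Finset ℕ => ∏ n ∈ s, absSum (u n) x :=
    summable_finsetProd_of_summable_nonneg (fun n => tsum_nonneg fun _ => norm_nonneg _) hs
  have hprod : ∀ s : Finset ℕ, EvalsTo (∏ n ∈ s, u n) x (∏ n ∈ s, v n) :=
    fun s => evalsTo_prod s fun i _ => hv i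
  have hsum : Summable fun q : Finset ℕ × (σ →₀ ℕ) =>
      MvPowerSeries.coeff q.2 (∏ n ∈ q.1, u n) * monom x q.2 := by
    refine Summable.of_norm ?_
    rw [summable_prod_of_nonneg (fun _ => norm_nonneg _)]
    refine ⟨fun s => (hprod s).absConv, ?_⟩
    exact Summable.of_nonneg_of_le (fun s => tsum_nonneg fun _ => norm_nonneg _)
      (fun s => absSum_prod_le s fun i => (hv i).absConv) hS
  have hval : HasSum (fun q : Finset ℕ × (σ →₀ ℕ) =>
      MvPowerSeries.coeff q.2 (∏ n ∈ q.1, u n) * monom x q.2) (∏' n, (1 + v n)) := by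
    have h1 := hsum.hasSum
    have h2 := h1.prod_fiberwise hprod
    rw [tprod_one_add h2.summable, h2.tsum_eq]
    exact h1
  have hcomm : HasSum (fun q : (σ →₀ ℕ) × Finset ℕ =>
      MvPowerSeries.coeff q.1 (∏ n ∈ q.2, u n) * monom x q.1) (∏' n, (1 + v n)) :=
    (Equiv.prodComm (σ →₀ ℕ) (Finset ℕ)).hasSum_iff.mpr hval
  have hfib : ∀ α : σ →₀ ℕ, HasSum (fun s : Finset ℕ =>
      MvPowerSeries.coeff α (∏ n ∈ s, u n) * monom x α)
      (MvPowerSeries.coeff α (formalProd u) * monom x α) := by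
    intro α
    rw [coeff_formalProd]
    by_cases hm : monom x α = 0
    · simp [hm, hasSum_zero]
    have h3 : Summable fun s : Finset ℕ => MvPowerSeries.coeff α (∏ n ∈ s, u n) :=
      (summable_mul_right_iff hm).mp (hcomm.summable.prod_factor α)
    exact h3.hasSum.mul_right _
  exact HasSum.prod_fiberwise hcomm hfib

end Eval

end

section

/-! ### Uniqueness of Fourier expansions -/

section FourierUniqueness

local instance measureSpaceUnitAddCircle : MeasureTheory.MeasureSpace UnitAddCircle :=
  ⟨AddCircle.haarAddCircle⟩

local instance isAddHaarMeasure_unitAddCircle :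
    MeasureTheory.Measure.IsAddHaarMeasure
      (MeasureTheory.volume : MeasureTheory.Measure UnitAddCircle) :=
  inferInstanceAs (MeasureTheory.Measure.IsAddHaarMeasure AddCircle.haarAddCircle)

local instance isProbabilityMeasure_unitAddCircle : MeasureTheory.IsProbabilityMeasure
    (MeasureTheory.volume : MeasureTheory.Measure UnitAddCircle) :=
  inferInstanceAs (MeasureTheory.IsProbabilityMeasure AddCircle.haarAddCircle)

variable {d : Type*} [Fintype d]

lemma eq_zero_of_hasSum_mFourier {ι : Type*} (e : ι → d → ℤ) (he : Function.Injective e)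
    (a : ι → ℂ)
    (h : ∀ x : UnitAddTorus d, HasSum (fun j => a j * UnitAddTorus.mFourier (e j) x) 0)
    (j₀ : ι) : a j₀ = 0 := by
  have hs : Summable a := by
    have := (h 0).summable
    refine this.congr fun j => ?_
    simp [UnitAddTorus.mFourier]
  have hsC : Summable fun j => a j • UnitAddTorus.mFourier (e j) := by
    refine Summable.of_norm ?_
    simpa [norm_smul, UnitAddTorus.mFourier_norm] using hs.norm
  have hC : HasSum (fun j => a j • UnitAddTorus.mFourier (e j)) 0 := by
    have hg : ∑' j, a j • UnitAddTorus.mFourier (e j) = 0 := by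
      ext x
      have := (ContinuousMap.evalCLM ℂ x).hasSum hsC.hasSum
      exact HasSum.unique this (by simpa using! h x)
    rw [← hg]
    exact hsC.hasSum
  have hL := ((innerSL ℂ (UnitAddTorus.mFourierLp 2 (e j₀))).comp
    (ContinuousMap.toLp (E := ℂ) 2 (MeasureTheory.volume : MeasureTheory.Measure (UnitAddTorus d))
      ℂ)).hasSum hC
  classical
  have hon := orthonormal_iff_ite.mp (UnitAddTorus.orthonormal_mFourier (d := d))
  have h1 : HasSum (fun j => if j = j₀ then a j else 0) 0 := by
    have h0 : (0:ℂ) = ((innerSL ℂ (UnitAddTorus.mFourierLp 2 (e j₀))).comp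
      (ContinuousMap.toLp (E := ℂ) 2
        (MeasureTheory.volume : MeasureTheory.Measure (UnitAddTorus d)) ℂ)) 0 := by simp
    rw [h0]
    refine hL.congr_fun fun j => ?_
    have := hon (e j₀) (e j)
    simp only [he.eq_iff] at this
    simp only [ContinuousLinearMap.comp_apply, map_smul, innerSL_apply_apply]
    rw [this]
    by_cases hj : j = j₀
    · simp [hj]
    · simp [hj, Ne.symm hj]
  exact (hasSum_ite_eq j₀ (a j₀)).unique (h1.congr_fun fun j => by
    by_cases hj : j = j₀ <;> simp [hj])

/-- A convergent exponential series with distinct integral frequencies that vanishes identically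
has vanishing coefficients. -/
lemma eq_zero_of_hasSum_exp {ι : Type*} (e : ι → d → ℤ) (he : Function.Injective e)
    (a : ι → ℂ)
    (h : ∀ x : d → ℝ,
      HasSum (fun j => a j * cexp (2 * Real.pi * I * ∑ i, (e j i : ℂ) * (x i : ℂ))) 0)
    (j₀ : ι) : a j₀ = 0 := by
  refine eq_zero_of_hasSum_mFourier e he a (fun x => ?_) j₀
  choose y hy using fun i => QuotientAddGroup.mk_surjective (x i)
  obtain rfl : (fun i => ((y i : ℝ) : UnitAddCircle)) = x := funext hy
  refine (h y).congr_fun fun j => ?_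
  congr 1
  simp only [UnitAddTorus.mFourier, ContinuousMap.coe_mk, fourier_coe_apply]
  rw [← Complex.exp_sum, Finset.mul_sum]
  congr 1
  refine Finset.sum_congr rfl fun i _ => ?_
  simp; ring

end FourierUniqueness

/-- A formal power series that vanishes on a torus is zero. -/
lemma eq_zero_of_evalsTo {σ : Type*} [Fintype σ] {F : MvPowerSeries σ ℂ} (r : σ → ℝ)
    (hr : ∀ i, 0 < r i) (h : ∀ x : σ → ℂ, (∀ i, ‖x i‖ = r i) → EvalsTo F x 0) : F = 0 := by
  ext α
  have key := eq_zero_of_hasSum_exp (fun (α : σ →₀ ℕ) i => (α i : ℤ))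
    (fun α β hαβ => Finsupp.ext fun i => by simpa using congrFun hαβ i)
    (fun α => MvPowerSeries.coeff α F * ((∏ i, r i ^ α i : ℝ) : ℂ)) (fun x => ?_) α
  · have h1 : ((∏ i, r i ^ α i : ℝ) : ℂ) ≠ 0 := by
      rw [Complex.ofReal_ne_zero]
      exact (Finset.prod_pos fun i _ => pow_pos (hr i) _).ne'
    exact (mul_eq_zero.mp key).resolve_right h1
  · refine HasSum.congr_fun (h (fun i => r i * cexp (2 * Real.pi * I * x i)) fun i => ?_) ?_
    · rw [norm_mul, Complex.norm_exp]
      simp [abs_of_pos (hr i)]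
    · intro α
      rw [monom, mul_assoc]
      congr 1
      simp only [mul_pow, Finset.prod_mul_distrib, Complex.ofReal_prod, Complex.ofReal_pow]
      congr 1
      rw [Finset.mul_sum, Complex.exp_sum]
      refine Finset.prod_congr rfl fun i _ => ?_
      rw [← Complex.exp_nat_mul]
      congr 1
      push_cast
      ring

end

section LevelOne

open UpperHalfPlane hiding I
open ModularForm ModularFormClass MatrixGroups EisensteinSeries

/-- The subring `ℤ[1/6]` of `ℂ`. -/
def R6 : Subring ℂ := Subring.closure {(6 : ℂ)⁻¹}

lemma inv_six_mem : (6 : ℂ)⁻¹ ∈ R6 := Subring.subset_closure rfl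

lemma inv_twelve_mem : (12 : ℂ)⁻¹ ∈ R6 := by
  have := R6.mul_mem (natCast_mem R6 3) (R6.mul_mem inv_six_mem inv_six_mem)
  convert this using 1; norm_num

lemma inv_1728_mem : (1728 : ℂ)⁻¹ ∈ R6 := by
  have := R6.pow_mem inv_twelve_mem 3
  convert this using 1; norm_num

lemma int_mem_R6 (n : ℤ) : (n : ℂ) ∈ R6 := intCast_mem R6 n

lemma mul_mem_of_mem_R6 {V : Submodule R6 ℂ} {c x : ℂ} (hc : c ∈ R6) (hx : x ∈ V) :
    c * x ∈ V := V.smul_mem (⟨c, hc⟩ : R6) hx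

lemma powerSeries_coeff_mul_mem (V : Submodule R6 ℂ) {A B : PowerSeries ℂ}
    (hA : ∀ n, A.coeff n ∈ R6) (hB : ∀ n, B.coeff n ∈ V) (n : ℕ) :
    (A * B).coeff n ∈ V := by
  rw [PowerSeries.coeff_mul]
  exact V.sum_mem fun i _ => mul_mem_of_mem_R6 (hA _) (hB _)

lemma powerSeries_coeff_mul_mem_R6 {A B : PowerSeries ℂ}
    (hA : ∀ n, A.coeff n ∈ R6) (hB : ∀ n, B.coeff n ∈ R6) (n : ℕ) :
    (A * B).coeff n ∈ R6 := by
  rw [PowerSeries.coeff_mul]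
  exact R6.sum_mem fun i _ => R6.mul_mem (hA _) (hB _)

lemma powerSeries_coeff_pow_mem_R6 {A : PowerSeries ℂ}
    (hA : ∀ n, A.coeff n ∈ R6) (j n : ℕ) : (A ^ j).coeff n ∈ R6 := by
  induction j generalizing n with
  | zero =>
    rw [pow_zero, PowerSeries.coeff_one]
    split_ifs
    exacts [R6.one_mem, R6.zero_mem]
  | succ j ih => rw [pow_succ]; exact powerSeries_coeff_mul_mem_R6 ih hA n

lemma E₄_coeff_mem (n : ℕ) : (qExpansion 1 E₄).coeff n ∈ R6 := by
  rw [E_qExpansion_coeff _ ⟨2, rfl⟩]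
  split_ifs
  · exact R6.one_mem
  · have : bernoulli 4 = -1/30 := by decide +kernel
    rw [this]
    have h := R6.mul_mem (natCast_mem R6 240) (natCast_mem R6 (ArithmeticFunction.sigma (4 - 1) n))
    convert h using 2
    norm_num

lemma E₆_coeff_mem (n : ℕ) : (qExpansion 1 E₆).coeff n ∈ R6 := by
  rw [E_qExpansion_coeff _ ⟨3, rfl⟩]
  split_ifs
  · exact R6.one_mem
  · have : bernoulli 6 = 1/42 := by decide +kernel
    rw [this]
    have h := R6.mul_mem (intCast_mem R6 (-504))
      (natCast_mem R6 (ArithmeticFunction.sigma (6 - 1) n))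
    convert h using 2
    norm_num

lemma discriminant_qExpansion_eq :
    qExpansion 1 ModularForm.discriminant =
      (1728 : ℂ)⁻¹ • (qExpansion 1 E₄ ^ 3 - qExpansion 1 E₆ ^ 2) := by
  have h : ModularForm.discriminant = ⇑((1728 : ℂ)⁻¹ • (ModularForm.mcast (by decide) (E₄.pow 3) -
      ModularForm.mcast (by decide) (E₆.pow 2) : ModularForm 𝒮ℒ 12)) := by
    ext z
    have := ModularForm.discriminant_eq_E₄_cube_sub_E₆_sq z
    rw [this]
    simp only [FunLike.coe_smul, FunLike.coe_sub, coe_mcast, coe_pow, Pi.smul_apply, Pi.sub_apply,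
      Pi.pow_apply, smul_eq_mul]
    ring
  rw [h, FunLike.coe_smul, ModularForm.qExpansion_smul one_pos one_mem_strictPeriods_SL,
    FunLike.coe_sub, ModularForm.qExpansion_sub one_pos one_mem_strictPeriods_SL,
    coe_mcast, coe_mcast,
    ModularForm.qExpansion_pow one_pos one_mem_strictPeriods_SL,
    ModularForm.qExpansion_pow one_pos one_mem_strictPeriods_SL]

lemma discriminant_coeff_mem (n : ℕ) : (qExpansion 1 ModularForm.discriminant).coeff n ∈ R6 := by
  rw [discriminant_qExpansion_eq, PowerSeries.coeff_smul, map_sub, smul_eq_mul]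
  exact R6.mul_mem inv_1728_mem (R6.sub_mem (powerSeries_coeff_pow_mem_R6 E₄_coeff_mem _ _)
    (powerSeries_coeff_pow_mem_R6 E₆_coeff_mem _ _))

lemma exists_monomial_coeff_mem (w : ℕ) (hw : Even w) (hw4 : 4 ≤ w) :
    ∃ E : ModularForm 𝒮ℒ (w : ℤ), (qExpansion 1 E).coeff 0 = 1 ∧
      ∀ n, (qExpansion 1 E).coeff n ∈ R6 := by
  obtain ⟨a, b, hab⟩ : ∃ a b : ℕ, 4 * a + 6 * b = w := by
    obtain ⟨v, rfl⟩ := hw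
    rcases Nat.even_or_odd v with ⟨u, rfl⟩ | ⟨u, rfl⟩
    · exact ⟨u, 0, by ring⟩
    · exact ⟨u - 1, 1, by omega⟩
  have hq : qExpansion 1 (ModularForm.mcast (Γ := 𝒮ℒ) (b := (w : ℤ)) (by push_cast [← hab]; ring)
      ((E₄.pow a).mul (E₆.pow b))) = qExpansion 1 E₄ ^ a * qExpansion 1 E₆ ^ b := by
    rw [coe_mcast, ModularForm.qExpansion_mul one_pos one_mem_strictPeriods_SL,
      ModularForm.qExpansion_pow one_pos one_mem_strictPeriods_SL,
      ModularForm.qExpansion_pow one_pos one_mem_strictPeriods_SL]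
  refine ⟨ModularForm.mcast (by push_cast [← hab]; ring) ((E₄.pow a).mul (E₆.pow b)), ?_,
    fun n => ?_⟩
  · rw [hq, PowerSeries.coeff_zero_eq_constantCoeff_apply, map_mul, map_pow, map_pow,
      ← PowerSeries.coeff_zero_eq_constantCoeff_apply,
      ← PowerSeries.coeff_zero_eq_constantCoeff_apply,
      E_qExpansion_coeff_zero _ ⟨2, rfl⟩, E_qExpansion_coeff_zero _ ⟨3, rfl⟩]
    simp
  · rw [hq]
    exact powerSeries_coeff_mul_mem_R6 (powerSeries_coeff_pow_mem_R6 E₄_coeff_mem _)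
      (powerSeries_coeff_pow_mem_R6 E₆_coeff_mem _) n

/-- A Sturm bound over `ℤ[1/6]` for level one elliptic modular forms. -/
theorem levelOne_coeff_mem (V : Submodule R6 ℂ) (w : ℤ) (hw : Even w) (f : ModularForm 𝒮ℒ w)
    (h : ∀ n : ℕ, 12 * (n : ℤ) ≤ w → (qExpansion 1 f).coeff n ∈ V) (n : ℕ) :
    (qExpansion 1 f).coeff n ∈ V := by
  induction hW : w.toNat using Nat.strong_induction_on generalizing w n with
  | _ W ih =>
  rcases lt_trichotomy w 0 with hneg | rfl | hpos
  · have := levelOne_neg_weight_eq_zero hneg f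
    rw [this]
    simp [qExpansion_zero]
  · obtain ⟨c, hc⟩ := levelOne_weight_zero_const f
    rcases Nat.eq_zero_or_pos n with rfl | hn
    · exact h 0 (by simp)
    · have : (f : ℍ → ℂ) = c • ⇑(1 : ModularForm 𝒮ℒ 0) := by
        rw [hc]; ext z; simp
      rw [this, ModularForm.qExpansion_smul one_pos one_mem_strictPeriods_SL,
        ModularForm.qExpansion_one, PowerSeries.coeff_smul, PowerSeries.coeff_one,
        if_neg hn.ne']
      simp
  obtain ⟨w, rfl⟩ : ∃ w' : ℕ, w = w' := ⟨w.toNat, by omega⟩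
  have hev : Even w := by exact_mod_cast hw
  by_cases h4 : 4 ≤ w
  swap
  · have : w = 2 := by obtain ⟨u, rfl⟩ := hev; omega
    subst this
    have := (rank_zero_iff_forall_zero.mp levelOne_weight_two_rank_zero) f
    rw [this, FunLike.coe_zero, qExpansion_zero]
    simp
  obtain ⟨E, hE0, hE⟩ := exists_monomial_coeff_mem w hev h4
  have h0 : (qExpansion 1 f).coeff 0 ∈ V := h 0 (by simp)
  set c := (qExpansion 1 f).coeff 0 with hc
  let F : ModularForm 𝒮ℒ (w : ℤ) := f - c • E
  have hq : qExpansion 1 F = qExpansion 1 f - c • qExpansion 1 E := by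
    rw [show (F : ℍ → ℂ) = ⇑f - ⇑(c • E) from rfl,
      ModularForm.qExpansion_sub one_pos one_mem_strictPeriods_SL, FunLike.coe_smul,
      ModularForm.qExpansion_smul one_pos one_mem_strictPeriods_SL]
  have hcusp : (qExpansion 1 F).coeff 0 = 0 := by
    rw [hq, map_sub, PowerSeries.coeff_smul, hE0, ← hc]; simp
  have hcE (m : ℕ) : (c • qExpansion 1 E).coeff m ∈ V := by
    rw [PowerSeries.coeff_smul, smul_eq_mul, mul_comm]
    exact mul_mem_of_mem_R6 (hE m) h0
  have hD := ModularForm.qExpansion_eq_qExpansion_discriminant_mul F hcusp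
  generalize CuspForm.discriminantEquiv (toCuspForm F hcusp) = g at hD
  have hD1 := ModularForm.discriminant_qExpansion_coeff_one
  have hD0 : (qExpansion 1 ModularForm.discriminant).coeff 0 = 0 := by
    exact CuspFormClass.qExpansion_coeff_zero CuspForm.discriminant one_pos one_mem_strictPeriods_SL
  -- the coefficients of the quotient by `Δ`
  have hrec (m : ℕ) : (qExpansion 1 g).coeff m = (qExpansion 1 F).coeff (m + 1) -
      ∑ x ∈ Finset.range m, (qExpansion 1 ModularForm.discriminant).coeff (m + 1 - x) *
        (qExpansion 1 g).coeff x := by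
    rw [hD, mul_comm, PowerSeries.coeff_mul, Finset.Nat.sum_antidiagonal_eq_sum_range_succ_mk,
      Finset.sum_range_succ, Finset.sum_range_succ]
    simp only [Nat.sub_self, hD0, show m + 1 - m = 1 by omega, hD1]
    simp_rw [mul_comm]
    ring
  have hgV : ∀ m : ℕ, 12 * (m : ℤ) ≤ (w : ℤ) - 12 → (qExpansion 1 g).coeff m ∈ V := by
    intro m
    induction m using Nat.strong_induction_on with
    | _ m ihm =>
    intro hm
    rw [hrec]
    refine V.sub_mem ?_ (V.sum_mem fun x hx => mul_mem_of_mem_R6 (discriminant_coeff_mem _)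
      (ihm x (Finset.mem_range.mp hx) ?_))
    · rw [hq, map_sub]
      exact V.sub_mem (h _ (by push_cast; linarith)) (hcE _)
    · have := Finset.mem_range.mp hx
      omega
  have hgall := fun m => ih (w - 12 : ℤ).toNat (by omega) (w - 12) (by
    exact hw.sub (by decide)) g hgV m rfl
  have : (qExpansion 1 f).coeff n = (qExpansion 1 F).coeff n + (c • qExpansion 1 E).coeff n := by
    rw [hq, map_sub]; ring
  rw [this]
  refine V.add_mem ?_ (hcE n)
  rw [hD]
  exact powerSeries_coeff_mul_mem V discriminant_coeff_mem hgall n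

theorem coeff_mem_of_hasSum (V : Submodule R6 ℂ) (w : ℤ) (hw : Even w) (g : ℂ → ℂ) (c : ℕ → ℂ)
    (hg : ∀ τ : ℂ, 0 < τ.im → HasSum (fun n => c n * cexp (2 * Real.pi * I * τ) ^ n) (g τ))
    (hS : ∀ τ : ℂ, 0 < τ.im → g (-1 / τ) = τ ^ w * g τ)
    (h : ∀ n : ℕ, 12 * (n : ℤ) ≤ w → c n ∈ V) (n : ℕ) : c n ∈ V := by
  have hsum (τ : ℍ) : HasSum (fun n => c n • Function.Periodic.qParam 1 (τ : ℂ) ^ n) (g τ) := by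
    simpa [Function.Periodic.qParam] using hg τ τ.im_pos
  have hinv : ∀ γ : SL(2, ℤ), (fun τ : ℍ => g τ) ∣[w] γ = fun τ : ℍ => g τ := by
    refine SlashInvariantForm.slash_action_generators_SL2Z ?_ ?_
    · ext z
      have h1 := hS z z.im_pos
      rw [SL_slash_apply, UpperHalfPlane.modular_S_smul]
      simp only [neg_div, one_div] at h1
      have hz : (z : ℂ) ^ w ≠ 0 := zpow_ne_zero _ z.ne_zero
      rw [ModularGroup.denom_S, UpperHalfPlane.coe_mk, inv_neg, h1, mul_right_comm,
        ← zpow_add₀ z.ne_zero]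
      simp
    · ext z
      rw [SL_slash_apply, modular_T_smul]
      have h1 := hg ((1 : ℝ) +ᵥ z : ℍ) (UpperHalfPlane.im_pos _)
      have h2 := hg z z.im_pos
      have : cexp (2 * Real.pi * I * (((1 : ℝ) +ᵥ z : ℍ) : ℂ)) = cexp (2 * Real.pi * I * z) := by
        rw [UpperHalfPlane.coe_vadd, ofReal_one, mul_add, mul_one, add_comm, exp_periodic]
      rw [this] at h1
      have hd : denom (ModularGroup.T : SL(2, ℤ)) (z : ℂ) = 1 := by
        rw [ModularGroup.denom_apply]
        simp [ModularGroup.T]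
      change g (((1 : ℝ) +ᵥ z : ℍ) : ℂ) * _ = _
      rw [h1.unique h2, hd]
      simp
  have hhol : DifferentiableOn ℂ g {z | 0 < z.im} := by
    intro z hz
    have hz : 0 < z.im := hz
    have hU : IsOpen {v : ℂ | z.im / 2 < v.im} := isOpen_lt continuous_const Complex.continuous_im
    have hs := (hg (((z.im / 2 : ℝ) : ℂ) * I) (by simpa using hz)).summable.norm
    have hd : DifferentiableOn ℂ (fun v => ∑' n, c n * cexp (2 * Real.pi * I * v) ^ n)
        {v : ℂ | z.im / 2 < v.im} := by
      refine differentiableOn_tsum_of_summable_norm hs (fun n => by fun_prop) hU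
        fun n v hv => ?_
      have hv : z.im / 2 < v.im := hv
      rw [norm_mul, norm_mul, norm_pow, norm_pow, Complex.norm_exp, Complex.norm_exp]
      gcongr 2
      simp
      nlinarith [Real.pi_pos]
    have hmem : z ∈ {v : ℂ | z.im / 2 < v.im} := by
      change z.im / 2 < z.im
      linarith
    refine (((hd.differentiableAt (hU.mem_nhds hmem)).congr_of_eventuallyEq
      ?_)).differentiableWithinAt
    filter_upwards [hU.mem_nhds hmem] with v hv
    exact ((hg v (lt_trans (by linarith) hv)).tsum_eq).symm
  let f : ModularForm 𝒮ℒ w :=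
    { toFun := fun τ => g τ
      slash_action_eq' := by
        rintro A ⟨A, rfl⟩
        exact hinv A
      holo' := by
        rw [UpperHalfPlane.mdifferentiable_iff]
        refine hhol.congr fun z hz => ?_
        simp [ofComplex_apply_of_im_pos hz]
      bdd_at_cusps' := by
        intro c hc
        rw [Subgroup.IsArithmetic.isCusp_iff_isCusp_SL2Z] at hc
        rw [OnePoint.isBoundedAt_iff_forall_SL2Z hc]
        intro γ _
        rw [hinv]
        exact isBoundedAtImInfty_of_hasSum_qExpansion one_pos hsum }
  have hc (m : ℕ) : c m = (qExpansion 1 f).coeff m :=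
    (ModularFormClass.qExpansion_coeff_unique one_pos one_mem_strictPeriods_SL hsum m)
  rw [hc]
  exact levelOne_coeff_mem V w hw f (fun n hn => by rw [← hc]; exact h n hn) n

end LevelOne

section

section FormalTheta

/-- The exponent vector with entries `a`, `b`. -/
def pair (a b : ℕ) : Fin 2 →₀ ℕ := Finsupp.equivFunOnFinite.symm ![a, b]

@[simp] lemma pair_zero (a b : ℕ) : pair a b 0 = a := rfl
@[simp] lemma pair_one (a b : ℕ) : pair a b 1 = b := rfl

lemma pair_eta (α : Fin 2 →₀ ℕ) : pair (α 0) (α 1) = α := by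
  ext i; fin_cases i <;> rfl

lemma pair_inj {a b c d : ℕ} : pair a b = pair c d ↔ a = c ∧ b = d := by
  constructor
  · intro h; exact ⟨DFunLike.congr_fun h 0, DFunLike.congr_fun h 1⟩
  · rintro ⟨rfl, rfl⟩; rfl

lemma monom_pair (x : Fin 2 → ℂ) (a b : ℕ) : monom x (pair a b) = x 0 ^ a * x 1 ^ b := by
  simp [monom, Fin.prod_univ_two]

lemma monom_two (x : Fin 2 → ℂ) (α : Fin 2 →₀ ℕ) : monom x α = x 0 ^ α 0 * x 1 ^ α 1 := by
  simp [monom, Fin.prod_univ_two]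

/-- The rational function `w / (1 - w)²`. -/
def yk (w : ℂ) : ℂ := w / (1 - w) ^ 2

/-- The formal expansion of `s · yk (ε q ^ l)`. -/
def formalYk (l : ℕ) (ε : ℤ) : MvPowerSeries (Fin 2) ℂ :=
  fun α => if α 1 = 1 ∧ l ∣ α 0 then (ε : ℂ) ^ (α 0 / l) * ((α 0 / l : ℕ) : ℂ) else 0

lemma coeff_formalYk (l : ℕ) (ε : ℤ) (α : Fin 2 →₀ ℕ) : MvPowerSeries.coeff α (formalYk l ε) =
    if α 1 = 1 ∧ l ∣ α 0 then (ε : ℂ) ^ (α 0 / l) * ((α 0 / l : ℕ) : ℂ) else 0 := rfl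

lemma coeff_formalYk_eq_zero {l n : ℕ} (ε : ℤ) (hl : n < l) (α : Fin 2 →₀ ℕ) (h : α 0 ≤ n) :
    MvPowerSeries.coeff α (formalYk l ε) = 0 := by
  rw [coeff_formalYk, Nat.div_eq_of_lt (lt_of_le_of_lt h hl)]
  simp

lemma hasSum_formalYk_aux {l : ℕ} (hl : 0 < l) (f : (Fin 2 →₀ ℕ) → ℂ) {v : ℂ}
    (hf : ∀ α : Fin 2 →₀ ℕ, ¬ (α 1 = 1 ∧ l ∣ α 0) → f α = 0)
    (h : HasSum (fun k : ℕ => f (pair (l * k) 1)) v) : HasSum f v := by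
  have hinj : Function.Injective fun k : ℕ => pair (l * k) 1 := by
    intro a b hab
    exact Nat.eq_of_mul_eq_mul_left hl (pair_inj.mp hab).1
  refine (hinj.hasSum_iff ?_).mp h
  intro α hα
  refine hf α fun ⟨h1, k, hk⟩ => hα ⟨k, ?_⟩
  change pair (l * k) 1 = α
  rw [← pair_eta α, h1, hk]

lemma evalsTo_formalYk {l : ℕ} (hl : 0 < l) {ε : ℤ} (hε : |ε| = 1) {x : Fin 2 → ℂ}
    (hx : ‖x 0‖ < 1) : EvalsTo (formalYk l ε) x (x 1 * yk (ε * x 0 ^ l)) := by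
  refine hasSum_formalYk_aux hl _ (fun α hα => by rw [coeff_formalYk, if_neg hα, zero_mul]) ?_
  have hn : ‖(ε : ℂ) * x 0 ^ l‖ < 1 := by
    rw [norm_mul, norm_pow, Complex.norm_intCast, ← Int.cast_abs, hε]
    simpa using pow_lt_one₀ (norm_nonneg _) hx hl.ne'
  have := (hasSum_coe_mul_geometric_of_norm_lt_one hn).mul_left (x 1)
  refine this.congr_fun fun k => ?_
  rw [coeff_formalYk, if_pos (by simp), monom_pair, pair_zero, Nat.mul_div_cancel_left _ hl]
  ring

lemma absSum_formalYk_le {l : ℕ} (hl : 0 < l) {ε : ℤ} (hε : |ε| = 1) {x : Fin 2 → ℂ}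
    (hx : ‖x 0‖ < 1) :
    absSum (formalYk l ε) x ≤ ‖x 1‖ / (1 - ‖x 0‖) ^ 2 * ‖x 0‖ ^ l := by
  have hn : ‖‖x 0‖ ^ l‖ < 1 := by
    simpa using pow_lt_one₀ (norm_nonneg _) hx hl.ne'
  have hS : HasSum (fun α => ((‖MvPowerSeries.coeff α (formalYk l ε) * monom x α‖ : ℝ) : ℂ))
      ((‖x 1‖ * (‖x 0‖ ^ l / (1 - ‖x 0‖ ^ l) ^ 2) : ℝ) : ℂ) := by
    refine hasSum_formalYk_aux hl _ (fun α hα => by rw [coeff_formalYk, if_neg hα]; simp) ?_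
    have := (hasSum_coe_mul_geometric_of_norm_lt_one hn).mul_left ‖x 1‖
    refine (Complex.hasSum_ofReal.mpr this).congr_fun ?_
    intro k
    rw [coeff_formalYk, if_pos (by simp), monom_pair, pair_zero, Nat.mul_div_cancel_left _ hl]
    congr 1
    rw [norm_mul, norm_mul, norm_mul, norm_pow, Complex.norm_intCast, ← Int.cast_abs, hε]
    simp [pow_mul]
    ring
  have := (Complex.hasSum_ofReal.mp hS).tsum_eq
  rw [absSum, this, div_mul_eq_mul_div, mul_div_assoc]
  have h1 : ‖x 0‖ ^ l ≤ ‖x 0‖ := pow_le_of_le_one (norm_nonneg _) hx.le hl.ne'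
  have h2 : 0 < 1 - ‖x 0‖ := by linarith
  gcongr

/-- The infinite product `∏ (1 - s · yk (ε q ^ (l n)))`, formally. -/
def formalTP (l : ℕ → ℕ) (ε : ℤ) : MvPowerSeries (Fin 2) ℂ :=
  formalProd fun n => -formalYk (l n) ε

/-- The infinite product `∏ (1 - s · yk (qⁿ w))`. -/
def TP (q w s : ℂ) : ℂ := ∏' n : ℕ, (1 + -(s * yk (q ^ n * w)))

lemma coeff_formalTP_mem {l : ℕ → ℕ} (hl : ∀ n, n < l n) (ε : ℤ) (α : Fin 2 →₀ ℕ) :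
    MvPowerSeries.coeff α (formalTP l ε) ∈ R6 := by
  refine coeff_formalProd_mem R6 _ 0 (fun n α => ?_) (fun n α h => ?_) α
  · rw [map_neg, coeff_formalYk]
    refine R6.neg_mem ?_
    split_ifs
    · exact R6.mul_mem (R6.pow_mem (int_mem_R6 _) _) (natCast_mem R6 _)
    · exact R6.zero_mem
  · rw [map_neg, coeff_formalYk_eq_zero ε (hl n) α h, neg_zero]

lemma evalsTo_formalTP {l : ℕ → ℕ} (hl : ∀ n, n < l n) {ε : ℤ} (hε : |ε| = 1) {x : Fin 2 → ℂ}
    (hx : ‖x 0‖ < 1) {q w : ℂ} (hw : ∀ n, q ^ n * w = ε * x 0 ^ l n) :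
    EvalsTo (formalTP l ε) x (TP q w (x 1)) := by
  have := evalsTo_formalProd (u := fun n => -formalYk (l n) ε) (x := x)
    (fun n => (evalsTo_formalYk (Nat.zero_lt_of_lt (hl n)) hε hx).neg) ?_
  · simpa only [TP, hw, formalTP] using this
  · have hg : Summable fun n : ℕ => ‖x 1‖ / (1 - ‖x 0‖) ^ 2 * ‖x 0‖ ^ n :=
      (summable_geometric_of_lt_one (norm_nonneg _) hx).mul_left _
    refine Summable.of_nonneg_of_le (fun n => tsum_nonneg fun _ => norm_nonneg _) (fun n => ?_) hg
    have h1 : absSum (-formalYk (l n) ε) x = absSum (formalYk (l n) ε) x := by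
      simp [absSum]
    rw [h1]
    refine (absSum_formalYk_le (Nat.zero_lt_of_lt (hl n)) hε hx).trans ?_
    have h2 : 0 < 1 - ‖x 0‖ := by linarith
    gcongr ?_ * ?_
    exact pow_le_pow_of_le_one (norm_nonneg _) hx.le (hl n).le

end FormalTheta

section Pochhammer

/-- The `q`-Pochhammer symbol `∏ (1 - qⁿ w)`. -/
def pp (q w : ℂ) : ℂ := ∏' n : ℕ, (1 + -(q ^ n * w))

lemma summable_pp {q : ℂ} (hq : ‖q‖ < 1) (w : ℂ) : Summable fun n : ℕ => ‖-(q ^ n * w)‖ := by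
  simp only [norm_neg, norm_mul, norm_pow]
  exact (summable_geometric_of_lt_one (norm_nonneg _) hq).mul_right _

lemma pp_ne_zero {q : ℂ} (hq : ‖q‖ < 1) {w : ℂ} (h : ∀ n : ℕ, q ^ n * w ≠ 1) : pp q w ≠ 0 :=
  tprod_one_add_ne_zero_of_summable (fun n hn => h n (by linear_combination -hn))
    (summable_pp hq w)

lemma pp_eq {q : ℂ} (hq : ‖q‖ < 1) (w : ℂ) : pp q w = (1 - w) * pp q (q * w) := by
  rw [pp, tprod_eq_zero_mul']
  · simp [pp, pow_succ, mul_assoc, sub_eq_add_neg]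
  · have := multipliable_one_add_of_summable (summable_pp hq (q * w))
    simpa [pow_succ, mul_assoc] using this

lemma pp_ne_zero_of_norm_lt {q w : ℂ} (hq : ‖q‖ < 1) (hw : ‖w‖ < 1) : pp q w ≠ 0 := by
  refine pp_ne_zero hq fun n hn => ?_
  have := congrArg norm hn
  rw [norm_mul, norm_pow, norm_one] at this
  have h1 : ‖q‖ ^ n ≤ 1 := pow_le_one₀ (norm_nonneg _) hq.le
  nlinarith [norm_nonneg w]

lemma TP_mul_pp {q w ζ : ℂ} (hq : ‖q‖ < 1) (hw : ‖w‖ < 1) (hζ : ζ ≠ 0) :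
    TP q w (ζ + ζ⁻¹ - 2) * pp q w ^ 2 = pp q (w * ζ) * pp q (w * ζ⁻¹) := by
  have hm (v : ℂ) := multipliable_one_add_of_summable (summable_pp hq v)
  have hlt (n : ℕ) : ‖q ^ n * w‖ ≤ ‖w‖ := by
    rw [norm_mul, norm_pow]
    have h1 : ‖q‖ ^ n ≤ 1 := pow_le_one₀ (norm_nonneg _) hq.le
    nlinarith [norm_nonneg w]
  have hne (n : ℕ) : 1 - q ^ n * w ≠ 0 := by
    intro h
    have := hlt n
    rw [← sub_eq_zero.mp h, norm_one] at this
    linarith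
  have hs : Summable fun n : ℕ => ‖-((ζ + ζ⁻¹ - 2) * yk (q ^ n * w))‖ := by
    have hg : Summable fun n : ℕ => ‖ζ + ζ⁻¹ - 2‖ * ((‖q‖ ^ n * ‖w‖) / (1 - ‖w‖) ^ 2) :=
      (((summable_geometric_of_lt_one (norm_nonneg _) hq).mul_right _).div_const _).mul_left _
    refine Summable.of_nonneg_of_le (fun n => norm_nonneg _) (fun n => ?_) hg
    rw [norm_neg, norm_mul, yk, norm_div, norm_mul, norm_pow, norm_pow]
    have h2 : 0 < 1 - ‖w‖ := by linarith
    have h3 : 1 - ‖w‖ ≤ ‖1 - q ^ n * w‖ := by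
      have := norm_sub_norm_le (1 : ℂ) (q ^ n * w)
      rw [norm_one] at this
      linarith [hlt n]
    gcongr
  have hms := multipliable_one_add_of_summable hs
  rw [TP, pp, pp, pp, sq, ← (hm w).tprod_mul (hm w), ← hms.tprod_mul ((hm w).mul (hm w)),
    ← (hm _).tprod_mul (hm _)]
  refine tprod_congr fun n => ?_
  have := hne n
  rw [yk]
  field_simp
  ring

end Pochhammer

end

section PhiA

open Filter Topology

/-- `e(z) = exp(2πiz)`. -/
def ex (z : ℂ) : ℂ := cexp (2 * Real.pi * I * z)

lemma ex_add (z w : ℂ) : ex (z + w) = ex z * ex w := by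
  rw [ex, mul_add, Complex.exp_add, ex, ex]

lemma ex_neg (z : ℂ) : ex (-z) = (ex z)⁻¹ := by
  rw [ex, mul_neg, Complex.exp_neg, ex]

lemma ex_ne_zero (z : ℂ) : ex z ≠ 0 := Complex.exp_ne_zero _

lemma ex_zero : ex 0 = 1 := by simp [ex]

lemma ex_eq_one_iff {z : ℂ} : ex z = 1 ↔ ∃ n : ℤ, z = n := by
  rw [ex, Complex.exp_eq_one_iff]
  have h : (2 * Real.pi * I : ℂ) ≠ 0 := Complex.two_pi_I_ne_zero
  refine exists_congr fun n => ⟨fun hn => ?_, fun hn => ?_⟩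
  · exact mul_left_cancel₀ h (by rw [hn]; ring)
  · rw [hn]; ring

lemma ex_int (n : ℤ) : ex n = 1 := ex_eq_one_iff.mpr ⟨n, rfl⟩

lemma ex_one : ex 1 = 1 := by simpa using ex_int 1

lemma ex_nat_mul (n : ℕ) (z : ℂ) : ex (n * z) = ex z ^ n := by
  rw [ex, ex, ← Complex.exp_nat_mul]; congr 1; ring

lemma ex_int_mul (n : ℤ) (z : ℂ) : ex (n * z) = ex z ^ n := by
  rw [ex, ex, ← Complex.exp_int_mul]; congr 1; ring

lemma norm_ex (z : ℂ) : ‖ex z‖ = Real.exp (-(2 * Real.pi * z.im)) := by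
  rw [ex, Complex.norm_exp]; simp

lemma norm_ex_lt_one {τ : ℂ} (h : 0 < τ.im) : ‖ex τ‖ < 1 := by
  rw [norm_ex, Real.exp_lt_one_iff]
  have := Real.pi_pos
  nlinarith [mul_pos this h]

lemma differentiable_ex : Differentiable ℂ ex := by
  unfold ex; fun_prop

lemma ex_half : ex (1 / 2) = -1 := by
  rw [ex, show 2 * Real.pi * I * (1 / 2) = Real.pi * I by ring, Complex.exp_pi_mul_I]

/-- `ζ - 2 + ζ⁻¹` for `ζ = e(z)`. -/
def sv (z : ℂ) : ℂ := ex z + (ex z)⁻¹ - 2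

lemma sv_zero : sv 0 = 0 := by norm_num [sv, ex_zero]

lemma sv_add_one (z : ℂ) : sv (z + 1) = sv z := by
  rw [sv, sv, ex_add, ex_one, mul_one]

lemma sv_neg (z : ℂ) : sv (-z) = sv z := by
  rw [sv, sv, ex_neg, inv_inv]; ring

lemma sv_eq (z : ℂ) : sv z = (ex z)⁻¹ * (1 - ex z) ^ 2 := by
  have := ex_ne_zero z
  rw [sv]; field_simp; ring

lemma differentiable_sv : Differentiable ℂ sv := by
  have h : sv = fun z => ex z + ex (-z) - 2 := by ext z; rw [sv, ex_neg]
  rw [h]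
  have h1 := differentiable_ex
  have h2 : Differentiable ℂ fun z => ex (-z) := h1.comp differentiable_neg
  fun_prop

lemma sv_surjective (s : ℂ) : ∃ z, sv z = s := by
  obtain ⟨w, hw⟩ := IsAlgClosed.exists_eq_mul_self ((s + 2) ^ 2 - 4)
  have hne : (s + 2 + w) / 2 ≠ 0 := by
    intro h
    have : w = -(s + 2) := by linear_combination 2 * h
    rw [this] at hw
    have : (4 : ℂ) = 0 := by linear_combination -hw
    norm_num at this
  refine ⟨Complex.log ((s + 2 + w) / 2) / (2 * Real.pi * I), ?_⟩
  have hx : ex (Complex.log ((s + 2 + w) / 2) / (2 * Real.pi * I)) = (s + 2 + w) / 2 := by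
    rw [ex, mul_div_cancel₀ _ Complex.two_pi_I_ne_zero, Complex.exp_log hne]
  rw [sv, hx]
  have hne2 : s + 2 + w ≠ 0 := by intro h; apply hne; rw [h]; simp
  field_simp
  linear_combination -hw

lemma tendsto_sv_div_sq : Tendsto (fun z => sv z / z ^ 2) (𝓝[≠] 0) (𝓝 ((2 * Real.pi * I) ^ 2)) := by
  have h1 : HasDerivAt ex (2 * Real.pi * I) 0 := by
    have : HasDerivAt (fun z : ℂ => 2 * Real.pi * I * z) (2 * Real.pi * I) 0 := by
      simpa using (hasDerivAt_id (0 : ℂ)).const_mul (2 * Real.pi * I)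
    have h := this.cexp
    rw [mul_zero, Complex.exp_zero, one_mul] at h
    exact h
  have h2 := (h1.tendsto_slope_zero).pow 2
  have h3 : Tendsto (fun z => (ex z)⁻¹) (𝓝[≠] 0) (𝓝 1) := by
    have : ContinuousAt (fun z => (ex z)⁻¹) 0 :=
      differentiable_ex.continuous.continuousAt.inv₀ (ex_ne_zero 0)
    have := this.tendsto
    rw [ex_zero, inv_one] at this
    exact this.mono_left nhdsWithin_le_nhds
  have h4 := h3.mul h2
  rw [one_mul] at h4
  refine h4.congr' ?_
  filter_upwards [self_mem_nhdsWithin] with z hz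
  have hz : z ≠ 0 := hz
  have := ex_ne_zero z
  rw [sv_eq, zero_add, ex_zero, smul_eq_mul]
  field_simp
  ring

lemma differentiable_of_evalsTo {F : MvPowerSeries (Fin 2) ℂ} {q : ℂ} {v : ℂ → ℂ}
    (h : ∀ s, EvalsTo F ![q, s] (v s)) : Differentiable ℂ v := by
  intro s₀
  have hU : IsOpen (Metric.ball (0 : ℂ) (‖s₀‖ + 1)) := Metric.isOpen_ball
  have hs := (h ((‖s₀‖ + 1 : ℝ) : ℂ)).absConv
  have hd : DifferentiableOn ℂ (fun s => ∑' α, MvPowerSeries.coeff α F * monom ![q, s] α)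
      (Metric.ball (0 : ℂ) (‖s₀‖ + 1)) := by
    refine differentiableOn_tsum_of_summable_norm hs (fun α => ?_) hU fun α s hs => ?_
    · simp only [monom_two, Matrix.cons_val_zero, Matrix.cons_val_one]
      fun_prop
    · have hs : ‖s‖ < ‖s₀‖ + 1 := by simpa using hs
      have h0 : 0 ≤ ‖s₀‖ + 1 := by positivity
      simp only [monom_two, Matrix.cons_val_zero, Matrix.cons_val_one, norm_mul, norm_pow,
        Complex.norm_real, Real.norm_eq_abs, abs_of_nonneg h0]
      gcongr
  have hmem : s₀ ∈ Metric.ball (0 : ℂ) (‖s₀‖ + 1) := by simp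
  refine (hd.differentiableAt (hU.mem_nhds hmem)).congr_of_eventuallyEq ?_
  filter_upwards with s
  exact ((h s).tsum_eq).symm

/-- The square of the normalised theta product, formally. -/
def formalA' : MvPowerSeries (Fin 2) ℂ := formalTP (· + 1) 1 ^ 2

/-- The weak Jacobi form `φ_{-2,1}`. -/
def phiA (τ z : ℂ) : ℂ := sv z * TP (ex τ) (ex τ) (sv z) ^ 2

variable {τ : ℂ}

lemma evalsTo_formalA' (hτ : 0 < τ.im) (s : ℂ) :
    EvalsTo formalA' ![ex τ, s] (TP (ex τ) (ex τ) s ^ 2) := by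
  refine EvalsTo.pow ?_ 2
  exact evalsTo_formalTP (x := ![ex τ, s]) (fun n => Nat.lt_succ_self n) (by simp)
    (by simpa using norm_ex_lt_one hτ) (fun n => by simp [pow_succ])

lemma TP_zero (q w : ℂ) : TP q w 0 = 1 := by simp [TP]

lemma differentiable_phiA (hτ : 0 < τ.im) : Differentiable ℂ (phiA τ) := by
  have h := (differentiable_of_evalsTo (evalsTo_formalA' hτ)).comp differentiable_sv
  exact differentiable_sv.mul h

/-- The square of the odd theta function, up to normalisation. -/
def thetaSq (q ζ : ℂ) : ℂ := ζ⁻¹ * pp q ζ ^ 2 * pp q (q * ζ⁻¹) ^ 2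

lemma phiA_mul_pp (hτ : 0 < τ.im) (z : ℂ) :
    phiA τ z * pp (ex τ) (ex τ) ^ 4 = thetaSq (ex τ) (ex z) := by
  have hq := norm_ex_lt_one hτ
  have h := TP_mul_pp hq hq (ex_ne_zero z)
  rw [phiA, thetaSq, pp_eq hq (ex z), sv_eq]
  rw [← sv, sv_eq] at h
  linear_combination (ex z)⁻¹ * (1 - ex z) ^ 2 * (TP (ex τ) (ex τ) ((ex z)⁻¹ * (1 - ex z) ^ 2) *
    pp (ex τ) (ex τ) ^ 2 + pp (ex τ) (ex τ * ex z) * pp (ex τ) (ex τ * (ex z)⁻¹)) * h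

lemma thetaSq_mul {q ζ : ℂ} (hq : ‖q‖ < 1) (hq0 : q ≠ 0) (hζ : ζ ≠ 0) :
    thetaSq q (ζ * q) = q⁻¹ * ζ⁻¹ ^ 2 * thetaSq q ζ := by
  rw [thetaSq, thetaSq, show q * (ζ * q)⁻¹ = ζ⁻¹ by field_simp, pp_eq hq ζ⁻¹, pp_eq hq ζ,
    mul_comm ζ q]
  field_simp
  ring

lemma pp_ex_ne_zero (hτ : 0 < τ.im) : pp (ex τ) (ex τ) ≠ 0 :=
  pp_ne_zero_of_norm_lt (norm_ex_lt_one hτ) (norm_ex_lt_one hτ)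

lemma phiA_add_one (z : ℂ) : phiA τ (z + 1) = phiA τ z := by
  rw [phiA, phiA, sv_add_one]

lemma phiA_neg (z : ℂ) : phiA τ (-z) = phiA τ z := by
  rw [phiA, phiA, sv_neg]

lemma phiA_add_tau (hτ : 0 < τ.im) (z : ℂ) :
    phiA τ (z + τ) = ex (-(τ + 2 * z)) * phiA τ z := by
  have hp := pow_ne_zero 4 (pp_ex_ne_zero hτ)
  apply mul_right_cancel₀ hp
  rw [mul_assoc, phiA_mul_pp hτ, phiA_mul_pp hτ, ex_add,
    thetaSq_mul (norm_ex_lt_one hτ) (ex_ne_zero _) (ex_ne_zero _), ex_neg, ex_add,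
    show (2 * z) = z + z by ring, ex_add, mul_inv, mul_inv]
  ring

lemma phiA_eq_zero (hτ : 0 < τ.im) {z : ℂ} (hz : phiA τ z = 0) :
    ∃ m n : ℤ, z = m + n * τ := by
  by_contra hcon
  push Not at hcon
  have hq := norm_ex_lt_one hτ
  have h := phiA_mul_pp hτ z
  rw [hz, zero_mul, thetaSq] at h
  have hex := ex_ne_zero z
  refine absurd h.symm (mul_ne_zero (mul_ne_zero (inv_ne_zero hex) (pow_ne_zero 2 ?_))
    (pow_ne_zero 2 ?_))
  · refine pp_ne_zero hq fun n hn => ?_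
    rw [← ex_nat_mul, ← ex_add, ex_eq_one_iff] at hn
    obtain ⟨m, hm⟩ := hn
    exact hcon m (-n) (by push_cast; linear_combination hm)
  · refine pp_ne_zero hq fun n hn => ?_
    rw [← ex_nat_mul, ← ex_neg, ← ex_add, ← ex_add, ex_eq_one_iff] at hn
    obtain ⟨m, hm⟩ := hn
    exact hcon (-m) (n + 1) (by push_cast; linear_combination -hm)

lemma tendsto_TP (hτ : 0 < τ.im) : Tendsto (fun z => TP (ex τ) (ex τ) (sv z) ^ 2) (𝓝[≠] 0)
    (𝓝 1) := by
  have h := ((differentiable_of_evalsTo (evalsTo_formalA' hτ)).comp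
    differentiable_sv).continuous.tendsto 0
  simp only [Function.comp_apply, sv_zero, TP_zero, one_pow] at h
  exact h.mono_left nhdsWithin_le_nhds

lemma tendsto_phiA_div_sq (hτ : 0 < τ.im) :
    Tendsto (fun z => phiA τ z / z ^ 2) (𝓝[≠] 0) (𝓝 ((2 * Real.pi * I) ^ 2)) := by
  have := tendsto_sv_div_sq.mul (tendsto_TP hτ)
  rw [mul_one] at this
  refine this.congr fun z => ?_
  rw [phiA]; ring

end PhiA

section Ellip

open Filter Topology

variable {τ : ℂ}

lemma phiA_zero : phiA τ 0 = 0 := by rw [phiA, sv_zero, zero_mul]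

lemma eventually_phiA_ne_zero (hτ : 0 < τ.im) : ∀ᶠ z in 𝓝[≠] (0 : ℂ), phiA τ z ≠ 0 := by
  have h := (tendsto_phiA_div_sq hτ).eventually_ne (pow_ne_zero 2 Complex.two_pi_I_ne_zero)
  filter_upwards [h] with z hz h0
  rw [h0, zero_div] at hz
  exact hz rfl

lemma periodic_lattice {g : ℂ → ℂ} (h1 : ∀ z, g (z + 1) = g z) (h2 : ∀ z, g (z + τ) = g z)
    (m n : ℤ) (z : ℂ) : g (z + (m + n * τ)) = g z := by
  have e1 : Function.Periodic g 1 := h1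
  have e2 : Function.Periodic g τ := h2
  have a1 := e1.int_mul m
  have a2 := e2.int_mul n
  rw [mul_one] at a1
  rw [← add_assoc, a2, a1]

/-- Every complex number is congruent to a point of the compact fundamental parallelogram. -/
lemma exists_lattice_sub (hτ : 0 < τ.im) (z : ℂ) :
    ∃ m n : ℤ, ∃ x ∈ Set.Icc (0 : ℝ) 1, ∃ y ∈ Set.Icc (0 : ℝ) 1,
      z = (x + y * τ) + (m + n * τ) := by
  set b : ℝ := z.im / τ.im with hb
  set a : ℝ := z.re - b * τ.re with ha
  refine ⟨⌊a⌋, ⌊b⌋, Int.fract a, ⟨Int.fract_nonneg _, (Int.fract_lt_one _).le⟩, Int.fract b,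
    ⟨Int.fract_nonneg _, (Int.fract_lt_one _).le⟩, ?_⟩
  have hz : z = a + b * τ := by
    apply Complex.ext
    · simp [ha]
    · simp [hb, hτ.ne']
  have h1 : ((Int.fract a : ℝ) : ℂ) = a - ⌊a⌋ := by rw [Int.fract]; push_cast; rfl
  have h2 : ((Int.fract b : ℝ) : ℂ) = b - ⌊b⌋ := by rw [Int.fract]; push_cast; rfl
  rw [h1, h2]
  linear_combination hz

lemma dense_compl_lattice (τ : ℂ) : Dense {z : ℂ | ∃ m n : ℤ, z = m + n * τ}ᶜ := by
  apply Set.Countable.dense_compl ℝ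
  have : {z : ℂ | ∃ m n : ℤ, z = m + n * τ} =
      Set.range (fun p : ℤ × ℤ => (p.1 : ℂ) + p.2 * τ) := by
    ext z; simp [eq_comm]
  rw [this]
  exact Set.countable_range _

/-- An entire function with the elliptic transformation behaviour of index `M` whose order of
vanishing at the lattice points is at least `2M` is a multiple of `φ_{-2,1}^M`. -/
lemma eq_mul_phiA_pow (hτ : 0 < τ.im) (M : ℕ) {h : ℂ → ℂ} (hd : Differentiable ℂ h)
    (h1 : ∀ z, h (z + 1) = h z)
    (h2 : ∀ z, h (z + τ) = ex (-(M * (τ + 2 * z))) * h z) {c : ℂ}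
    (hc : Tendsto (fun z => h z / phiA τ z ^ M) (𝓝[≠] 0) (𝓝 c)) (z : ℂ) :
    h z = c * phiA τ z ^ M := by
  classical
  have hAd := differentiable_phiA hτ
  set g : ℂ → ℂ := fun z => if phiA τ z = 0 then c else h z / phiA τ z ^ M with hg
  have g1 : ∀ z, g (z + 1) = g z := fun z => by simp only [hg, phiA_add_one, h1]
  have g2 : ∀ z, g (z + τ) = g z := fun z => by
    have hex := ex_ne_zero (-(τ + 2 * z))
    simp only [hg, phiA_add_tau hτ, h2, mul_eq_zero, hex, false_or]
    split_ifs
    · rfl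
    · rw [mul_pow, ← ex_nat_mul, show (M : ℂ) * -(τ + 2 * z) = -(M * (τ + 2 * z)) by ring,
        mul_div_mul_left _ _ (ex_ne_zero _)]
  have g3 := periodic_lattice g1 g2
  have hne : ∀ z, phiA τ z ≠ 0 → DifferentiableAt ℂ g z := by
    intro z hz
    have hz' : ∀ᶠ w in 𝓝 z, phiA τ w ≠ 0 := hAd.continuous.continuousAt.eventually_ne hz
    have : DifferentiableAt ℂ (fun z => h z / phiA τ z ^ M) z :=
      hd.differentiableAt.div (hAd.differentiableAt.pow M) (pow_ne_zero M hz)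
    refine this.congr_of_eventuallyEq ?_
    filter_upwards [hz'] with w hw
    simp [hg, hw]
  have hg0 : g 0 = c := by simp [hg, phiA_zero]
  have hz0 : DifferentiableAt ℂ g 0 := by
    refine (Complex.analyticAt_of_differentiable_on_punctured_nhds_of_continuousAt
      ?_ ?_).differentiableAt
    · filter_upwards [eventually_phiA_ne_zero hτ] with w hw using hne w hw
    · rw [continuousAt_iff_punctured_nhds, hg0]
      refine hc.congr' ?_
      filter_upwards [eventually_phiA_ne_zero hτ] with w hw
      simp [hg, hw]
  have hgd : Differentiable ℂ g := by
    intro z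
    by_cases hz : phiA τ z = 0
    · obtain ⟨m, n, rfl⟩ := phiA_eq_zero hτ hz
      have hcomp : g = fun w => g (w + (((-m : ℤ) : ℂ) + ((-n : ℤ) : ℂ) * τ)) := by
        ext w; rw [g3]
      rw [hcomp]
      have e : ((m : ℂ) + n * τ) + (((-m : ℤ) : ℂ) + ((-n : ℤ) : ℂ) * τ) = 0 := by
        push_cast; ring
      exact DifferentiableAt.comp (g := g) _ (by rw [e]; exact hz0) (by fun_prop)
    · exact hne z hz
  have hb : Bornology.IsBounded (Set.range g) := by
    have hK : IsCompact ((fun p : ℝ × ℝ => g (p.1 + p.2 * τ)) '' (Set.Icc 0 1 ×ˢ Set.Icc 0 1)) := by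
      refine (isCompact_Icc.prod isCompact_Icc).image ?_
      exact hgd.continuous.comp (by fun_prop)
    refine hK.isBounded.subset ?_
    rintro _ ⟨z, rfl⟩
    obtain ⟨m, n, x, hx, y, hy, hz⟩ := exists_lattice_sub hτ z
    refine ⟨(x, y), ⟨hx, hy⟩, ?_⟩
    rw [hz, g3]
  have hconst : ∀ z, g z = c := fun z => by rw [← hg0]; exact hgd.apply_eq_apply_of_bounded hb z 0
  have hfun : h = fun z => c * phiA τ z ^ M := by
    refine Continuous.ext_on (dense_compl_lattice τ) hd.continuous
      (continuous_const.mul (hAd.continuous.pow M)) fun z hz => ?_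
    have hz' : phiA τ z ≠ 0 := fun h0 => hz (phiA_eq_zero hτ h0)
    have := hconst z
    simp only [hg, hz', if_false] at this
    rw [← this, div_mul_cancel₀ _ (pow_ne_zero M hz')]
  exact congrFun hfun z

lemma im_neg_one_div (hτ : 0 < τ.im) : 0 < (-1 / τ).im := by
  have : τ ≠ 0 := by rintro rfl; simp at hτ
  rw [neg_div, Complex.neg_im, one_div, Complex.inv_im]
  have := Complex.normSq_pos.2 this
  simp only [neg_div, neg_neg]
  positivity

lemma ne_zero_of_im_pos (hτ : 0 < τ.im) : τ ≠ 0 := by rintro rfl; simp at hτ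

lemma phiA_sub_tau (hτ : 0 < τ.im) (z : ℂ) :
    phiA τ (z - τ) = ex (-(τ - 2 * z)) * phiA τ z := by
  rw [← phiA_neg, neg_sub, show τ - z = -z + τ by ring, phiA_add_tau hτ, phiA_neg]
  congr 2; ring

lemma phiA_S (hτ : 0 < τ.im) (z : ℂ) :
    phiA (-1 / τ) (z / τ) = τ⁻¹ ^ 2 * ex (z ^ 2 / τ) * phiA τ z := by
  have hτ' := im_neg_one_div hτ
  have h0 := ne_zero_of_im_pos hτ
  set h : ℂ → ℂ := fun z => ex (-(z ^ 2 / τ)) * phiA (-1 / τ) (z / τ) with hh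
  have hd : Differentiable ℂ h := by
    refine Differentiable.mul ?_ ?_
    · exact differentiable_ex.comp (by fun_prop)
    · exact (differentiable_phiA hτ').comp (by fun_prop)
  have hsub := phiA_sub_tau hτ'
  have h1 : ∀ z, h (z + 1) = h z := fun z => by
    simp only [hh]
    rw [show (z + 1) / τ = z / τ - -1 / τ by ring, hsub, ← mul_assoc, ← ex_add]
    congr 2
    field_simp
    ring
  have h2 : ∀ z, h (z + τ) = ex (-((1 : ℕ) * (τ + 2 * z))) * h z := fun z => by
    simp only [hh]
    rw [show (z + τ) / τ = z / τ + 1 by field_simp, phiA_add_one, ← mul_assoc, ← ex_add]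
    congr 2
    field_simp
    push_cast
    ring
  have hc : Tendsto (fun z => h z / phiA τ z ^ 1) (𝓝[≠] 0) (𝓝 (τ⁻¹ ^ 2)) := by
    have t1 := tendsto_phiA_div_sq hτ
    have t2 := tendsto_phiA_div_sq hτ'
    have t3 : Tendsto (fun z : ℂ => z / τ) (𝓝[≠] 0) (𝓝[≠] 0) := by
      refine tendsto_nhdsWithin_of_tendsto_nhds_of_eventually_within _ ?_ ?_
      · have : Continuous fun z : ℂ => z / τ := by fun_prop
        have := this.tendsto 0
        rw [zero_div] at this
        exact this.mono_left nhdsWithin_le_nhds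
      · filter_upwards [self_mem_nhdsWithin] with z hz
        exact div_ne_zero hz h0
    have t4 : Tendsto (fun z : ℂ => ex (-(z ^ 2 / τ))) (𝓝[≠] 0) (𝓝 1) := by
      have : Continuous fun z : ℂ => ex (-(z ^ 2 / τ)) :=
        differentiable_ex.continuous.comp (by fun_prop)
      have := this.tendsto 0
      rw [show -((0 : ℂ) ^ 2 / τ) = 0 by simp, ex_zero] at this
      exact this.mono_left nhdsWithin_le_nhds
    have hne := pow_ne_zero 2 Complex.two_pi_I_ne_zero
    have t5 := (t4.mul ((t2.comp t3).div t1 hne)).mul_const (τ⁻¹ ^ 2)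
    rw [div_self hne, one_mul, one_mul] at t5
    refine t5.congr' ?_
    filter_upwards [self_mem_nhdsWithin, eventually_phiA_ne_zero hτ] with z hz hz'
    have hz : z ≠ 0 := hz
    simp only [hh, Function.comp_apply, Pi.div_apply]
    field_simp
  have := eq_mul_phiA_pow hτ 1 hd h1 h2 hc z
  simp only [hh, pow_one] at this
  calc phiA (-1 / τ) (z / τ) = ex (z ^ 2 / τ) * (ex (-(z ^ 2 / τ)) * phiA (-1 / τ) (z / τ)) := by
        rw [← mul_assoc, ← ex_add, add_neg_cancel, ex_zero, one_mul]
    _ = _ := by rw [this]; ring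

end Ellip

section PhiB

open Filter Topology

variable {τ : ℂ}

/-- The subring of power series with coefficients in `ℤ[1/6]`. -/
def S6 (σ : Type*) : Subring (MvPowerSeries σ ℂ) where
  carrier := {F | ∀ α, MvPowerSeries.coeff α F ∈ R6}
  mul_mem' {F G} hF hG α := by
    classical
    rw [MvPowerSeries.coeff_mul]
    exact R6.sum_mem fun p _ => R6.mul_mem (hF _) (hG _)
  one_mem' α := by
    classical
    rw [MvPowerSeries.coeff_one]
    split_ifs
    exacts [R6.one_mem, R6.zero_mem]
  add_mem' {F G} hF hG α := by rw [map_add]; exact R6.add_mem (hF α) (hG α)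
  zero_mem' α := by rw [map_zero]; exact R6.zero_mem
  neg_mem' {F} hF α := by rw [map_neg]; exact R6.neg_mem (hF α)

lemma X_mem_S6 {σ : Type*} (i : σ) : MvPowerSeries.X i ∈ S6 σ := fun α => by
  classical
  rw [MvPowerSeries.coeff_X]
  split_ifs
  exacts [R6.one_mem, R6.zero_mem]

lemma smul_mem_S6 {σ : Type*} {c : ℂ} (hc : c ∈ R6) {F : MvPowerSeries σ ℂ} (hF : F ∈ S6 σ) :
    c • F ∈ S6 σ := fun α => by
  rw [map_smul, smul_eq_mul]; exact R6.mul_mem hc (hF α)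

lemma coeff_mul_mem_of_mem_S6 {σ : Type*} {V : Submodule R6 ℂ} {F G : MvPowerSeries σ ℂ}
    (hF : ∀ α, MvPowerSeries.coeff α F ∈ V) (hG : G ∈ S6 σ) (α : σ →₀ ℕ) :
    MvPowerSeries.coeff α (F * G) ∈ V := by
  classical
  rw [MvPowerSeries.coeff_mul]
  refine V.sum_mem fun p _ => ?_
  rw [mul_comm]
  exact mul_mem_of_mem_R6 (hG _) (hF _)

lemma formalA'_mem : formalA' ∈ S6 (Fin 2) :=
  (S6 _).pow_mem (fun α => coeff_formalTP_mem (fun n => Nat.lt_succ_self n) 1 α) 2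

/-- The part of a power series in `(Q, s)` even in `Q`, as a series in `(Q², s)`. -/
def evenPart (F : MvPowerSeries (Fin 2) ℂ) : MvPowerSeries (Fin 2) ℂ :=
  fun α => MvPowerSeries.coeff (pair (2 * α 0) (α 1)) F

lemma coeff_evenPart (F : MvPowerSeries (Fin 2) ℂ) (α : Fin 2 →₀ ℕ) :
    MvPowerSeries.coeff α (evenPart F) = MvPowerSeries.coeff (pair (2 * α 0) (α 1)) F := rfl

lemma evalsTo_evenPart {F : MvPowerSeries (Fin 2) ℂ} {Q s v w : ℂ} (hv : EvalsTo F ![Q, s] v)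
    (hw : EvalsTo F ![-Q, s] w) : EvalsTo (evenPart F) ![Q ^ 2, s] ((v + w) / 2) := by
  have h := (HasSum.add hv hw).div_const 2
  have hinj : Function.Injective fun α : Fin 2 →₀ ℕ => pair (2 * α 0) (α 1) := by
    intro α β hαβ
    rw [pair_inj] at hαβ
    rw [← pair_eta α, ← pair_eta β, pair_inj]
    omega
  have h2 := (hinj.hasSum_iff ?_).mpr h
  · refine h2.congr_fun fun α => ?_
    simp only [Function.comp_apply, coeff_evenPart, monom_two, Matrix.cons_val_zero,
      Matrix.cons_val_one, pair_zero, pair_one]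
    rw [pow_mul, pow_mul, neg_sq]
    ring
  · intro α hα
    have hodd : Odd (α 0) := by
      rw [← Nat.not_even_iff_odd]
      rintro ⟨r, hr⟩
      refine hα ⟨pair r (α 1), ?_⟩
      simp only [pair_zero, pair_one]
      rw [two_mul, ← hr, pair_eta]
    simp only [monom_two, Matrix.cons_val_zero, Matrix.cons_val_one, hodd.neg_pow]
    ring

/-- Quotients of theta functions with characteristics by their theta constants. -/
def psi (a b : ℤ) (τ z : ℂ) : ℂ :=
  ex (a * z) * phiA τ (z + (a * τ + b) / 2) / phiA τ ((a * τ + b) / 2)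

lemma psi_add_tau (hτ : 0 < τ.im) (a b : ℤ) (z : ℂ) :
    psi a b τ (z + τ) = ex (-(τ + 2 * z)) * psi a b τ z := by
  rw [psi, psi, show z + τ + (a * τ + b) / 2 = z + (a * τ + b) / 2 + τ by ring, phiA_add_tau hτ,
    ← mul_assoc, ← ex_add, show a * (z + τ) + -(τ + 2 * (z + (a * τ + b) / 2)) =
      (-(τ + 2 * z) + a * z) + (-b : ℤ) by push_cast; ring, ex_add, ex_int, ex_add]
  ring

lemma phiA_sub_int (z : ℂ) (a : ℤ) : phiA τ (z - a) = phiA τ z := by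
  have : Function.Periodic (phiA τ) 1 := phiA_add_one
  have := this.sub_int_mul_eq (x := z) a
  rwa [mul_one] at this

lemma psi_S (hτ : 0 < τ.im) (a b : ℤ) (z : ℂ) :
    psi a b (-1 / τ) (z / τ) = ex (z ^ 2 / τ) * psi b a τ z := by
  have h0 := ne_zero_of_im_pos hτ
  have key : ex (a * (z / τ)) * ex ((z + (b * τ - a) / 2) ^ 2 / τ) =
      ex (z ^ 2 / τ) * ex (b * z) * ex (((b * τ - a) / 2) ^ 2 / τ) := by
    rw [← ex_add, ← ex_add, ← ex_add]
    congr 1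
    field_simp
    ring
  have h1 := inv_ne_zero h0
  have h2 := ex_ne_zero (((b * τ - a) / 2) ^ 2 / τ)
  have e1 : phiA τ (z + (b * τ - a) / 2) = phiA τ (z + (b * τ + a) / 2) := by
    rw [← phiA_sub_int (z + (b * τ + a) / 2) a]; congr 1; ring
  have e2 : phiA τ ((b * τ - a) / 2) = phiA τ ((b * τ + a) / 2) := by
    rw [← phiA_sub_int ((b * τ + a) / 2) a]; congr 1; ring
  rw [psi, psi, show z / τ + (a * (-1 / τ) + b) / 2 = (z + (b * τ - a) / 2) / τ by field_simp; ring,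
    show (a * (-1 / τ) + b) / 2 = ((b * τ - a) / 2) / τ by field_simp; ring, phiA_S hτ, phiA_S hτ,
    e1, e2]
  calc _ = (τ⁻¹ ^ 2 * (ex (a * (z / τ)) * ex ((z + (b * τ - a) / 2) ^ 2 / τ)) *
        phiA τ (z + (b * τ + a) / 2)) / (τ⁻¹ ^ 2 * ex (((b * τ - a) / 2) ^ 2 / τ) *
        phiA τ ((b * τ + a) / 2)) := by ring
    _ = (τ⁻¹ ^ 2 * ex (((b * τ - a) / 2) ^ 2 / τ)) * (ex (z ^ 2 / τ) * ex (b * z) *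
        phiA τ (z + (b * τ + a) / 2)) / ((τ⁻¹ ^ 2 * ex (((b * τ - a) / 2) ^ 2 / τ)) *
        phiA τ ((b * τ + a) / 2)) := by rw [key]; ring
    _ = _ := by
      rw [mul_div_mul_left _ _ (mul_ne_zero (pow_ne_zero 2 h1) h2)]
      ring

lemma im_lattice_eq {m n : ℤ} {x y : ℝ} (hτ : 0 < τ.im) (h : (x : ℂ) + y * τ = m + n * τ) :
    x = m ∧ y = n := by
  have h1 := congrArg Complex.im h
  have h2 := congrArg Complex.re h
  simp at h1 h2
  have h3 : y = n := by
    rcases h1 with h1 | h1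
    · exact h1
    · exact absurd h1 hτ.ne'
  exact ⟨by rw [h3] at h2; linarith, h3⟩

lemma half_ne_int (n : ℤ) : (1 / 2 : ℝ) ≠ n := by
  intro h
  have : (1 : ℝ) = ((2 * n : ℤ) : ℝ) := by push_cast; linarith
  have : (1 : ℤ) = 2 * n := by exact_mod_cast this
  omega

lemma phiA_half_ne_zero (hτ : 0 < τ.im) : phiA τ (((0 : ℤ) * τ + (1 : ℤ)) / 2) ≠ 0 := by
  intro h
  obtain ⟨m, n, hmn⟩ := phiA_eq_zero hτ h
  refine half_ne_int m (im_lattice_eq (y := 0) hτ (n := n) ?_).1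
  rw [← hmn]; push_cast; ring

lemma phiA_half_tau_ne_zero (hτ : 0 < τ.im) (b : ℤ) :
    phiA τ (((1 : ℤ) * τ + b) / 2) ≠ 0 := by
  intro h
  obtain ⟨m, n, hmn⟩ := phiA_eq_zero hτ h
  refine half_ne_int n (im_lattice_eq (x := b / 2) hτ (m := m) ?_).2
  rw [← hmn]; push_cast; ring

lemma psi_zero {a b : ℤ} (h : phiA τ ((a * τ + b) / 2) ≠ 0) : psi a b τ 0 = 1 := by
  rw [psi, mul_zero, ex_zero, one_mul, zero_add, div_self h]

lemma psi_zero_one (hτ : 0 < τ.im) (z : ℂ) :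
    psi 0 1 τ z = (sv z + 4) / 4 * TP (ex τ) (-ex τ) (sv z) ^ 2 := by
  have hq := norm_ex_lt_one hτ
  have hq' : ‖-ex τ‖ < 1 := by rwa [norm_neg]
  have key : ∀ z, phiA τ (z + 1 / 2) * pp (ex τ) (ex τ) ^ 4 =
      -(sv z + 4) * (TP (ex τ) (-ex τ) (sv z) * pp (ex τ) (-ex τ) ^ 2) ^ 2 := by
    intro z
    have h1 := TP_mul_pp hq hq (ex_ne_zero (z + 1 / 2))
    have h2 := TP_mul_pp hq hq' (ex_ne_zero z)
    rw [← sv] at h1 h2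
    have e : ex (z + 1 / 2) = -ex z := by rw [ex_add, ex_half]; ring
    have hs : sv (z + 1 / 2) = -(sv z + 4) := by
      rw [sv, sv, e, inv_neg]; ring
    rw [e, inv_neg, mul_neg, mul_neg] at h1
    rw [neg_mul, neg_mul] at h2
    rw [h2, phiA, ← h1, hs]
    ring
  have k0 := key 0
  have kz := key z
  rw [zero_add, sv_zero, TP_zero] at k0
  have hne := phiA_half_ne_zero hτ
  have e : (((0 : ℤ) : ℂ) * τ + (1 : ℤ)) / 2 = 1 / 2 := by push_cast; ring
  have hp := pow_ne_zero 4 (pp_ex_ne_zero hτ)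
  rw [psi, e, Int.cast_zero, zero_mul, ex_zero, one_mul]
  rw [e] at hne
  rw [div_eq_iff hne]
  apply mul_right_cancel₀ hp
  rw [kz, mul_assoc, k0]
  ring

lemma psi_one (hτ : 0 < τ.im) (b : ℤ) (z : ℂ) :
    psi 1 b τ z = TP (ex τ) (ex ((τ + b) / 2)) (sv z) ^ 2 := by
  set w := ex ((τ + b) / 2) with hw
  have hw0 : w ≠ 0 := ex_ne_zero _
  have hww : w * w = ex τ := by
    rw [hw, ← ex_add, show (τ + b) / 2 + (τ + b) / 2 = τ + b by ring, ex_add, ex_int, mul_one]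
  have hwn : ‖w‖ < 1 := norm_ex_lt_one (by simpa using hτ)
  have hq := norm_ex_lt_one hτ
  have key : ∀ z, ex z * phiA τ (z + (τ + b) / 2) * pp (ex τ) (ex τ) ^ 4 =
      w⁻¹ * (TP (ex τ) w (sv z) * pp (ex τ) w ^ 2) ^ 2 := by
    intro z
    have hz := ex_ne_zero z
    have h2 := TP_mul_pp hq hwn hz
    rw [← sv] at h2
    rw [mul_assoc, phiA_mul_pp hτ, thetaSq, ex_add, ← hw,
      show ex τ * (ex z * w)⁻¹ = w * (ex z)⁻¹ by rw [← hww]; field_simp, h2, mul_comm (ex z) w]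
    field_simp
  have k0 := key 0
  have kz := key z
  rw [zero_add, sv_zero, TP_zero, ex_zero] at k0
  have hne := phiA_half_tau_ne_zero hτ b
  have hp := pow_ne_zero 4 (pp_ex_ne_zero hτ)
  rw [Int.cast_one, one_mul] at hne
  rw [psi, Int.cast_one, one_mul, one_mul, div_eq_iff hne]
  apply mul_right_cancel₀ hp
  rw [kz, mul_assoc]
  linear_combination -TP (ex τ) w (sv z) ^ 2 * k0

/-- The weak Jacobi form `φ_{0,1} / 12`. -/
def phiB (τ z : ℂ) : ℂ := 3⁻¹ * (psi 0 1 τ z + (psi 1 0 τ z + psi 1 1 τ z))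

/-- The expansion of `φ_{0,1} / 12` in `q` and `s = ζ - 2 + ζ⁻¹`. -/
def formalB : MvPowerSeries (Fin 2) ℂ :=
  (3⁻¹ : ℂ) • (((4⁻¹ : ℂ) • (MvPowerSeries.X 1 + (4 : ℂ) • 1)) * formalTP (· + 1) (-1) ^ 2 +
    (2 : ℂ) • evenPart (formalTP (fun n => 2 * n + 1) 1 ^ 2))

lemma formalB_mem : formalB ∈ S6 (Fin 2) := by
  have h2 : (2 : ℂ) ∈ R6 := by exact_mod_cast int_mem_R6 2
  have h4 : (4 : ℂ) ∈ R6 := by exact_mod_cast int_mem_R6 4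
  have i3 : (3⁻¹ : ℂ) ∈ R6 := by
    have := R6.mul_mem h2 inv_six_mem
    norm_num at this ⊢
    exact this
  have i4 : (4⁻¹ : ℂ) ∈ R6 := by
    have := R6.mul_mem (int_mem_R6 3) inv_twelve_mem
    norm_num at this ⊢
    exact this
  have hT : formalTP (fun n => 2 * n + 1) 1 ^ 2 ∈ S6 (Fin 2) :=
    (S6 _).pow_mem (fun α => coeff_formalTP_mem (fun n => by omega) 1 α) 2
  refine smul_mem_S6 i3 ((S6 _).add_mem ((S6 _).mul_mem (smul_mem_S6 i4 ((S6 _).add_mem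
    (X_mem_S6 1) (smul_mem_S6 h4 (S6 _).one_mem))) ((S6 _).pow_mem (fun α =>
    coeff_formalTP_mem (fun n => Nat.lt_succ_self n) (-1) α) 2)) (smul_mem_S6 h2 fun α => ?_))
  rw [coeff_evenPart]
  exact hT _

lemma evalsTo_formalB (hτ : 0 < τ.im) (z : ℂ) :
    EvalsTo formalB ![ex τ, sv z] (phiB τ z) := by
  have hτ2 : 0 < (τ / 2).im := by simpa using hτ
  have hQ := norm_ex_lt_one hτ2
  have hQ2 : ex (τ / 2) ^ 2 = ex τ := by
    rw [← ex_nat_mul]; congr 1; push_cast; ring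
  have h1 : EvalsTo (formalTP (· + 1) (-1)) ![ex τ, sv z] (TP (ex τ) (-ex τ) (sv z)) :=
    evalsTo_formalTP (x := ![ex τ, sv z]) (fun n => Nat.lt_succ_self n) (by simp)
      (by simpa using norm_ex_lt_one hτ) (fun n => by simp [pow_succ])
  have hT : ∀ Q : ℂ, ‖Q‖ < 1 → EvalsTo (formalTP (fun n => 2 * n + 1) 1) ![Q, sv z]
      (TP (Q ^ 2) Q (sv z)) := fun Q hQ =>
    evalsTo_formalTP (x := ![Q, sv z]) (fun n => by omega) (by simp)
      (by simpa using hQ) (fun n => by simp [pow_succ, pow_mul])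
  have h2 := evalsTo_evenPart ((hT _ hQ).pow 2) ((hT (-ex (τ / 2)) (by rwa [norm_neg])).pow 2)
  rw [neg_sq, hQ2] at h2
  have h3 := ((((evalsTo_X 1 ![ex τ, sv z]).add ((evalsTo_one _).smul 4)).smul 4⁻¹).mul
    (h1.pow 2)).add (h2.smul 2) |>.smul 3⁻¹
  have e1 : ex ((τ + (0 : ℤ)) / 2) = ex (τ / 2) := by simp
  have e2 : ex ((τ + (1 : ℤ)) / 2) = -ex (τ / 2) := by
    rw [add_div, ex_add, Int.cast_one, ex_half]; ring
  rw [phiB, psi_zero_one hτ, psi_one hτ, psi_one hτ, e1, e2]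
  have e3 : ![ex τ, sv z] 1 = sv z := rfl
  rw [e3] at h3
  refine (congrArg (EvalsTo formalB ![ex τ, sv z]) ?_).mpr h3
  ring

lemma phiB_add_tau (hτ : 0 < τ.im) (z : ℂ) :
    phiB τ (z + τ) = ex (-(τ + 2 * z)) * phiB τ z := by
  simp only [phiB, psi_add_tau hτ]; ring

lemma phiB_S (hτ : 0 < τ.im) (z : ℂ) :
    phiB (-1 / τ) (z / τ) = ex (z ^ 2 / τ) * phiB τ z := by
  simp only [phiB, psi_S hτ]; ring

lemma phiB_zero (hτ : 0 < τ.im) : phiB τ 0 = 1 := by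
  rw [phiB, psi_zero (phiA_half_ne_zero hτ), psi_zero (phiA_half_tau_ne_zero hτ _),
    psi_zero (phiA_half_tau_ne_zero hτ _)]
  norm_num

end PhiB

section Jacobi

open Filter Topology

variable {τ : ℂ}

lemma exists_ex_eq {q : ℂ} (h0 : q ≠ 0) (h1 : ‖q‖ < 1) : ∃ τ : ℂ, 0 < τ.im ∧ ex τ = q := by
  have h : ex (Complex.log q / (2 * Real.pi * I)) = q := by
    rw [ex, mul_div_cancel₀ _ Complex.two_pi_I_ne_zero, Complex.exp_log h0]
  refine ⟨_, ?_, h⟩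
  have hn := norm_ex (Complex.log q / (2 * Real.pi * I))
  rw [h] at hn
  rw [hn, Real.exp_lt_one_iff] at h1
  have := Real.pi_pos
  by_contra! hc
  nlinarith [mul_nonneg this.le (neg_nonneg.mpr hc)]

lemma eq_zero_of_evalsTo_ex {F : MvPowerSeries (Fin 2) ℂ}
    (h : ∀ τ : ℂ, 0 < τ.im → ∀ s : ℂ, s ≠ 0 → EvalsTo F ![ex τ, s] 0) : F = 0 := by
  refine eq_zero_of_evalsTo ![1 / 2, 1] (by intro i; fin_cases i <;> norm_num) fun x hx => ?_
  have hx0 := hx 0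
  have hx1 := hx 1
  simp only [Matrix.cons_val_zero, Matrix.cons_val_one] at hx0 hx1
  obtain ⟨τ, hτ, hq⟩ := exists_ex_eq (q := x 0) (by rw [← norm_ne_zero_iff, hx0]; norm_num)
    (by rw [hx0]; norm_num)
  have := h τ hτ (x 1) (by rw [← norm_ne_zero_iff, hx1]; norm_num)
  rwa [hq, show ![x 0, x 1] = x by ext i; fin_cases i <;> rfl] at this

/-- The part of a power series in `(q, s)` that is constant in `s`. -/
def constPart (F : MvPowerSeries (Fin 2) ℂ) : MvPowerSeries (Fin 2) ℂ :=
  fun α => if α 1 = 0 then MvPowerSeries.coeff α F else 0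

lemma coeff_constPart (F : MvPowerSeries (Fin 2) ℂ) (α : Fin 2 →₀ ℕ) :
    MvPowerSeries.coeff α (constPart F) = if α 1 = 0 then MvPowerSeries.coeff α F else 0 := rfl

lemma evalsTo_constPart {F : MvPowerSeries (Fin 2) ℂ} {q v : ℂ} (h : EvalsTo F ![q, 0] v) (s : ℂ) :
    EvalsTo (constPart F) ![q, s] v := by
  refine HasSum.congr_fun h fun α => ?_
  rw [coeff_constPart, monom_two, monom_two]
  by_cases hα : α 1 = 0
  · simp [hα]
  · simp [hα]

lemma hasSum_of_evalsTo_zero {F : MvPowerSeries (Fin 2) ℂ} {q v : ℂ} (h : EvalsTo F ![q, 0] v) :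
    HasSum (fun n : ℕ => MvPowerSeries.coeff (pair n 0) F * q ^ n) v := by
  have hinj : Function.Injective fun n : ℕ => pair n 0 := fun a b hab => (pair_inj.mp hab).1
  have h2 := (hinj.hasSum_iff ?_).mpr h
  · refine h2.congr_fun fun n => ?_
    simp [monom_pair]
  · intro α hα
    have : α 1 ≠ 0 := fun h0 => hα ⟨α 0, by
      change pair (α 0) 0 = α
      rw [← h0, pair_eta]⟩
    simp [monom_two, this]

/-- Division by `s` of a power series in `(q, s)`. -/
def divS (F : MvPowerSeries (Fin 2) ℂ) : MvPowerSeries (Fin 2) ℂ :=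
  fun α => MvPowerSeries.coeff (pair (α 0) (α 1 + 1)) F

lemma coeff_divS (F : MvPowerSeries (Fin 2) ℂ) (α : Fin 2 →₀ ℕ) :
    MvPowerSeries.coeff α (divS F) = MvPowerSeries.coeff (pair (α 0) (α 1 + 1)) F := rfl

lemma evalsTo_divS {F : MvPowerSeries (Fin 2) ℂ} (hF : constPart F = 0) {q s v : ℂ} (hs : s ≠ 0)
    (h : EvalsTo F ![q, s] v) : EvalsTo (divS F) ![q, s] (v / s) := by
  have hinj : Function.Injective fun α : Fin 2 →₀ ℕ => pair (α 0) (α 1 + 1) := by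
    intro α β hαβ
    rw [pair_inj] at hαβ
    rw [← pair_eta α, ← pair_eta β, pair_inj]
    omega
  have h2 := ((hinj.hasSum_iff ?_).mpr h).div_const s
  · refine h2.congr_fun fun α => ?_
    simp only [Function.comp_apply, coeff_divS, monom_two, Matrix.cons_val_zero,
      Matrix.cons_val_one, pair_zero, pair_one, pow_succ]
    field_simp
  · intro α hα
    have h1 : α 1 = 0 := by
      by_contra h1
      refine hα ⟨pair (α 0) (α 1 - 1), ?_⟩
      simp only [pair_zero, pair_one]
      rw [Nat.sub_add_cancel (Nat.one_le_iff_ne_zero.mpr h1), pair_eta]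
    have := coeff_constPart F α
    rw [hF, if_pos h1, map_zero] at this
    rw [← this, zero_mul]

lemma tendsto_comp_sv {v : ℂ → ℂ} (hv : Continuous v) :
    Tendsto (fun z => v (sv z)) (𝓝[≠] 0) (𝓝 (v 0)) := by
  have h := (hv.comp differentiable_sv.continuous).tendsto 0
  simp only [Function.comp_apply, sv_zero] at h
  exact h.mono_left nhdsWithin_le_nhds

lemma eventually_sv_ne_zero : ∀ᶠ z in 𝓝[≠] (0 : ℂ), sv z ≠ 0 := by
  have h := tendsto_sv_div_sq.eventually_ne (pow_ne_zero 2 Complex.two_pi_I_ne_zero)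
  filter_upwards [h] with z hz h0
  rw [h0, zero_div] at hz
  exact hz rfl

lemma tendsto_div_const (h0 : τ ≠ 0) : Tendsto (fun z : ℂ => z / τ) (𝓝[≠] 0) (𝓝[≠] 0) := by
  refine tendsto_nhdsWithin_of_tendsto_nhds_of_eventually_within _ ?_ ?_
  · have : Continuous fun z : ℂ => z / τ := by fun_prop
    have := this.tendsto 0
    rw [zero_div] at this
    exact this.mono_left nhdsWithin_le_nhds
  · filter_upwards [self_mem_nhdsWithin] with z hz
    exact div_ne_zero hz h0

lemma tendsto_sv_div_sv (h0 : τ ≠ 0) :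
    Tendsto (fun z => sv (z / τ) / sv z) (𝓝[≠] 0) (𝓝 (τ⁻¹ ^ 2)) := by
  have hne := pow_ne_zero 2 Complex.two_pi_I_ne_zero
  have h := ((tendsto_sv_div_sq.comp (tendsto_div_const h0)).div tendsto_sv_div_sq hne).mul_const
    (τ⁻¹ ^ 2)
  rw [div_self hne, one_mul] at h
  refine h.congr' ?_
  filter_upwards [self_mem_nhdsWithin, eventually_sv_ne_zero] with z hz hz'
  have hz : z ≠ 0 := hz
  simp only [Function.comp_apply, Pi.div_apply]
  field_simp

lemma eq_zero_of_vanishing_order {F : MvPowerSeries (Fin 2) ℂ} {v : ℂ → ℂ → ℂ} {m : ℕ}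
    (hF : ∀ τ : ℂ, 0 < τ.im → ∀ s, EvalsTo F ![ex τ, s] (v τ s))
    (hT : ∀ τ : ℂ, 0 < τ.im → ∀ z, sv (z + τ) ^ (m + 1) * v τ (sv (z + τ)) =
      ex (-(m * (τ + 2 * z))) * (sv z ^ (m + 1) * v τ (sv z))) : F = 0 := by
  refine eq_zero_of_evalsTo_ex fun τ hτ s hs => ?_
  have hd := differentiable_of_evalsTo (hF τ hτ)
  have hc : Tendsto (fun z => (sv z ^ (m + 1) * v τ (sv z)) / phiA τ z ^ m) (𝓝[≠] 0) (𝓝 0) := by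
    have h1 := tendsto_comp_sv (v := fun s => s * v τ s) (continuous_id.mul hd.continuous)
    have h2 := ((tendsto_TP hτ).pow m).inv₀ (by simp)
    have h3 := h1.mul h2
    rw [zero_mul, zero_mul] at h3
    refine h3.congr' ?_
    filter_upwards [eventually_sv_ne_zero] with z hz
    rw [phiA, mul_pow, pow_succ]
    field_simp
    ring
  have h := eq_mul_phiA_pow hτ m (h := fun z => sv z ^ (m + 1) * v τ (sv z))
    ((differentiable_sv.pow _).mul (hd.comp differentiable_sv))
    (fun z => by simp only [sv_add_one]) (hT τ hτ) hc
  obtain ⟨z, rfl⟩ := sv_surjective s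
  have hz := h z
  rw [zero_mul, mul_eq_zero, or_iff_right (pow_ne_zero _ hs)] at hz
  rw [← hz]
  exact hF τ hτ _

lemma constTerm_S {v : ℂ → ℂ → ℂ} {m i : ℕ} {K : ℤ} (hτ : 0 < τ.im)
    (hd : Continuous (v τ)) (hd' : Continuous (v (-1 / τ)))
    (hS : ∀ z, sv (z / τ) ^ i * v (-1 / τ) (sv (z / τ)) =
      τ ^ K * ex (m * (z ^ 2 / τ)) * (sv z ^ i * v τ (sv z))) :
    v (-1 / τ) 0 = τ ^ (K + 2 * i) * v τ 0 := by
  have h0 := ne_zero_of_im_pos hτ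
  have h1 := ((tendsto_sv_div_sv h0).pow i).mul ((tendsto_comp_sv hd').comp (tendsto_div_const h0))
  have h2 : Tendsto (fun z : ℂ => ex (m * (z ^ 2 / τ))) (𝓝[≠] 0) (𝓝 1) := by
    have : Continuous fun z : ℂ => ex (m * (z ^ 2 / τ)) :=
      differentiable_ex.continuous.comp (by fun_prop)
    have := this.tendsto 0
    rw [show (m : ℂ) * ((0 : ℂ) ^ 2 / τ) = 0 by simp, ex_zero] at this
    exact this.mono_left nhdsWithin_le_nhds
  have h3 := (h2.const_mul (τ ^ K)).mul (tendsto_comp_sv hd)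
  have h4 := tendsto_nhds_unique_of_eventuallyEq h1 h3 (by
    filter_upwards [eventually_sv_ne_zero] with z hz
    have := hS z
    simp only [Function.comp_apply]
    rw [div_pow, div_mul_eq_mul_div, this]
    field_simp)
  rw [mul_one] at h4
  rw [zpow_add₀ h0, show (2 * (i : ℤ)) = ((2 * i : ℕ) : ℤ) by push_cast; ring, zpow_natCast,
    pow_mul]
  rw [inv_pow, inv_pow] at h4
  have hne : (τ ^ 2) ^ i ≠ 0 := pow_ne_zero _ (pow_ne_zero _ h0)
  rw [inv_mul_eq_iff_eq_mul₀ hne] at h4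
  rw [h4]; ring

/-- The Taylor development principle: the coefficients of a weak Jacobi form of even weight `K`
and index `m` lie in a `ℤ[1/6]`-module as soon as those of `q^n` with `12 n ≤ K + 2 m` do. -/
theorem jacobi_coeff_mem_aux (V : Submodule R6 ℂ) (K : ℤ) (hK : Even K) (m : ℕ) (d : ℕ) :
    ∀ (i : ℕ) (_ : i + d = m + 1) (F : MvPowerSeries (Fin 2) ℂ) (v : ℂ → ℂ → ℂ)
    (_ : ∀ τ : ℂ, 0 < τ.im → ∀ s, EvalsTo F ![ex τ, s] (v τ s))
    (_ : ∀ τ : ℂ, 0 < τ.im → ∀ z, sv (z + τ) ^ i * v τ (sv (z + τ)) =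
      ex (-(m * (τ + 2 * z))) * (sv z ^ i * v τ (sv z)))
    (_ : ∀ τ : ℂ, 0 < τ.im → ∀ z, sv (z / τ) ^ i * v (-1 / τ) (sv (z / τ)) =
      τ ^ K * ex (m * (z ^ 2 / τ)) * (sv z ^ i * v τ (sv z)))
    (_ : ∀ α : Fin 2 →₀ ℕ, 12 * (α 0 : ℤ) ≤ K + 2 * m → MvPowerSeries.coeff α F ∈ V)
    (α : Fin 2 →₀ ℕ), MvPowerSeries.coeff α F ∈ V := by
  induction d with
  | zero =>
    intro i hi F v hF hT hS hV α
    rw [add_zero] at hi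
    subst hi
    rw [eq_zero_of_vanishing_order hF hT, map_zero]
    exact V.zero_mem
  | succ d ih =>
    intro i hi F v hF hT hS hV
    have hcont : ∀ τ : ℂ, 0 < τ.im → Continuous (v τ) := fun τ hτ =>
      (differentiable_of_evalsTo (hF τ hτ)).continuous
    have hχ : ∀ n : ℕ, MvPowerSeries.coeff (pair n 0) F ∈ V := by
      refine coeff_mem_of_hasSum V (K + 2 * i) (hK.add (even_two_mul _)) (fun τ => v τ 0) _
        (fun τ hτ => hasSum_of_evalsTo_zero (hF τ hτ 0)) (fun τ hτ => ?_) fun n hn => ?_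
      · exact constTerm_S hτ (hcont τ hτ) (hcont _ (im_neg_one_div hτ)) (hS τ hτ)
      · exact hV _ (by rw [pair_zero]; omega)
    have hχ' : ∀ α, MvPowerSeries.coeff α (constPart F) ∈ V := fun α => by
      rw [coeff_constPart]
      split_ifs with h
      · have := hχ (α 0)
        rwa [← h, pair_eta] at this
      · exact V.zero_mem
    set P : MvPowerSeries (Fin 2) ℂ := constPart F * (formalA' ^ i * formalB ^ (m - i)) with hP
    have hPV : ∀ α, MvPowerSeries.coeff α P ∈ V := coeff_mul_mem_of_mem_S6 hχ'
      ((S6 _).mul_mem ((S6 _).pow_mem formalA'_mem _) ((S6 _).pow_mem formalB_mem _))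
    have hPe : ∀ τ : ℂ, 0 < τ.im → ∀ z, EvalsTo P ![ex τ, sv z]
        (v τ 0 * ((TP (ex τ) (ex τ) (sv z) ^ 2) ^ i * phiB τ z ^ (m - i))) := fun τ hτ z =>
      (evalsTo_constPart (hF τ hτ 0) _).mul
        (((evalsTo_formalA' hτ _).pow i).mul ((evalsTo_formalB hτ z).pow _))
    have hG0 : constPart (F - P) = 0 := by
      refine eq_zero_of_evalsTo_ex fun τ hτ s _ => evalsTo_constPart ?_ s
      have := (hF τ hτ 0).sub (sv_zero ▸ hPe τ hτ 0)
      simpa only [TP_zero, phiB_zero hτ, one_pow, mul_one, sub_self] using this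
    have hGe : ∀ τ : ℂ, 0 < τ.im → ∀ z, EvalsTo (F - P) ![ex τ, sv z]
        (v τ (sv z) - v τ 0 * ((TP (ex τ) (ex τ) (sv z) ^ 2) ^ i * phiB τ z ^ (m - i))) :=
      fun τ hτ z => (hF τ hτ _).sub (hPe τ hτ z)
    set w : ℂ → ℂ → ℂ := fun τ s =>
      ∑' α, MvPowerSeries.coeff α (divS (F - P)) * monom ![ex τ, s] α with hw
    have hwe : ∀ τ : ℂ, 0 < τ.im → ∀ s, EvalsTo (divS (F - P)) ![ex τ, s] (w τ s) := by
      intro τ hτ s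
      suffices AbsConv (divS (F - P)) ![ex τ, s] from (Summable.of_norm this).hasSum
      by_cases hs : s = 0
      · obtain ⟨z, hz⟩ := sv_surjective 1
        have h1 := (evalsTo_divS hG0 one_ne_zero (hz ▸ hGe τ hτ z)).absConv
        refine h1.mono fun j => ?_
        fin_cases j <;> simp [hs]
      · obtain ⟨z, rfl⟩ := sv_surjective s
        exact (evalsTo_divS hG0 hs (hGe τ hτ z)).absConv
    have hsw : ∀ τ : ℂ, 0 < τ.im → ∀ z, sv z ^ (i + 1) * w τ (sv z) =
        sv z ^ i * v τ (sv z) - v τ 0 * (phiA τ z ^ i * phiB τ z ^ (m - i)) := by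
      intro τ hτ z
      have h1 : sv z * w τ (sv z) =
          v τ (sv z) - v τ 0 * ((TP (ex τ) (ex τ) (sv z) ^ 2) ^ i * phiB τ z ^ (m - i)) := by
        by_cases hs : sv z = 0
        · have := hGe τ hτ z
          rw [hs] at this ⊢
          have h2 := evalsTo_constPart this 1
          rw [hG0] at h2
          rw [zero_mul, h2.unique (evalsTo_zero _)]
        · have := (evalsTo_divS hG0 hs (hGe τ hτ z)).unique (hwe τ hτ (sv z))
          rw [← this, mul_div_cancel₀ _ hs]
      rw [pow_succ, mul_assoc, h1, phiA, mul_pow]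
      ring
    have hmi : ((m - i : ℕ) : ℂ) = m - i := by
      rw [Nat.cast_sub (by omega)]
    have hG := ih (i + 1) (by omega) (divS (F - P)) w hwe
      (fun τ hτ z => by
        rw [hsw τ hτ, hsw τ hτ, hT τ hτ, phiA_add_tau hτ, phiB_add_tau hτ, mul_pow, mul_pow,
          ← ex_nat_mul, ← ex_nat_mul]
        have : ex (-(m * (τ + 2 * z))) =
            ex (i * -(τ + 2 * z)) * ex ((m - i : ℕ) * -(τ + 2 * z)) := by
          rw [← ex_add, hmi]; congr 1; ring
        rw [this]
        ring)
      (fun τ hτ z => by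
        have h0 := ne_zero_of_im_pos hτ
        rw [hsw _ (im_neg_one_div hτ), hsw τ hτ, hS τ hτ, phiA_S hτ, phiB_S hτ,
          constTerm_S hτ (hcont τ hτ) (hcont _ (im_neg_one_div hτ)) (hS τ hτ),
          mul_pow, mul_pow, mul_pow,
          ← ex_nat_mul, ← ex_nat_mul, zpow_add₀ h0,
          show (2 * (i : ℤ)) = ((2 * i : ℕ) : ℤ) by push_cast; ring, zpow_natCast, pow_mul]
        have : ex (m * (z ^ 2 / τ)) =
            ex (i * (z ^ 2 / τ)) * ex ((m - i : ℕ) * (z ^ 2 / τ)) := by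
          rw [← ex_add, hmi]; congr 1; ring
        rw [this, inv_pow, inv_pow]
        have hne : (τ ^ 2) ^ i ≠ 0 := pow_ne_zero _ (pow_ne_zero _ h0)
        field_simp)
      (fun α hα => by
        rw [coeff_divS, map_sub]
        exact V.sub_mem (hV _ (by simpa using hα)) (hPV _))
    intro α
    have hsub : MvPowerSeries.coeff α (F - P) ∈ V := by
      by_cases h1 : α 1 = 0
      · have := coeff_constPart (F - P) α
        rw [hG0, if_pos h1, map_zero] at this
        rw [← this]; exact V.zero_mem
      · have := hG (pair (α 0) (α 1 - 1))
        rw [coeff_divS, pair_zero, pair_one, Nat.sub_add_cancel (Nat.one_le_iff_ne_zero.mpr h1),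
          pair_eta] at this
        exact this
    rw [map_sub] at hsub
    have := V.add_mem hsub (hPV α)
    rwa [sub_add_cancel] at this

theorem jacobi_coeff_mem (V : Submodule R6 ℂ) (K : ℤ) (hK : Even K) (m : ℕ)
    (F : MvPowerSeries (Fin 2) ℂ) (v : ℂ → ℂ → ℂ)
    (hF : ∀ τ : ℂ, 0 < τ.im → ∀ s, EvalsTo F ![ex τ, s] (v τ s))
    (hT : ∀ τ : ℂ, 0 < τ.im → ∀ z, v τ (sv (z + τ)) = ex (-(m * (τ + 2 * z))) * v τ (sv z))
    (hS : ∀ τ : ℂ, 0 < τ.im → ∀ z, v (-1 / τ) (sv (z / τ)) =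
      τ ^ K * ex (m * (z ^ 2 / τ)) * v τ (sv z))
    (hV : ∀ α : Fin 2 →₀ ℕ, 12 * (α 0 : ℤ) ≤ K + 2 * m → MvPowerSeries.coeff α F ∈ V)
    (α : Fin 2 →₀ ℕ) : MvPowerSeries.coeff α F ∈ V :=
  jacobi_coeff_mem_aux V K hK m (m + 1) 0 (zero_add _) F v hF
    (fun τ hτ z => by simpa using hT τ hτ z) (fun τ hτ z => by simpa using hS τ hτ z) hV α

end Jacobi

section

/-! ### Fourier expansion of periodic holomorphic functions on the tube domain -/

/-- The cone of positive definite binary forms in coordinates `(y₁, y₂, y₃)`. -/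
def posCone : Set (Fin 3 → ℝ) := {y | 0 < y 0 ∧ y 1 ^ 2 < y 0 * y 2}

/-- The Siegel upper half-space of degree two in coordinates `(τ, z, τ')`. -/
def tube : Set (Fin 3 → ℂ) := {w | (fun i => (w i).im) ∈ posCone}

/-- The point with real part `x` and imaginary part `y`. -/
def tpt (x y : Fin 3 → ℝ) : Fin 3 → ℂ := fun i => x i + y i * I

lemma tpt_mem_tube {x y : Fin 3 → ℝ} : tpt x y ∈ tube ↔ y ∈ posCone := by
  simp [tube, tpt]

lemma eq_tpt (w : Fin 3 → ℂ) : w = tpt (fun i => (w i).re) (fun i => (w i).im) := by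
  funext i
  simp [tpt, Complex.re_add_im]

lemma isOpen_posCone : IsOpen posCone := by
  have h0 : IsOpen {y : Fin 3 → ℝ | 0 < y 0} := isOpen_lt (by fun_prop) (by fun_prop)
  have h1 : IsOpen {y : Fin 3 → ℝ | y 1 ^ 2 < y 0 * y 2} := isOpen_lt (by fun_prop) (by fun_prop)
  exact h0.inter h1

lemma posCone_pos {y : Fin 3 → ℝ} (hy : y ∈ posCone) : 0 < y 2 := by
  obtain ⟨h0, h1⟩ := hy
  by_contra h
  nlinarith [sq_nonneg (y 1), mul_nonneg h0.le (sub_nonneg.mpr (not_lt.mp h))]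

lemma exists_torus_lift {d : Type*} [Fintype d] (h : (d → ℝ) → ℂ) (hc : Continuous h)
    (hp : ∀ (n : d → ℤ) x, h (fun i => x i + n i) = h x) :
    ∃ H : C(UnitAddTorus d, ℂ), ∀ x : d → ℝ, H (fun i => (x i : UnitAddCircle)) = h x := by
  have hq : IsOpenQuotientMap (Pi.map fun (_ : d) (x : ℝ) => (x : UnitAddCircle)) :=
    IsOpenQuotientMap.piMap fun _ => QuotientAddGroup.isOpenQuotientMap_mk
  choose r hr using fun t : UnitAddTorus d => hq.surjective t
  have key : ∀ x : d → ℝ, h (r (fun i => (x i : UnitAddCircle))) = h x := by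
    intro x
    have h1 := hr (fun i => (x i : UnitAddCircle))
    have h2 : ∀ i, ∃ n : ℤ, r (fun i => (x i : UnitAddCircle)) i = x i + n := by
      intro i
      have h3 := congrFun h1 i
      simp only [Pi.map_apply] at h3
      rw [← sub_eq_zero, ← AddCircle.coe_sub, AddCircle.coe_eq_zero_iff] at h3
      obtain ⟨n, hn⟩ := h3
      refine ⟨n, ?_⟩
      simp only [zsmul_eq_mul, mul_one] at hn
      linarith
    choose n hn using h2
    rw [← hp n x]
    congr 1
    funext i
    exact hn i
  refine ⟨⟨fun t => h (r t), ?_⟩, key⟩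
  rw [← hq.continuous_comp_iff]
  exact hc.congr fun x => (key x).symm

section TorusIntegral

attribute [local instance] measureSpaceUnitAddCircle isAddHaarMeasure_unitAddCircle
  isProbabilityMeasure_unitAddCircle

lemma integral_torus_eq_average {d : Type*} [Fintype d] (H : C(UnitAddTorus d, ℂ)) (v : d → ℝ) :
    ∫ t, H t = ∫ t : UnitAddTorus d, ∫ s in (0 : ℝ)..1,
      H (t + fun i => ((s * v i : ℝ) : UnitAddCircle)) := by
  have hcont : Continuous fun q : UnitAddTorus d × ℝ =>
      H (q.1 + fun i => ((q.2 * v i : ℝ) : UnitAddCircle)) := by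
    refine H.continuous.comp (continuous_fst.add (continuous_pi fun i => ?_))
    exact (AddCircle.continuous_mk' 1).comp (by fun_prop)
  have h1 : ∫ t : UnitAddTorus d, ∫ s in (0 : ℝ)..1,
      H (t + fun i => ((s * v i : ℝ) : UnitAddCircle)) =
      ∫ s in (0 : ℝ)..1, ∫ t : UnitAddTorus d,
        H (t + fun i => ((s * v i : ℝ) : UnitAddCircle)) := by
    simp only [intervalIntegral.integral_of_le zero_le_one]
    refine MeasureTheory.integral_integral_swap ?_
    refine MeasureTheory.Integrable.mono' (g := fun _ => ‖H‖) (MeasureTheory.integrable_const _)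
      hcont.aestronglyMeasurable (Filter.Eventually.of_forall fun q => ?_)
    exact H.norm_coe_le_norm _
  rw [h1]
  simp [MeasureTheory.integral_add_right_eq_self (fun t => H t)]

lemma integral_segment_eq {h : (Fin 3 → ℂ) → ℂ} (hd : DifferentiableOn ℂ h tube)
    (hp : ∀ (n : Fin 3 → ℤ), ∀ w ∈ tube, h (fun i => w i + n i) = h w) (x y : Fin 3 → ℝ)
    (v : Fin 3 → ℤ) {b : ℝ} (hb : 0 ≤ b)
    (hmem : ∀ s, 0 ≤ s → s ≤ b → (fun i => y i + s * v i) ∈ posCone) :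
    ∫ s in (0 : ℝ)..1, h (tpt (fun i => x i + s * v i) y) =
      ∫ s in (0 : ℝ)..1, h (tpt (fun i => x i + s * v i) (fun i => y i + b * v i)) := by
  set L : ℂ → Fin 3 → ℂ := fun ζ i => x i + y i * I + ζ * v i with hL
  have hLd : Differentiable ℂ L := by
    rw [differentiable_pi]
    intro i
    fun_prop
  have hLm : ∀ ζ : ℂ, 0 ≤ ζ.im → ζ.im ≤ b → L ζ ∈ tube := by
    intro ζ h0 h1
    have : (fun i => (L ζ i).im) = fun i => y i + ζ.im * v i := by
      funext i
      simp [hL]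
    change (fun i => (L ζ i).im) ∈ posCone
    rw [this]
    exact hmem _ h0 h1
  have hrect := Complex.integral_boundary_rect_eq_zero_of_differentiableOn (fun ζ => h (L ζ)) 0
    (1 + b * I) (by
      refine hd.comp hLd.differentiableOn fun ζ hζ => ?_
      have h2 := hζ.2
      simp only [zero_im, add_im, one_im, mul_im, ofReal_re, I_im, mul_one, ofReal_im, I_re,
        mul_zero, add_zero, zero_add, Set.mem_preimage, Set.uIcc_of_le hb] at h2
      exact hLm ζ h2.1 h2.2)
  simp only [zero_re, zero_im, add_re, add_im, one_re, one_im, mul_re, mul_im, ofReal_re,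
    ofReal_im, I_re, I_im, mul_zero, mul_one, add_zero, zero_add, ofReal_zero,
    zero_mul, ofReal_one, sub_self] at hrect
  have hside : ∫ u in (0 : ℝ)..b, h (L (1 + u * I)) = ∫ u in (0 : ℝ)..b, h (L (u * I)) := by
    refine intervalIntegral.integral_congr fun u hu => ?_
    rw [Set.uIcc_of_le hb] at hu
    rw [← hp v (L (u * I)) (hLm _ (by simpa using hu.1) (by simpa using hu.2))]
    congr 1
    funext i
    simp only [hL]
    ring
  rw [hside, add_sub_cancel_right, sub_eq_zero] at hrect
  have e1 : ∀ s : ℝ, tpt (fun i => x i + s * v i) y = L s := fun s => by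
    funext i
    simp [hL, tpt]
    ring
  have e2 : ∀ s : ℝ, tpt (fun i => x i + s * v i) (fun i => y i + b * v i) = L (s + b * I) :=
    fun s => by
    funext i
    simp [hL, tpt]
    ring
  simp only [e1, e2]
  exact hrect

lemma integral_torus_eq_of_segment {h : (Fin 3 → ℂ) → ℂ} (hd : DifferentiableOn ℂ h tube)
    (hp : ∀ (n : Fin 3 → ℤ), ∀ w ∈ tube, h (fun i => w i + n i) = h w) {y y' : Fin 3 → ℝ}
    (v : Fin 3 → ℤ) {b : ℝ} (hb : 0 ≤ b)
    (hmem : ∀ s, 0 ≤ s → s ≤ b → (fun i => y i + s * v i) ∈ posCone)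
    (hy' : y' = fun i => y i + b * v i)
    (H H' : C(UnitAddTorus (Fin 3), ℂ))
    (hH : ∀ x : Fin 3 → ℝ, H (fun i => (x i : UnitAddCircle)) = h (tpt x y))
    (hH' : ∀ x : Fin 3 → ℝ, H' (fun i => (x i : UnitAddCircle)) = h (tpt x y')) :
    ∫ t, H t = ∫ t, H' t := by
  rw [integral_torus_eq_average H fun i => (v i : ℝ),
    integral_torus_eq_average H' fun i => (v i : ℝ)]
  congr 1
  funext t
  choose x hx using fun i => QuotientAddGroup.mk_surjective (t i)
  obtain rfl : (fun i => ((x i : ℝ) : UnitAddCircle)) = t := funext hx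
  have e : ∀ s : ℝ, ((fun i => ((x i : ℝ) : UnitAddCircle)) +
      fun i => ((s * v i : ℝ) : UnitAddCircle)) =
      fun i => ((x i + s * v i : ℝ) : UnitAddCircle) := fun s => by
    funext i
    simp
  simp only [e, hH, hH', hy']
  exact integral_segment_eq hd hp x y v hb hmem

lemma continuous_comp_tpt {h : (Fin 3 → ℂ) → ℂ} (hd : DifferentiableOn ℂ h tube) {y : Fin 3 → ℝ}
    (hy : y ∈ posCone) : Continuous fun x => h (tpt x y) := by
  refine hd.continuousOn.comp_continuous ?_ fun x => tpt_mem_tube.mpr hy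
  unfold tpt
  fun_prop

lemma exists_torus_lift_tpt {h : (Fin 3 → ℂ) → ℂ} (hd : DifferentiableOn ℂ h tube)
    (hp : ∀ (n : Fin 3 → ℤ), ∀ w ∈ tube, h (fun i => w i + n i) = h w) {y : Fin 3 → ℝ}
    (hy : y ∈ posCone) : ∃ H : C(UnitAddTorus (Fin 3), ℂ),
      ∀ x : Fin 3 → ℝ, H (fun i => (x i : UnitAddCircle)) = h (tpt x y) := by
  refine exists_torus_lift _ (continuous_comp_tpt hd hy) fun n x => ?_
  rw [← hp n (tpt x y) (tpt_mem_tube.mpr hy)]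
  congr 1
  funext i
  simp [tpt]
  ring

lemma posCone_add_one {y : Fin 3 → ℝ} (hy : y ∈ posCone) {s : ℝ} (hs : 0 ≤ s) :
    (fun i => y i + s * ((![1, 1, 1] : Fin 3 → ℤ) i : ℝ)) ∈ posCone := by
  have h2 := posCone_pos hy
  obtain ⟨h0, h1⟩ := hy
  simp only [posCone, Set.mem_ofPred_eq]
  simp only [Matrix.cons_val_zero, Matrix.cons_val_one, Matrix.cons_val, Int.cast_one, mul_one]
  refine ⟨by positivity, ?_⟩
  have : 2 * y 1 ≤ y 0 + y 2 := by
    by_contra h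
    nlinarith [sq_nonneg (y 0 - y 2)]
  nlinarith [mul_le_mul_of_nonneg_left this hs]

lemma posCone_add_single {y : Fin 3 → ℝ} (hy : y ∈ posCone) {s : ℝ} (hs : 0 ≤ s) {u : ℝ}
    (hu : 0 ≤ u) : ![y 0 + s, y 1, y 2 + u] ∈ posCone := by
  have h2 := posCone_pos hy
  obtain ⟨h0, h1⟩ := hy
  simp only [posCone, Set.mem_ofPred_eq]
  simp only [Matrix.cons_val_zero, Matrix.cons_val_one, Matrix.cons_val]
  exact ⟨by positivity, by nlinarith [mul_nonneg hs h2.le, mul_nonneg hs hu, mul_nonneg h0.le hu]⟩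

/-- The mean of a periodic holomorphic function over a horizontal torus does not depend on the
imaginary part. -/
lemma integral_torus_eq {h : (Fin 3 → ℂ) → ℂ} (hd : DifferentiableOn ℂ h tube)
    (hp : ∀ (n : Fin 3 → ℤ), ∀ w ∈ tube, h (fun i => w i + n i) = h w) {y y' : Fin 3 → ℝ}
    (hy : y ∈ posCone) (hy' : y' ∈ posCone)
    (H H' : C(UnitAddTorus (Fin 3), ℂ))
    (hH : ∀ x : Fin 3 → ℝ, H (fun i => (x i : UnitAddCircle)) = h (tpt x y))
    (hH' : ∀ x : Fin 3 → ℝ, H' (fun i => (x i : UnitAddCircle)) = h (tpt x y')) :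
    ∫ t, H t = ∫ t, H' t := by
  have hdiag : ∀ (y : Fin 3 → ℝ), y ∈ posCone → ∀ s u : ℝ, 0 ≤ s → 0 ≤ u →
      ∀ H H' : C(UnitAddTorus (Fin 3), ℂ),
      (∀ x : Fin 3 → ℝ, H (fun i => (x i : UnitAddCircle)) = h (tpt x y)) →
      (∀ x : Fin 3 → ℝ, H' (fun i => (x i : UnitAddCircle)) =
        h (tpt x ![y 0 + s, y 1, y 2 + u])) → ∫ t, H t = ∫ t, H' t := by
    intro y hy s u hs hu H H' hH hH'
    obtain ⟨H'', hH''⟩ := exists_torus_lift_tpt hd hp (posCone_add_single hy hs le_rfl)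
    have h1 := integral_torus_eq_of_segment hd hp ![1, 0, 0] hs (fun b hb _ => by
      convert posCone_add_single hy hb le_rfl using 1
      funext i
      fin_cases i <;> simp) (by funext i; fin_cases i <;> simp) H H'' hH hH''
    have h2 := integral_torus_eq_of_segment hd hp ![0, 0, 1] hu (fun b hb _ => by
      convert posCone_add_single hy hs hb using 1
      funext i
      fin_cases i <;> simp) (by funext i; fin_cases i <;> simp) H'' H' hH'' hH'
    exact h1.trans h2
  have hcommon : ∀ (y y' : Fin 3 → ℝ), y ∈ posCone → y' ∈ posCone → y 1 = y' 1 →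
      ∀ H H' : C(UnitAddTorus (Fin 3), ℂ),
      (∀ x : Fin 3 → ℝ, H (fun i => (x i : UnitAddCircle)) = h (tpt x y)) →
      (∀ x : Fin 3 → ℝ, H' (fun i => (x i : UnitAddCircle)) = h (tpt x y')) →
      ∫ t, H t = ∫ t, H' t := by
    intro y y' hy hy' h1 H H' hH hH'
    have e : ![y 0 + y' 0, y 1, y 2 + y' 2] = ![y' 0 + y 0, y' 1, y' 2 + y 2] := by
      rw [add_comm, h1, add_comm (y 2)]
    obtain ⟨H'', hH''⟩ := exists_torus_lift_tpt hd hp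
      (posCone_add_single hy hy'.1.le (posCone_pos hy').le)
    rw [hdiag y hy _ _ hy'.1.le (posCone_pos hy').le H H'' hH hH'']
    rw [e] at hH''
    exact (hdiag y' hy' _ _ hy.1.le (posCone_pos hy).le H' H'' hH' hH'').symm
  wlog hle : y 1 ≤ y' 1 generalizing y y' H H'
  · exact (this hy' hy H' H hH' hH (le_of_not_ge hle)).symm
  have hs := sub_nonneg.mpr hle
  obtain ⟨H'', hH''⟩ := exists_torus_lift_tpt hd hp (posCone_add_one hy hs)
  rw [integral_torus_eq_of_segment hd hp ![1, 1, 1] hs (fun b hb _ => posCone_add_one hy hb) rfl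
    H H'' hH hH'']
  exact hcommon _ y' (posCone_add_one hy hs) hy' (by simp) H'' H' hH'' hH'

lemma summable_exp_neg_abs {c : ℝ} (hc : 0 < c) :
    Summable fun n : Fin 3 → ℤ => Real.exp (-(c * ∑ i, |(n i : ℝ)|)) := by
  have h1 : Summable fun n : ℤ => Real.exp (-(c * |(n : ℝ)|)) := by
    have h : Summable fun n : ℕ => Real.exp (-(c * n)) := by
      refine (Real.summable_exp_nat_mul_iff.mpr (neg_lt_zero.mpr hc)).congr fun n => ?_
      ring_nf
    refine Summable.of_nat_of_neg ?_ ?_ <;> simpa using h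
  have h0 : ∀ n : ℤ, 0 ≤ Real.exp (-(c * |(n : ℝ)|)) := fun n => (Real.exp_pos _).le
  have h2 := h1.mul_of_nonneg h1 h0 h0
  have h3 := h1.mul_of_nonneg h2 h0 fun q => mul_nonneg (h0 _) (h0 _)
  let φ : (Fin 3 → ℤ) → ℤ × ℤ × ℤ := fun n => (n 0, n 1, n 2)
  have hφ : Function.Injective φ := fun n m h => by
    simp only [φ, Prod.mk.injEq] at h
    funext i
    fin_cases i
    exacts [h.1, h.2.1, h.2.2]
  refine (h3.comp_injective hφ).congr fun n => ?_
  simp only [Function.comp, φ, Fin.sum_univ_three]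
  rw [← Real.exp_add, ← Real.exp_add]
  ring_nf

/-- A periodic holomorphic function on the tube domain has an absolutely convergent Fourier
expansion. -/
theorem exists_fourier_expansion {g : (Fin 3 → ℂ) → ℂ} (hd : DifferentiableOn ℂ g tube)
    (hp : ∀ (n : Fin 3 → ℤ), ∀ w ∈ tube, g (fun i => w i + n i) = g w) :
    ∃ a : (Fin 3 → ℤ) → ℂ, ∀ w ∈ tube, HasSum (fun n => a n * ex (∑ i, n i * w i)) (g w) := by
  have hbase : (![1, 0, 1] : Fin 3 → ℝ) ∈ posCone := by simp [posCone]
  obtain ⟨G₀, hG₀⟩ := exists_torus_lift_tpt hd hp hbase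
  set c : (Fin 3 → ℤ) → (Fin 3 → ℝ) → ℂ := fun n y => ex (-∑ i, n i * (y i * I)) with hc
  set tw : (Fin 3 → ℤ) → (Fin 3 → ℝ) → C(UnitAddTorus (Fin 3), ℂ) → C(UnitAddTorus (Fin 3), ℂ) :=
    fun n y G => c n y • (UnitAddTorus.mFourier (-n) * G) with htw
  have htwint : ∀ n y (G : C(UnitAddTorus (Fin 3), ℂ)),
      ∫ t, tw n y G t = c n y * UnitAddTorus.mFourierCoeff G n := by
    intro n y G
    simp only [htw, UnitAddTorus.mFourierCoeff, ContinuousMap.smul_apply, ContinuousMap.mul_apply,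
      smul_eq_mul]
    rw [MeasureTheory.integral_const_mul]
  have hmF : ∀ (n : Fin 3 → ℤ) (x : Fin 3 → ℝ),
      UnitAddTorus.mFourier n (fun i => (x i : UnitAddCircle)) = ex (∑ i, n i * x i) := by
    intro n x
    simp only [UnitAddTorus.mFourier, ContinuousMap.coe_mk, fourier_coe_apply, ex]
    rw [← Complex.exp_sum, Finset.mul_sum]
    congr 1
    refine Finset.sum_congr rfl fun i _ => ?_
    simp
    ring
  have htwlift : ∀ n y (G : C(UnitAddTorus (Fin 3), ℂ)),
      (∀ x : Fin 3 → ℝ, G (fun i => (x i : UnitAddCircle)) = g (tpt x y)) →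
      ∀ x : Fin 3 → ℝ, tw n y G (fun i => (x i : UnitAddCircle)) =
        ex (-∑ i, n i * tpt x y i) * g (tpt x y) := by
    intro n y G hG x
    simp only [htw, ContinuousMap.smul_apply, ContinuousMap.mul_apply, smul_eq_mul, hmF, hG, hc]
    rw [← mul_assoc, ← ex_add]
    congr 2
    rw [← Finset.sum_neg_distrib, ← Finset.sum_neg_distrib, ← Finset.sum_add_distrib]
    refine Finset.sum_congr rfl fun i _ => ?_
    simp [tpt]
    ring
  have hconst : ∀ n y, y ∈ posCone → ∀ G : C(UnitAddTorus (Fin 3), ℂ),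
      (∀ x : Fin 3 → ℝ, G (fun i => (x i : UnitAddCircle)) = g (tpt x y)) →
      c n y * UnitAddTorus.mFourierCoeff G n =
        c n ![1, 0, 1] * UnitAddTorus.mFourierCoeff G₀ n := by
    intro n y hy G hG
    rw [← htwint, ← htwint]
    refine integral_torus_eq (h := fun w => ex (-∑ i, n i * w i) * g w) ?_ ?_ hy hbase _ _
      (htwlift n y G hG) (htwlift n _ G₀ hG₀)
    · refine DifferentiableOn.mul ?_ hd
      refine (differentiable_ex.comp ?_).differentiableOn
      fun_prop
    · intro m w hw
      simp only
      rw [hp m w hw]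
      congr 1
      have : -∑ i, (n i : ℂ) * (w i + m i) =
          -∑ i, (n i : ℂ) * w i + ((-∑ i, n i * m i : ℤ) : ℂ) := by
        push_cast
        simp only [mul_add, Finset.sum_add_distrib]
        ring
      rw [this, ex_add, ex_int, mul_one]
  refine ⟨fun n => c n ![1, 0, 1] * UnitAddTorus.mFourierCoeff G₀ n, fun w hw => ?_⟩
  set y : Fin 3 → ℝ := fun i => (w i).im with hy
  have hyc : y ∈ posCone := hw
  obtain ⟨G, hG⟩ := exists_torus_lift_tpt hd hp hyc
  have hnormc : ∀ n y, ‖c n y‖ = Real.exp (2 * Real.pi * ∑ i, n i * y i) := by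
    intro n y
    simp only [hc, norm_ex]
    congr 1
    simp
  have hsum : Summable (UnitAddTorus.mFourierCoeff G) := by
    obtain ⟨ε, hε, hball⟩ := Metric.isOpen_iff.mp isOpen_posCone y hyc
    have hmem : ∀ σ : Fin 3 → SignType, (fun i => y i - ε / 2 * (σ i : ℝ)) ∈ posCone := by
      intro σ
      refine hball ?_
      rw [Metric.mem_ball, dist_pi_lt_iff hε]
      intro i
      rw [Real.dist_eq]
      have : |((σ i : SignType) : ℝ)| ≤ 1 := by
        cases σ i <;> simp
      have h2 : y i - ε / 2 * (σ i : ℝ) - y i = -(ε / 2 * (σ i : ℝ)) := by ring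
      rw [h2, abs_neg, abs_mul, abs_of_pos (half_pos hε)]
      nlinarith
    choose G' hG' using fun σ => exists_torus_lift_tpt hd hp (hmem σ)
    refine Summable.of_norm_bounded (g := fun n => (∑ σ, ‖G' σ‖) *
      Real.exp (-(Real.pi * ε * ∑ i, |(n i : ℝ)|)))
      ((summable_exp_neg_abs (mul_pos Real.pi_pos hε)).mul_left _) fun n => ?_
    set σ : Fin 3 → SignType := fun i => SignType.sign (n i : ℝ) with hσ
    have h1 := (hconst n y hyc G hG).trans (hconst n _ (hmem σ) (G' σ) (hG' σ)).symm
    have h2 : ‖UnitAddTorus.mFourierCoeff (G' σ) n‖ ≤ ∑ σ, ‖G' σ‖ := by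
      refine le_trans ?_ (Finset.single_le_sum (f := fun σ => ‖G' σ‖) (fun _ _ => norm_nonneg _)
        (Finset.mem_univ σ))
      have h3 := MeasureTheory.norm_integral_le_of_norm_le_const
        (μ := (MeasureTheory.volume : MeasureTheory.Measure (UnitAddTorus (Fin 3))))
        (f := fun t => UnitAddTorus.mFourier (-n) t • G' σ t) (C := ‖G' σ‖)
        (Filter.Eventually.of_forall fun t => by
          rw [norm_smul]
          have h4 := (UnitAddTorus.mFourier (-n)).norm_coe_le_norm t
          rw [UnitAddTorus.mFourier_norm] at h4
          have h5 := (G' σ).norm_coe_le_norm t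
          calc _ ≤ 1 * ‖G' σ‖ := mul_le_mul h4 h5 (norm_nonneg _) zero_le_one
            _ = _ := one_mul _)
      simpa using! h3
    have h3 := congrArg norm h1
    rw [norm_mul, norm_mul, hnormc, hnormc] at h3
    have h4 : ∑ i, (n i : ℝ) * (y i - ε / 2 * (σ i : ℝ)) =
        ∑ i, (n i : ℝ) * y i - ε / 2 * ∑ i, |(n i : ℝ)| := by
      rw [Finset.mul_sum, ← Finset.sum_sub_distrib]
      refine Finset.sum_congr rfl fun i _ => ?_
      rw [hσ, ← self_mul_sign (n i : ℝ)]
      ring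
    rw [h4] at h3
    have h5 : 2 * Real.pi * (∑ i, (n i : ℝ) * y i - ε / 2 * ∑ i, |(n i : ℝ)|) =
        2 * Real.pi * (∑ i, (n i : ℝ) * y i) + -(Real.pi * ε * ∑ i, |(n i : ℝ)|) := by ring
    rw [h5, Real.exp_add, mul_assoc (Real.exp _)] at h3
    have h6 := mul_left_cancel₀ (Real.exp_pos _).ne' h3
    rw [h6, mul_comm]
    gcongr
  have hfin := UnitAddTorus.hasSum_mFourier_series_apply_of_summable hsum
    (fun i => ((w i).re : UnitAddCircle))
  rw [hG, ← eq_tpt w] at hfin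
  refine hfin.congr_fun fun n => ?_
  beta_reduce
  rw [← hconst n y hyc G hG, hmF, mul_comm (c n y), mul_assoc, smul_eq_mul, hc, ← ex_add]
  congr 2
  rw [← Finset.sum_neg_distrib, ← Finset.sum_add_distrib]
  refine Finset.sum_congr rfl fun i _ => ?_
  conv_lhs => rw [← Complex.re_add_im (w i)]
  simp only [hy]
  ring

end TorusIntegral

end

section

/-! ### Fourier coefficients of Siegel modular forms of level one -/

/-- `a` is the family of Fourier coefficients of `g` on the tube domain. -/
def IsFourier (a : (Fin 3 → ℤ) → ℂ) (g : (Fin 3 → ℂ) → ℂ) : Prop :=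
  ∀ w ∈ tube, HasSum (fun n => a n * ex (∑ i, n i * w i)) (g w)

lemma IsFourier.unique {a b : (Fin 3 → ℤ) → ℂ} {g : (Fin 3 → ℂ) → ℂ} (ha : IsFourier a g)
    (hb : IsFourier b g) : a = b := by
  funext n
  have hbase : (![1, 0, 1] : Fin 3 → ℝ) ∈ posCone := by simp [posCone]
  have key := eq_zero_of_hasSum_exp (fun n : Fin 3 → ℤ => n) Function.injective_id
    (fun n => (a n - b n) * ex (∑ i, n i * ((![1, 0, 1] : Fin 3 → ℝ) i * I))) (fun x => ?_) n
  · exact sub_eq_zero.mp ((mul_eq_zero.mp key).resolve_right (ex_ne_zero _))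
  · have h := (ha (tpt x _) (tpt_mem_tube.mpr hbase)).sub (hb (tpt x _) (tpt_mem_tube.mpr hbase))
    rw [sub_self] at h
    refine h.congr_fun fun n => ?_
    change (a n - b n) * ex _ * ex (∑ i, (n i : ℂ) * x i) = _
    rw [← sub_mul, mul_assoc, ← ex_add, ← Finset.sum_add_distrib]
    congr 2
    refine Finset.sum_congr rfl fun i _ => ?_
    simp only [tpt]
    ring

lemma IsFourier.apply_equiv {a : (Fin 3 → ℤ) → ℂ} {g : (Fin 3 → ℂ) → ℂ} (ha : IsFourier a g)
    (σ : (Fin 3 → ℤ) ≃ (Fin 3 → ℤ)) (L : (Fin 3 → ℂ) → Fin 3 → ℂ)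
    (hL : ∀ w ∈ tube, L w ∈ tube) (hg : ∀ w ∈ tube, g (L w) = g w)
    (hσ : ∀ (n : Fin 3 → ℤ) w, ∑ i, n i * L w i = ∑ i, (σ n i : ℂ) * w i) (n : Fin 3 → ℤ) :
    a (σ n) = a n := by
  have h : IsFourier (a ∘ σ.symm) g := by
    intro w hw
    have h1 := ha _ (hL w hw)
    rw [hg w hw] at h1
    rw [← σ.hasSum_iff]
    refine h1.congr_fun fun n => ?_
    simp [hσ]
  have := congrFun (h.unique ha) (σ n)
  simpa using this.symm

/-- The invariance properties of a Siegel modular form of degree two, weight `K` and level one. -/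
structure IsLevelOne (K : ℤ) (g : (Fin 3 → ℂ) → ℂ) : Prop where
  diff : DifferentiableOn ℂ g tube
  periodic : ∀ (n : Fin 3 → ℤ), ∀ w ∈ tube, g (fun i => w i + n i) = g w
  swap : ∀ w ∈ tube, g ![w 2, w 1, w 0] = g w
  neg : ∀ w ∈ tube, g ![w 0, -w 1, w 2] = g w
  shear : ∀ w ∈ tube, g ![w 0, w 1 + w 0, w 2 + 2 * w 1 + w 0] = g w
  inversion : ∀ w ∈ tube, g ![-1 / w 0, w 1 / w 0, w 2 - w 1 ^ 2 / w 0] = w 0 ^ K * g w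

lemma mem_tube {w : Fin 3 → ℂ} :
    w ∈ tube ↔ 0 < (w 0).im ∧ (w 1).im ^ 2 < (w 0).im * (w 2).im := Iff.rfl

lemma vec3_mem_tube {τ z τ' : ℂ} :
    ![τ, z, τ'] ∈ tube ↔ 0 < τ.im ∧ z.im ^ 2 < τ.im * τ'.im := by
  simp [mem_tube]

lemma vec3_eta {α : Type*} (w : Fin 3 → α) : ![w 0, w 1, w 2] = w := by
  funext i
  fin_cases i <;> rfl

namespace IsLevelOne

variable {K : ℤ} {g : (Fin 3 → ℂ) → ℂ} {a : (Fin 3 → ℤ) → ℂ}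

lemma coeff_swap (hg : IsLevelOne K g) (ha : IsFourier a g) (n r m : ℤ) :
    a ![m, r, n] = a ![n, r, m] := by
  let σ : (Fin 3 → ℤ) ≃ (Fin 3 → ℤ) :=
    ⟨fun n => ![n 2, n 1, n 0], fun n => ![n 2, n 1, n 0], fun n => vec3_eta n,
      fun n => vec3_eta n⟩
  exact ha.apply_equiv σ (fun w => ![w 2, w 1, w 0]) (fun w hw => by
      have h2 : 0 < (w 2).im := posCone_pos (y := fun i => (w i).im) hw
      rw [mem_tube] at hw
      rw [vec3_mem_tube]
      exact ⟨h2, by nlinarith⟩) hg.swap (fun n w => by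
      change _ = ∑ i, ((![n 2, n 1, n 0] i : ℤ) : ℂ) * w i
      simp [Fin.sum_univ_three]
      ring) ![n, r, m]

lemma coeff_neg (hg : IsLevelOne K g) (ha : IsFourier a g) (n r m : ℤ) :
    a ![n, -r, m] = a ![n, r, m] := by
  let σ : (Fin 3 → ℤ) ≃ (Fin 3 → ℤ) :=
    ⟨fun n => ![n 0, -n 1, n 2], fun n => ![n 0, -n 1, n 2],
      fun n => by simpa using vec3_eta n, fun n => by simpa using vec3_eta n⟩
  exact ha.apply_equiv σ (fun w => ![w 0, -w 1, w 2]) (fun w hw => by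
      rw [mem_tube] at hw
      rw [vec3_mem_tube]
      simpa using hw) hg.neg (fun n w => by
      simp [σ, Fin.sum_univ_three]) ![n, r, m]

lemma shear_mem {w : Fin 3 → ℂ} (hw : w ∈ tube) :
    ![w 0, w 1 + w 0, w 2 + 2 * w 1 + w 0] ∈ tube := by
  rw [mem_tube] at hw
  rw [vec3_mem_tube]
  refine ⟨hw.1, ?_⟩
  simp only [add_im, mul_im, re_ofNat, im_ofNat, zero_mul, add_zero]
  nlinarith [hw.2]

lemma coeff_shear (hg : IsLevelOne K g) (ha : IsFourier a g) (n r m : ℤ) :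
    a ![n + r + m, r + 2 * m, m] = a ![n, r, m] := by
  let σ : (Fin 3 → ℤ) ≃ (Fin 3 → ℤ) :=
    ⟨fun n => ![n 0 + n 1 + n 2, n 1 + 2 * n 2, n 2],
      fun n => ![n 0 - n 1 + n 2, n 1 - 2 * n 2, n 2],
      fun n => by
        funext i
        fin_cases i <;> simp
        ring,
      fun n => by
        funext i
        fin_cases i <;> simp
        ring⟩
  exact ha.apply_equiv σ (fun w => ![w 0, w 1 + w 0, w 2 + 2 * w 1 + w 0])
    (fun w hw => shear_mem hw) hg.shear (fun n w => by
      simp [σ, Fin.sum_univ_three]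
      ring) ![n, r, m]

lemma coeff_shear_iterate (hg : IsLevelOne K g) (ha : IsFourier a g) (n r m : ℤ) (l : ℕ) :
    a ![n + l * r + l ^ 2 * m, r + 2 * l * m, m] = a ![n, r, m] := by
  induction l with
  | zero => simp
  | succ l ih =>
    rw [← ih, ← hg.coeff_shear ha (n + l * r + l ^ 2 * m)]
    congr 2
    · push_cast
      ring
    · congr 1
      push_cast
      ring

lemma coeff_eq_zero_of_neg (hg : IsLevelOne K g) (ha : IsFourier a g) (n r : ℤ) {m : ℤ}
    (hm : m < 0) : a ![n, r, m] = 0 := by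
  by_contra hne
  have hw : (![I, 0, I] : Fin 3 → ℂ) ∈ tube := by simp [vec3_mem_tube]
  have hs := (ha _ hw).summable.norm
  have hinj : Function.Injective fun l : ℕ => ![n + l * r + l ^ 2 * m, r + 2 * l * m, m] := by
    intro l l' h
    have h1 := congrFun h 1
    simp only [Matrix.cons_val_one, Matrix.cons_val_zero] at h1
    have h2 : (l : ℤ) * m = l' * m := by linarith
    exact_mod_cast mul_right_cancel₀ hm.ne h2
  have ht := (hs.comp_injective hinj).tendsto_atTop_zero
  have hlow : ∀ l : ℕ, ‖a ![n, r, m]‖ * Real.exp (-(2 * Real.pi * (n + r ^ 2 + m))) ≤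
      ‖a ![n + l * r + l ^ 2 * m, r + 2 * l * m, m] *
        ex (∑ i, ((![n + l * r + l ^ 2 * m, r + 2 * l * m, m] : Fin 3 → ℤ) i : ℂ) *
          (![I, 0, I] : Fin 3 → ℂ) i)‖ := by
    intro l
    rw [hg.coeff_shear_iterate ha, norm_mul, norm_ex]
    refine mul_le_mul_of_nonneg_left (Real.exp_le_exp.mpr ?_) (norm_nonneg _)
    rw [neg_le_neg_iff]
    refine mul_le_mul_of_nonneg_left ?_ (by positivity)
    have h3 : n + l * r + l ^ 2 * m + m ≤ n + r ^ 2 + m := by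
      nlinarith [sq_nonneg (2 * r - (l : ℤ)),
        mul_nonneg (sq_nonneg (l : ℤ)) (show 0 ≤ -1 - m by omega),
        sq_nonneg r]
    have h4 : ((n + l * r + l ^ 2 * m + m : ℤ) : ℝ) ≤ ((n + r ^ 2 + m : ℤ) : ℝ) := by
      exact_mod_cast h3
    push_cast at h4
    have h5 : ((l : ℂ) ^ 2).re = (l : ℝ) ^ 2 := by norm_cast
    simpa [Fin.sum_univ_three, h5] using! h4
  have h5 := ge_of_tendsto' ht hlow
  have h6 : 0 < ‖a ![n, r, m]‖ * Real.exp (-(2 * Real.pi * (n + r ^ 2 + m))) := by positivity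
  linarith

lemma coeff_support (hg : IsLevelOne K g) (ha : IsFourier a g) {n r m : ℤ}
    (h : a ![n, r, m] ≠ 0) : 0 ≤ n ∧ 0 ≤ m ∧ |r| ≤ n + m := by
  have h1 : ∀ {n r m : ℤ}, a ![n, r, m] ≠ 0 → 0 ≤ m := fun h => by
    by_contra h'
    exact h (hg.coeff_eq_zero_of_neg ha _ _ (not_le.mp h'))
  have h2 : ∀ {n r m : ℤ}, a ![n, r, m] ≠ 0 → 0 ≤ n := fun h => by
    rw [← hg.coeff_swap ha] at h
    exact h1 h
  have h3 : ∀ {n r m : ℤ}, a ![n, r, m] ≠ 0 → 0 ≤ n + r + m := fun h => by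
    rw [← hg.coeff_shear ha] at h
    exact h2 h
  have h4 := h3 h
  rw [← hg.coeff_neg ha] at h
  have h5 := h3 h
  refine ⟨h2 h, h1 h, abs_le.mpr ⟨?_, ?_⟩⟩ <;> linarith

end IsLevelOne

end

section

/-! ### Fourier–Jacobi coefficients -/

/-- The terms of the `m`-th Fourier–Jacobi coefficient. -/
def fjTerm (a : (Fin 3 → ℤ) → ℂ) (m : ℤ) (τ z : ℂ) (q : ℤ × ℤ) : ℂ :=
  a ![q.1, q.2, m] * ex (q.1 * τ + q.2 * z)

/-- The `m`-th Fourier–Jacobi coefficient. -/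
def fj (a : (Fin 3 → ℤ) → ℂ) (m : ℤ) (τ z : ℂ) : ℂ := ∑' q, fjTerm a m τ z q

/-- Indices of Fourier coefficients, sorted by the last coordinate. -/
def fjEquiv : ℤ × ℤ × ℤ ≃ (Fin 3 → ℤ) where
  toFun q := ![q.2.1, q.2.2, q.1]
  invFun n := (n 2, n 0, n 1)
  left_inv _ := rfl
  right_inv n := vec3_eta n

lemma exists_mem_tube {τ : ℂ} (hτ : 0 < τ.im) (z : ℂ) {τ' : ℂ} (h : z.im ^ 2 / τ.im < τ'.im) :
    ![τ, z, τ'] ∈ tube := by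
  rw [vec3_mem_tube]
  refine ⟨hτ, ?_⟩
  rw [div_lt_iff₀ hτ] at h
  linarith

variable {a : (Fin 3 → ℤ) → ℂ} {g : (Fin 3 → ℂ) → ℂ}

lemma IsFourier.hasSum_prod (ha : IsFourier a g) {τ z τ' : ℂ} (hw : ![τ, z, τ'] ∈ tube) :
    HasSum (fun q : ℤ × ℤ × ℤ => fjTerm a q.1 τ z q.2 * ex (q.1 * τ')) (g ![τ, z, τ']) := by
  refine (fjEquiv.hasSum_iff.mpr (ha _ hw)).congr_fun fun q => ?_
  change _ = a ![q.2.1, q.2.2, q.1] *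
    ex (∑ i, ((![q.2.1, q.2.2, q.1] i : ℤ) : ℂ) * (![τ, z, τ'] : Fin 3 → ℂ) i)
  rw [fjTerm, mul_assoc, ← ex_add, Fin.sum_univ_three]
  simp

lemma IsFourier.summable_fjTerm (ha : IsFourier a g) (m : ℤ) {τ : ℂ} (hτ : 0 < τ.im) (z : ℂ) :
    Summable (fjTerm a m τ z) := by
  have hw : ![τ, z, ((z.im ^ 2 / τ.im + 1 : ℝ) : ℂ) * I] ∈ tube :=
    exists_mem_tube hτ z (by rw [Complex.mul_I_im, ofReal_re]; linarith)
  have h := (ha.hasSum_prod hw).summable.comp_injective (Prod.mk_right_injective m)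
  refine (h.mul_right (ex (m * (((z.im ^ 2 / τ.im + 1 : ℝ) : ℂ) * I)))⁻¹).congr fun q => ?_
  simp only [Function.comp]
  rw [mul_inv_cancel_right₀ (ex_ne_zero _)]

lemma IsFourier.hasSum_fj (ha : IsFourier a g) {τ z τ' : ℂ} (hw : ![τ, z, τ'] ∈ tube) :
    HasSum (fun m : ℤ => fj a m τ z * ex (m * τ')) (g ![τ, z, τ']) := by
  refine (ha.hasSum_prod hw).prod_fiberwise fun m => ?_
  exact ((ha.summable_fjTerm m (vec3_mem_tube.mp hw).1 z).hasSum).mul_right _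

lemma coeff_unique_of_im_gt {A B : ℤ → ℂ} {G : ℂ → ℂ} (y : ℝ)
    (hA : ∀ τ' : ℂ, y < τ'.im → HasSum (fun m : ℤ => A m * ex (m * τ')) (G τ'))
    (hB : ∀ τ' : ℂ, y < τ'.im → HasSum (fun m : ℤ => B m * ex (m * τ')) (G τ')) (m : ℤ) :
    A m = B m := by
  have key := eq_zero_of_hasSum_exp (fun (m : ℤ) (_ : Fin 1) => m)
    (fun m m' h => congrFun h 0)
    (fun m => (A m - B m) * ex (m * ((y + 1 : ℝ) * I))) (fun x => ?_) m
  · exact sub_eq_zero.mp ((mul_eq_zero.mp key).resolve_right (ex_ne_zero _))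
  · have hy : y < ((x 0 : ℂ) + ((y + 1 : ℝ) : ℂ) * I).im := by simp
    have h := (hA _ hy).sub (hB _ hy)
    rw [sub_self] at h
    refine h.congr_fun fun m => ?_
    change (A m - B m) * ex _ * ex (∑ i, (m : ℂ) * x i) = _
    rw [← sub_mul, mul_assoc, ← ex_add]
    congr 2
    simp
    ring

variable {K : ℤ}

lemma IsLevelOne.fj_add (hg : IsLevelOne K g) (ha : IsFourier a g) (m : ℤ) {τ : ℂ}
    (hτ : 0 < τ.im) (z : ℂ) : fj a m τ (z + τ) = ex (-(m * (τ + 2 * z))) * fj a m τ z := by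
  have key := coeff_unique_of_im_gt (A := fun m => fj a m τ (z + τ) * ex (m * (τ + 2 * z)))
    (B := fun m => fj a m τ z) (G := fun τ' => g ![τ, z, τ']) (z.im ^ 2 / τ.im) (fun τ' h => ?_)
    (fun τ' h => ha.hasSum_fj (exists_mem_tube hτ z h)) m
  · rw [ex_neg, ← key]
    field_simp [ex_ne_zero]
  · have hw := exists_mem_tube hτ z h
    have h1 := ha.hasSum_fj (τ := τ) (z := z + τ) (τ' := τ' + 2 * z + τ)
      (by simpa using IsLevelOne.shear_mem hw)
    have h2 := hg.shear _ hw
    simp only [Matrix.cons_val_zero, Matrix.cons_val_one, Matrix.cons_val] at h2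
    rw [h2] at h1
    refine h1.congr_fun fun m => ?_
    rw [mul_assoc, ← ex_add]
    congr 2
    ring

lemma inversion_mem {w : Fin 3 → ℂ} (hw : w ∈ tube) :
    ![-1 / w 0, w 1 / w 0, w 2 - w 1 ^ 2 / w 0] ∈ tube := by
  rw [mem_tube] at hw
  have h0 : w 0 ≠ 0 := ne_zero_of_im_pos hw.1
  have hN : 0 < normSq (w 0) := normSq_pos.mpr h0
  rw [vec3_mem_tube]
  refine ⟨im_neg_one_div hw.1, ?_⟩
  have e : (-1 / w 0).im * (w 2 - w 1 ^ 2 / w 0).im - (w 1 / w 0).im ^ 2 =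
      ((w 0).im * (w 2).im - (w 1).im ^ 2) / normSq (w 0) := by
    simp only [div_im, sub_im, neg_re, neg_im, one_re, one_im, pow_two, mul_re, mul_im]
    have hN' : normSq (w 0) = (w 0).re * (w 0).re + (w 0).im * (w 0).im := normSq_apply _
    field_simp
    rw [hN']
    ring
  have := div_pos (sub_pos.mpr hw.2) hN
  linarith

lemma IsLevelOne.fj_inversion (hg : IsLevelOne K g) (ha : IsFourier a g) (m : ℤ) {τ : ℂ}
    (hτ : 0 < τ.im) (z : ℂ) :
    fj a m (-1 / τ) (z / τ) = τ ^ K * ex (m * (z ^ 2 / τ)) * fj a m τ z := by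
  have key := coeff_unique_of_im_gt
    (A := fun m => fj a m (-1 / τ) (z / τ) * ex (-(m * (z ^ 2 / τ))))
    (B := fun m => τ ^ K * fj a m τ z) (G := fun τ' => τ ^ K * g ![τ, z, τ']) (z.im ^ 2 / τ.im)
    (fun τ' h => ?_)
    (fun τ' h => ((ha.hasSum_fj (exists_mem_tube hτ z h)).mul_left (τ ^ K)).congr_fun fun m => by
      ring) m
  · simp only [ex_neg] at key
    rw [mul_right_comm, ← key, inv_mul_cancel_right₀ (ex_ne_zero _)]
  · have hw := exists_mem_tube hτ z h
    have h1 := ha.hasSum_fj (τ := -1 / τ) (z := z / τ) (τ' := τ' - z ^ 2 / τ)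
      (by simpa using inversion_mem hw)
    have h2 := hg.inversion _ hw
    simp only [Matrix.cons_val_zero, Matrix.cons_val_one, Matrix.cons_val] at h2
    rw [h2] at h1
    refine h1.congr_fun fun m => ?_
    rw [mul_assoc, ← ex_add]
    congr 2
    ring

/-! ### Expansion of a Fourier–Jacobi coefficient in `q` and `s = ζ + ζ⁻¹ - 2` -/

open Polynomial in
/-- The polynomial `P` with `P (ζ + ζ⁻¹ - 2) = ζ ^ r + ζ⁻¹ ^ r` (twice the constant `1` for
`r = 0`). -/
def symPoly : ℕ → ℤ[X]
  | 0 => 2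
  | 1 => X + 2
  | (r + 2) => (X + 2) * symPoly (r + 1) - symPoly r

open Polynomial in
/-- A majorant of `symPoly`. -/
def symMajorant : ℕ → ℤ[X]
  | 0 => 2
  | 1 => X + 2
  | (r + 2) => (X + 2) * symMajorant (r + 1) + symMajorant r

open Polynomial in
lemma aeval_symPoly {x : ℂ} (hx : x ≠ 0) (r : ℕ) :
    aeval (x + x⁻¹ - 2) (symPoly r) = x ^ r + x⁻¹ ^ r := by
  have h2 : aeval (x + x⁻¹ - 2) (2 : ℤ[X]) = 2 := map_ofNat _ 2
  induction r using Nat.twoStepInduction with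
  | zero => rw [symPoly, h2]; norm_num
  | one => simp [symPoly, h2]
  | more r h0 h1 =>
    rw [symPoly, map_sub, map_mul, h0, h1]
    simp only [map_add, aeval_X, map_ofNat]
    have : x * x⁻¹ = 1 := mul_inv_cancel₀ hx
    linear_combination (x ^ r + x⁻¹ ^ r) * this

open Polynomial in
lemma coeff_X_add_two_mul (P : ℤ[X]) (l : ℕ) :
    ((X + 2) * P).coeff l = (if l = 0 then 0 else P.coeff (l - 1)) + 2 * P.coeff l := by
  have h2 : (2 : ℤ[X]) = C 2 := rfl
  rw [add_mul, coeff_add, h2, coeff_C_mul]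
  cases l <;> simp

lemma abs_coeff_symPoly_le (r l : ℕ) : |(symPoly r).coeff l| ≤ (symMajorant r).coeff l := by
  have h2 : ∀ l, |(2 : Polynomial ℤ).coeff l| ≤ (2 : Polynomial ℤ).coeff l := fun l => by
    have h2 : (2 : Polynomial ℤ) = Polynomial.C 2 := rfl
    rw [h2, Polynomial.coeff_C]
    split_ifs <;> simp
  induction r using Nat.twoStepInduction generalizing l with
  | zero => exact h2 l
  | one =>
    have h := h2 l
    simp only [symPoly, symMajorant, Polynomial.coeff_add, Polynomial.coeff_X]
    refine (abs_add_le _ _).trans (add_le_add ?_ h)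
    split_ifs <;> simp
  | more r h0 h1 =>
    rw [symPoly, symMajorant, Polynomial.coeff_sub, Polynomial.coeff_add, coeff_X_add_two_mul,
      coeff_X_add_two_mul]
    refine (abs_sub _ _).trans (add_le_add ((abs_add_le _ _).trans (add_le_add ?_ ?_)) (h0 l))
    · split_ifs
      · simp
      · exact h1 _
    · rw [abs_mul]
      simpa using h1 l

lemma natDegree_symPoly_le (r : ℕ) : (symPoly r).natDegree ≤ r := by
  induction r using Nat.twoStepInduction with
  | zero => exact (Polynomial.natDegree_C 2).le
  | one => exact (Polynomial.natDegree_X_add_C (2 : ℤ)).le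
  | more r h0 h1 =>
    rw [symPoly]
    refine (Polynomial.natDegree_sub_le _ _).trans (max_le ?_ (h0.trans (by omega)))
    refine Polynomial.natDegree_mul_le.trans ?_
    have := (Polynomial.natDegree_X_add_C (2 : ℤ)).le
    have h : ((Polynomial.X : Polynomial ℤ) + 2).natDegree ≤ 1 := this
    omega

lemma coeff_symPoly_self (r : ℕ) (hr : r ≠ 0) : (symPoly r).coeff r = 1 := by
  induction r using Nat.twoStepInduction with
  | zero => exact absurd rfl hr
  | one =>
    have h2 : symPoly 1 = Polynomial.X + Polynomial.C 2 := rfl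
    simp [h2]
  | more r h0 h1 =>
    rw [symPoly, Polynomial.coeff_sub, coeff_X_add_two_mul,
      Polynomial.coeff_eq_zero_of_natDegree_lt
        ((natDegree_symPoly_le r).trans_lt (by omega : r < r + 2)),
      Polynomial.coeff_eq_zero_of_natDegree_lt
        ((natDegree_symPoly_le (r + 1)).trans_lt (by omega : r + 1 < r + 2))]
    simpa using h1 (by omega)

lemma natDegree_symMajorant_le (r : ℕ) : (symMajorant r).natDegree ≤ r := by
  induction r using Nat.twoStepInduction with
  | zero => exact (Polynomial.natDegree_C 2).le
  | one => exact (Polynomial.natDegree_X_add_C (2 : ℤ)).le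
  | more r h0 h1 =>
    rw [symMajorant]
    refine (Polynomial.natDegree_add_le _ _).trans (max_le ?_ (h0.trans (by omega)))
    refine Polynomial.natDegree_mul_le.trans ?_
    have := (Polynomial.natDegree_X_add_C (2 : ℤ)).le
    have h : ((Polynomial.X : Polynomial ℤ) + 2).natDegree ≤ 1 := this
    omega

lemma aeval_symMajorant_le {x : ℝ} (hx : 0 ≤ x) (r : ℕ) :
    0 ≤ Polynomial.aeval x (symMajorant r) ∧
      Polynomial.aeval x (symMajorant r) ≤ 2 * (x + 3) ^ r := by
  have h2 : Polynomial.aeval x (2 : Polynomial ℤ) = 2 := map_ofNat _ 2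
  induction r using Nat.twoStepInduction with
  | zero => simp [symMajorant, h2]
  | one =>
    simp only [symMajorant, map_add, Polynomial.aeval_X, h2, pow_one]
    constructor <;> linarith
  | more r h0 h1 =>
    simp only [symMajorant, map_add, map_mul, Polynomial.aeval_X, map_ofNat]
    refine ⟨add_nonneg (mul_nonneg (by linarith) h1.1) h0.1, ?_⟩
    have hp : (0 : ℝ) ≤ (x + 3) ^ r := by positivity
    calc _ ≤ (x + 2) * (2 * (x + 3) ^ (r + 1)) + 2 * (x + 3) ^ r := by
          gcongr
          exacts [h1.2, h0.2]
      _ ≤ _ := by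
        rw [pow_add, pow_add]
        nlinarith [mul_nonneg hx hp]

end

section

lemma hasSum_coeff_mul_pow (P : Polynomial ℤ) (s : ℂ) :
    HasSum (fun l : ℕ => (P.coeff l : ℂ) * s ^ l) (Polynomial.aeval s P) := by
  rw [Polynomial.aeval_eq_sum_range]
  simp only [zsmul_eq_mul]
  refine hasSum_sum_of_ne_finset_zero fun l hl => ?_
  rw [Polynomial.coeff_eq_zero_of_natDegree_lt (by simpa using hl)]
  simp

lemma summable_norm_coeff_symPoly (r : ℕ) (s : ℂ) :
    Summable (fun l : ℕ => ‖((symPoly r).coeff l : ℂ) * s ^ l‖) ∧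
      ∑' l : ℕ, ‖((symPoly r).coeff l : ℂ) * s ^ l‖ ≤ 2 * (‖s‖ + 3) ^ r := by
  have hs := (hasSum_coeff_mul_pow (symPoly r) s).summable.norm
  refine ⟨hs, le_trans ?_ (aeval_symMajorant_le (norm_nonneg s) r).2⟩
  rw [Polynomial.aeval_eq_sum_range' (Nat.lt_succ_of_le (natDegree_symMajorant_le r)),
    tsum_eq_sum (s := Finset.range (r + 1)) fun l hl => ?_]
  · refine Finset.sum_le_sum fun l _ => ?_
    rw [norm_mul, norm_pow, zsmul_eq_mul]
    refine mul_le_mul_of_nonneg_right ?_ (by positivity)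
    rw [Complex.norm_intCast]
    exact_mod_cast abs_coeff_symPoly_le r l
  · have : r < l := by simpa using hl
    rw [Polynomial.coeff_eq_zero_of_natDegree_lt ((natDegree_symPoly_le r).trans_lt this)]
    simp

lemma exists_norm_ex_eq {b : ℝ} (hb : 0 < b) : ∃ z : ℂ, ∀ r : ℤ, ‖ex (r * z)‖ = b ^ r := by
  refine ⟨((-(Real.log b / (2 * Real.pi)) : ℝ) : ℂ) * I, fun r => ?_⟩
  rw [ex_int_mul, norm_zpow, norm_ex, Complex.mul_I_im, ofReal_re]
  congr 1
  rw [mul_neg, neg_neg, mul_div_cancel₀ _ (by positivity), Real.exp_log hb]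

/-- The terms of the expansion of a Fourier–Jacobi coefficient in `q` and `s`. -/
def qsTerm (a : (Fin 3 → ℤ) → ℂ) (m : ℤ) (τ s : ℂ) (x : (ℤ × ℤ) × ℕ) : ℂ :=
  a ![x.1.1, x.1.2, m] * ex (x.1.1 * τ) *
    (2⁻¹ * (((symPoly x.1.2.natAbs).coeff x.2 : ℂ) * s ^ x.2))

variable {a : (Fin 3 → ℤ) → ℂ} {g : (Fin 3 → ℂ) → ℂ} {K : ℤ}

lemma IsFourier.summable_qsTerm (ha : IsFourier a g) (m : ℤ) {τ : ℂ} (hτ : 0 < τ.im) (s : ℂ) :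
    Summable (qsTerm a m τ s) := by
  refine Summable.of_norm ?_
  rw [summable_prod_of_nonneg fun _ => norm_nonneg _]
  have hb : (1 : ℝ) ≤ ‖s‖ + 3 := by linarith [norm_nonneg s]
  have hb0 : (0 : ℝ) < ‖s‖ + 3 := by linarith
  obtain ⟨z, hz⟩ := exists_norm_ex_eq hb0
  simp only [qsTerm, norm_mul]
  simp only [← norm_mul _ (s ^ _)]
  refine ⟨fun q => ((summable_norm_coeff_symPoly q.2.natAbs s).1.mul_left _).mul_left _, ?_⟩
  refine Summable.of_nonneg_of_le (fun q => tsum_nonneg fun l => by positivity) (fun q => ?_)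
    ((ha.summable_fjTerm m hτ z).norm.add (ha.summable_fjTerm m hτ (-z)).norm)
  rw [tsum_mul_left, tsum_mul_left]
  have h1 := (summable_norm_coeff_symPoly q.2.natAbs s).2
  have e1 : ‖fjTerm a m τ z q‖ = ‖a ![q.1, q.2, m]‖ * ‖ex (q.1 * τ)‖ * (‖s‖ + 3) ^ q.2 := by
    rw [fjTerm, ex_add, norm_mul, norm_mul, hz, mul_assoc]
  have e2 : ‖fjTerm a m τ (-z) q‖ = ‖a ![q.1, q.2, m]‖ * ‖ex (q.1 * τ)‖ * (‖s‖ + 3) ^ (-q.2) := by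
    rw [fjTerm, ex_add, norm_mul, norm_mul, ← hz, mul_assoc]
    congr 4
    push_cast
    ring
  rw [e1, e2, ← mul_add]
  refine mul_le_mul_of_nonneg_left ?_ (by positivity)
  have h2 : (‖s‖ + 3) ^ q.2.natAbs ≤ (‖s‖ + 3) ^ q.2 + (‖s‖ + 3) ^ (-q.2) := by
    rcases Int.natAbs_eq q.2 with h | h
    · have : (‖s‖ + 3) ^ q.2.natAbs = (‖s‖ + 3) ^ q.2 := by
        conv_rhs => rw [h, zpow_natCast]
      rw [this]
      linarith [zpow_pos hb0 (-q.2)]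
    · have : (‖s‖ + 3) ^ q.2.natAbs = (‖s‖ + 3) ^ (-q.2) := by
        conv_rhs => rw [h, neg_neg, zpow_natCast]
      rw [this]
      linarith [zpow_pos hb0 q.2]
  have h3 : ‖(2 : ℂ)⁻¹‖ = 2⁻¹ := by simp
  rw [h3]
  linarith

lemma IsLevelOne.hasSum_qsTerm (hg : IsLevelOne K g) (ha : IsFourier a g) (m : ℤ) {τ : ℂ}
    (hτ : 0 < τ.im) (z : ℂ) : HasSum (qsTerm a m τ (sv z)) (fj a m τ z) := by
  have hs := ha.summable_qsTerm m hτ (sv z)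
  have h1 := hs.hasSum.prod_fiberwise fun q =>
    (((hasSum_coeff_mul_pow (symPoly q.2.natAbs) (sv z)).mul_left 2⁻¹).mul_left
      (a ![q.1, q.2, m] * ex (q.1 * τ)))
  have h2 := (ha.summable_fjTerm m hτ z).hasSum
  have h3 : HasSum (fun q : ℤ × ℤ => fjTerm a m τ z (q.1, -q.2)) (fj a m τ z) :=
    ((Equiv.prodCongr (Equiv.refl ℤ) (Equiv.neg ℤ)).hasSum_iff.mpr h2)
  have h4 := (h2.add h3).mul_left 2⁻¹
  have h5 : (2 : ℂ)⁻¹ * (fj a m τ z + fj a m τ z) = fj a m τ z := by ring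
  change HasSum _ ((2 : ℂ)⁻¹ * (fj a m τ z + fj a m τ z)) at h4
  rw [h5] at h4
  have h6 : HasSum (fun q : ℤ × ℤ => a ![q.1, q.2, m] * ex (q.1 * τ) *
      (2⁻¹ * Polynomial.aeval (sv z) (symPoly q.2.natAbs))) (fj a m τ z) := by
    refine h4.congr_fun fun q => ?_
    have e : Polynomial.aeval (sv z) (symPoly q.2.natAbs) = ex z ^ q.2 + (ex z)⁻¹ ^ q.2 := by
      rw [sv, aeval_symPoly (ex_ne_zero z)]
      rcases Int.natAbs_eq q.2 with h | h
      · conv_rhs => rw [h, zpow_natCast, zpow_natCast]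
      · conv_rhs => rw [h, _root_.zpow_neg, _root_.zpow_neg, zpow_natCast, zpow_natCast]
        rw [inv_pow, inv_inv, add_comm]
    rw [e, fjTerm, fjTerm, hg.coeff_neg ha, ex_add, ex_add, ex_int_mul q.2 z]
    have e2 : ex (((-q.2 : ℤ) : ℂ) * z) = (ex z)⁻¹ ^ q.2 := by
      rw [ex_int_mul, _root_.inv_zpow, _root_.zpow_neg]
    simp only [e2]
    ring
  have h7 := h1.unique h6
  rw [← h7]
  exact hs.hasSum

/-- The formal expansion of a Fourier–Jacobi coefficient in `q` and `s`. -/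
def formalFJ (a : (Fin 3 → ℤ) → ℂ) (m : ℕ) : MvPowerSeries (Fin 2) ℂ := fun α =>
  ∑ r ∈ Finset.Icc (-(α 0 + m : ℤ)) (α 0 + m),
    a ![α 0, r, m] * (2⁻¹ * ((symPoly r.natAbs).coeff (α 1) : ℂ))

lemma coeff_formalFJ (a : (Fin 3 → ℤ) → ℂ) (m : ℕ) (α : Fin 2 →₀ ℕ) :
    MvPowerSeries.coeff α (formalFJ a m) = ∑ r ∈ Finset.Icc (-(α 0 + m : ℤ)) (α 0 + m),
      a ![α 0, r, m] * (2⁻¹ * ((symPoly r.natAbs).coeff (α 1) : ℂ)) := rfl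

lemma IsLevelOne.evalsTo_formalFJ (hg : IsLevelOne K g) (ha : IsFourier a g) (m : ℕ) {τ : ℂ}
    (hτ : 0 < τ.im) (z : ℂ) : EvalsTo (formalFJ a m) ![ex τ, sv z] (fj a m τ z) := by
  have h := hg.hasSum_qsTerm ha m hτ z
  let e : (ℤ × ℕ) × ℤ ≃ (ℤ × ℤ) × ℕ :=
    ⟨fun x => ((x.1.1, x.2), x.1.2), fun x => ((x.1.1, x.2), x.1.2), fun _ => rfl, fun _ => rfl⟩
  have h1 : HasSum (fun x : (ℤ × ℕ) × ℤ => qsTerm a m τ (sv z) ((x.1.1, x.2), x.1.2))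
      (fj a m τ z) := e.hasSum_iff.mpr h
  have h2 := h1.prod_fiberwise (g := fun y : ℤ × ℕ => ∑ r ∈ Finset.Icc (-(y.1 + m)) (y.1 + m),
    qsTerm a m τ (sv z) ((y.1, r), y.2)) fun y => by
      refine hasSum_sum_of_ne_finset_zero fun r hr => ?_
      have h0 : a ![y.1, r, m] = 0 := by
        by_contra hne
        have := (hg.coeff_support ha hne).2.2
        rw [abs_le] at this
        exact hr (Finset.mem_Icc.mpr this)
      simp only [qsTerm]
      rw [h0, zero_mul, zero_mul]
  let φ : (Fin 2 →₀ ℕ) → ℤ × ℕ := fun α => (α 0, α 1)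
  have hφ : Function.Injective φ := fun α β hαβ => by
    simp only [φ, Prod.mk.injEq, Nat.cast_inj] at hαβ
    ext i
    fin_cases i
    exacts [hαβ.1, hαβ.2]
  have h3 := (hφ.hasSum_iff (fun y hy => ?_)).mpr h2
  · refine h3.congr_fun fun α => ?_
    simp only [Function.comp, φ]
    rw [coeff_formalFJ, monom_two, Finset.sum_mul]
    refine Finset.sum_congr rfl fun r _ => ?_
    simp only [qsTerm, Matrix.cons_val_zero, Matrix.cons_val_one, Int.cast_natCast, ex_nat_mul]
    ring
  · have hy0 : y.1 < 0 := by
      by_contra hneg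
      exact hy ⟨pair y.1.toNat y.2, by
        simp only [φ, pair_zero, pair_one]
        rw [Int.toNat_of_nonneg (not_lt.mp hneg)]⟩
    refine Finset.sum_eq_zero fun r _ => ?_
    have h0 : a ![y.1, r, m] = 0 := by
      by_contra hne
      linarith [(hg.coeff_support ha hne).1]
    simp only [qsTerm]
    rw [h0, zero_mul, zero_mul]

lemma inv_two_mem : (2 : ℂ)⁻¹ ∈ R6 := by
  have := R6.mul_mem (natCast_mem R6 3) inv_six_mem
  convert this using 1
  norm_num

lemma formalFJ_coeff_mem (V : Submodule R6 ℂ) (m : ℕ) (α : Fin 2 →₀ ℕ)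
    (h : ∀ r, a ![α 0, r, m] ∈ V) : MvPowerSeries.coeff α (formalFJ a m) ∈ V := by
  rw [coeff_formalFJ]
  refine V.sum_mem fun r _ => ?_
  rw [mul_comm]
  exact mul_mem_of_mem_R6 (R6.mul_mem inv_two_mem (int_mem_R6 _)) (h r)

lemma IsLevelOne.coeff_mem_of_formalFJ (hg : IsLevelOne K g) (ha : IsFourier a g)
    (V : Submodule R6 ℂ) (m n : ℕ)
    (h : ∀ l, MvPowerSeries.coeff (pair n l) (formalFJ a m) ∈ V) (r : ℤ) :
    a ![n, r, m] ∈ V := by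
  induction hd : n + m + 1 - r.natAbs using Nat.strong_induction_on generalizing r with
  | _ d ih =>
  by_cases hr : n + m < r.natAbs
  · have h0 : a ![n, r, m] = 0 := by
      by_contra hne
      have := abs_le.mp (hg.coeff_support ha hne).2.2
      omega
    rw [h0]
    exact V.zero_mem
  have h1 := h r.natAbs
  rw [coeff_formalFJ, ← Finset.sum_filter_add_sum_filter_not _ fun r' => r'.natAbs = r.natAbs]
    at h1
  simp only [pair_zero, pair_one] at h1
  have hrest : ∑ r' ∈ (Finset.Icc (-(n + m : ℤ)) (n + m)).filter fun r' => ¬ r'.natAbs = r.natAbs,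
      a ![n, r', m] * (2⁻¹ * ((symPoly r'.natAbs).coeff r.natAbs : ℂ)) ∈ V := by
    refine V.sum_mem fun r' hr' => ?_
    rw [Finset.mem_filter] at hr'
    by_cases hlt : r'.natAbs < r.natAbs
    · rw [Polynomial.coeff_eq_zero_of_natDegree_lt ((natDegree_symPoly_le _).trans_lt hlt)]
      simp
    · rw [mul_comm]
      refine mul_mem_of_mem_R6 (R6.mul_mem inv_two_mem (int_mem_R6 _)) (ih _ ?_ r' rfl)
      omega
  have h2 := (V.add_mem_iff_left hrest).mp h1
  have hmain : ∑ r' ∈ (Finset.Icc (-(n + m : ℤ)) (n + m)).filter fun r' => r'.natAbs = r.natAbs,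
      a ![n, r', m] * (2⁻¹ * ((symPoly r'.natAbs).coeff r.natAbs : ℂ)) = a ![n, r, m] := by
    by_cases h0 : r = 0
    · subst h0
      have : (Finset.Icc (-(n + m : ℤ)) (n + m)).filter (fun r' => r'.natAbs = (0 : ℤ).natAbs)
          = {0} := by
        ext r'
        simp
        omega
      rw [this, Finset.sum_singleton]
      have h2 : symPoly 0 = Polynomial.C 2 := rfl
      simp [h2]
    · have : (Finset.Icc (-(n + m : ℤ)) (n + m)).filter (fun r' => r'.natAbs = r.natAbs)
          = {r, -r} := by
        ext r'
        simp
        omega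
      rw [this, Finset.sum_pair (by omega), Int.natAbs_neg, hg.coeff_neg ha,
        coeff_symPoly_self _ (by omega)]
      push_cast
      ring
  rwa [hmain] at h2

/-- The Fourier coefficients of a Siegel modular form of degree two, even weight `K` and level
one are determined over `ℤ[1/6]` by those with both diagonal entries at most `K / 10`. -/
theorem IsLevelOne.coeff_mem (hg : IsLevelOne K g) (ha : IsFourier a g) (hK : Even K)
    (V : Submodule R6 ℂ)
    (hV : ∀ n r m : ℤ, 10 * n ≤ K → 10 * m ≤ K → a ![n, r, m] ∈ V) (n : Fin 3 → ℤ) :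
    a n ∈ V := by
  suffices H : ∀ (m : ℕ) (n r : ℤ), a ![n, r, m] ∈ V by
    by_cases h : 0 ≤ n 2
    · have := H (n 2).toNat (n 0) (n 1)
      rwa [Int.toNat_of_nonneg h, vec3_eta] at this
    · rw [← vec3_eta n, hg.coeff_eq_zero_of_neg ha _ _ (not_le.mp h)]
      exact V.zero_mem
  intro m
  induction m using Nat.strong_induction_on with
  | _ m ih =>
  have hJ : ∀ α, MvPowerSeries.coeff α (formalFJ a m) ∈ V := by
    choose zs hzs using sv_surjective
    have hv : ∀ τ : ℂ, 0 < τ.im → ∀ z, fj a m τ (zs (sv z)) = fj a m τ z := by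
      intro τ hτ z
      have h := hg.evalsTo_formalFJ ha m hτ (zs (sv z))
      rw [hzs] at h
      exact h.unique (hg.evalsTo_formalFJ ha m hτ z)
    refine jacobi_coeff_mem V K hK m (formalFJ a m) (fun τ s => fj a m τ (zs s)) ?_ ?_ ?_ ?_
    · intro τ hτ s
      have h := hg.evalsTo_formalFJ ha m hτ (zs s)
      rwa [hzs] at h
    · intro τ hτ z
      simp only [hv τ hτ]
      exact_mod_cast hg.fj_add ha m hτ z
    · intro τ hτ z
      simp only [hv τ hτ, hv (-1 / τ) (im_neg_one_div hτ)]
      exact_mod_cast hg.fj_inversion ha m hτ z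
    · intro α hα
      refine formalFJ_coeff_mem V m α fun r => ?_
      by_cases hm : 10 * (m : ℤ) ≤ K
      · exact hV _ _ _ (by omega) hm
      · rw [← hg.coeff_swap ha]
        exact ih (α 0) (by omega) m r
  intro n r
  by_cases hn : 0 ≤ n
  · obtain ⟨n, rfl⟩ := Int.eq_ofNat_of_zero_le hn
    exact hg.coeff_mem_of_formalFJ ha V m n (fun l => hJ _) r
  · have h0 : a ![n, r, m] = 0 := by
      by_contra hne
      exact hn (hg.coeff_support ha hne).1
    rw [h0]
    exact V.zero_mem

end

section

/-- The factor `AZ + B` of the action of an integral symplectic matrix. -/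
def numS (M : Matrix (Fin 2 ⊕ Fin 2) (Fin 2 ⊕ Fin 2) ℤ) (Z : Matrix (Fin 2) (Fin 2) ℂ) :
    Matrix (Fin 2) (Fin 2) ℂ :=
  (M.map (fun a => (a : ℂ))).toBlocks₁₁ * Z + (M.map (fun a => (a : ℂ))).toBlocks₁₂

/-- The factor `CZ + D` of the action of an integral symplectic matrix. -/
def denS (M : Matrix (Fin 2 ⊕ Fin 2) (Fin 2 ⊕ Fin 2) ℤ) (Z : Matrix (Fin 2) (Fin 2) ℂ) :
    Matrix (Fin 2) (Fin 2) ℂ :=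
  (M.map (fun a => (a : ℂ))).toBlocks₂₁ * Z + (M.map (fun a => (a : ℂ))).toBlocks₂₂

theorem matActS_eq_mul (M : Matrix (Fin 2 ⊕ Fin 2) (Fin 2 ⊕ Fin 2) ℤ)
    (Z : Matrix (Fin 2) (Fin 2) ℂ) : matActS M Z = numS M Z * (denS M Z)⁻¹ := rfl

theorem blocks_relations {M : Matrix (Fin 2 ⊕ Fin 2) (Fin 2 ⊕ Fin 2) ℤ}
    (hM : M ∈ SiegelModularGroup 2) :
    let A := (M.map (fun a => (a : ℂ))).toBlocks₁₁
    let B := (M.map (fun a => (a : ℂ))).toBlocks₁₂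
    let C := (M.map (fun a => (a : ℂ))).toBlocks₂₁
    let D := (M.map (fun a => (a : ℂ))).toBlocks₂₂
    Cᵀ * A - Aᵀ * C = 0 ∧ Dᵀ * B - Bᵀ * D = 0 ∧ Cᵀ * B - Aᵀ * D = -1 ∧
      Dᵀ * A - Bᵀ * C = 1 := by
  intro A B C D
  have h : (M.map (fun a => (a : ℂ)))ᵀ * fromBlocks 0 (-1) 1 0 * M.map (fun a => (a : ℂ)) =
      fromBlocks 0 (-1) 1 0 := by
    have h1 : Mᵀ * fromBlocks 0 (-1) 1 0 * M = fromBlocks 0 (-1) 1 0 := hM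
    have h2 := congrArg (fun X => X.map (Int.castRingHom ℂ)) h1
    simp only [Matrix.map_mul, Matrix.fromBlocks_map, Matrix.transpose_map] at h2
    convert h2 using 1
    · congr 2
      congr 1 <;> ext i j <;> fin_cases i <;> fin_cases j <;> simp
    · congr 1 <;> ext i j <;> fin_cases i <;> fin_cases j <;> simp
  have hb : M.map (fun a => (a : ℂ)) = fromBlocks A B C D := (fromBlocks_toBlocks _).symm
  rw [hb, fromBlocks_transpose, fromBlocks_multiply, fromBlocks_multiply] at h
  obtain ⟨h1, h2, h3, h4⟩ := fromBlocks_inj.mp h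
  simp only [Matrix.mul_zero, Matrix.mul_one, zero_add, add_zero, Matrix.mul_neg,
    Matrix.neg_mul] at h1 h2 h3 h4
  refine ⟨?_, ?_, ?_, ?_⟩
  · rw [sub_eq_add_neg]; exact h1
  · rw [sub_eq_add_neg]; exact h4
  · rw [sub_eq_add_neg]; exact h2
  · rw [sub_eq_add_neg]; exact h3

theorem conjTranspose_intCast (A : Matrix (Fin 2) (Fin 2) ℤ) :
    (A.map (fun a => (a : ℂ)))ᴴ = (A.map (fun a => (a : ℂ)))ᵀ := by
  ext i j
  simp

theorem denS_transpose_mul {M : Matrix (Fin 2 ⊕ Fin 2) (Fin 2 ⊕ Fin 2) ℤ}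
    (hM : M ∈ SiegelModularGroup 2) {Z : Matrix (Fin 2) (Fin 2) ℂ} (hZ : Z.IsSymm) :
    (denS M Z)ᵀ * numS M Z = (numS M Z)ᵀ * denS M Z := by
  obtain ⟨h1, h2, h3, h4⟩ := blocks_relations hM
  set A := (M.map (fun a => (a : ℂ))).toBlocks₁₁
  set B := (M.map (fun a => (a : ℂ))).toBlocks₁₂
  set C := (M.map (fun a => (a : ℂ))).toBlocks₂₁
  set D := (M.map (fun a => (a : ℂ))).toBlocks₂₂
  rw [← sub_eq_zero]
  change (C * Z + D)ᵀ * (A * Z + B) - (A * Z + B)ᵀ * (C * Z + D) = 0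
  rw [transpose_add, transpose_add, transpose_mul, transpose_mul, hZ.eq]
  have e : (Z * Cᵀ + Dᵀ) * (A * Z + B) - (Z * Aᵀ + Bᵀ) * (C * Z + D) =
      Z * (Cᵀ * A - Aᵀ * C) * Z + Z * (Cᵀ * B - Aᵀ * D) + (Dᵀ * A - Bᵀ * C) * Z
        + (Dᵀ * B - Bᵀ * D) := by noncomm_ring
  rw [e, h1, h2, h3, h4]
  simp

theorem denS_conjTranspose_mul {M : Matrix (Fin 2 ⊕ Fin 2) (Fin 2 ⊕ Fin 2) ℤ}
    (hM : M ∈ SiegelModularGroup 2) (Z : Matrix (Fin 2) (Fin 2) ℂ) :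
    (denS M Z)ᴴ * numS M Z - (numS M Z)ᴴ * denS M Z = Z - Zᴴ := by
  obtain ⟨h1, h2, h3, h4⟩ := blocks_relations hM
  have hA : (M.map (fun a => (a : ℂ))).toBlocks₁₁ᴴ = (M.map (fun a => (a : ℂ))).toBlocks₁₁ᵀ :=
    conjTranspose_intCast M.toBlocks₁₁
  have hB : (M.map (fun a => (a : ℂ))).toBlocks₁₂ᴴ = (M.map (fun a => (a : ℂ))).toBlocks₁₂ᵀ :=
    conjTranspose_intCast M.toBlocks₁₂
  have hC : (M.map (fun a => (a : ℂ))).toBlocks₂₁ᴴ = (M.map (fun a => (a : ℂ))).toBlocks₂₁ᵀ :=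
    conjTranspose_intCast M.toBlocks₂₁
  have hD : (M.map (fun a => (a : ℂ))).toBlocks₂₂ᴴ = (M.map (fun a => (a : ℂ))).toBlocks₂₂ᵀ :=
    conjTranspose_intCast M.toBlocks₂₂
  unfold denS numS
  set A := (M.map (fun a => (a : ℂ))).toBlocks₁₁
  set B := (M.map (fun a => (a : ℂ))).toBlocks₁₂
  set C := (M.map (fun a => (a : ℂ))).toBlocks₂₁
  set D := (M.map (fun a => (a : ℂ))).toBlocks₂₂
  rw [conjTranspose_add, conjTranspose_add, conjTranspose_mul, conjTranspose_mul, hA, hB, hC, hD]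
  have e : (Zᴴ * Cᵀ + Dᵀ) * (A * Z + B) - (Zᴴ * Aᵀ + Bᵀ) * (C * Z + D) =
      Zᴴ * (Cᵀ * A - Aᵀ * C) * Z + Zᴴ * (Cᵀ * B - Aᵀ * D) + (Dᵀ * A - Bᵀ * C) * Z
        + (Dᵀ * B - Bᵀ * D) := by noncomm_ring
  rw [e, h1, h2, h3, h4]
  simp
  abel

theorem map_div_eq_smul (X : Matrix (Fin 2) (Fin 2) ℂ) :
    X.map (fun w => w / (2 * I)) = (2 * I)⁻¹ • X := by
  ext i j
  simp [div_eq_inv_mul]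

theorem isUnit_denS {M : Matrix (Fin 2 ⊕ Fin 2) (Fin 2 ⊕ Fin 2) ℤ}
    (hM : M ∈ SiegelModularGroup 2) {Z : Matrix (Fin 2) (Fin 2) ℂ}
    (hZ : Z ∈ SiegelUpperHalfSpace 2) : IsUnit (denS M Z) := by
  rw [← Matrix.mulVec_injective_iff_isUnit, ← Matrix.coe_mulVecLin, injective_iff_map_eq_zero]
  intro v hv
  by_contra hne
  have hpos := hZ.2.dotProduct_mulVec_pos hne
  rw [map_div_eq_smul, ← denS_conjTranspose_mul hM Z] at hpos
  have hv' : denS M Z *ᵥ v = 0 := hv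
  have h1 : ((denS M Z)ᴴ * numS M Z - (numS M Z)ᴴ * denS M Z) *ᵥ v
      = (denS M Z)ᴴ *ᵥ (numS M Z *ᵥ v) := by
    rw [Matrix.sub_mulVec, ← Matrix.mulVec_mulVec, ← Matrix.mulVec_mulVec, hv']
    simp
  rw [Matrix.smul_mulVec, h1, dotProduct_smul, Matrix.dotProduct_mulVec,
    ← Matrix.star_mulVec, hv'] at hpos
  simp at hpos

theorem det_denS_ne_zero {M : Matrix (Fin 2 ⊕ Fin 2) (Fin 2 ⊕ Fin 2) ℤ}
    (hM : M ∈ SiegelModularGroup 2) {Z : Matrix (Fin 2) (Fin 2) ℂ}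
    (hZ : Z ∈ SiegelUpperHalfSpace 2) : (denS M Z).det ≠ 0 :=
  ((Matrix.isUnit_iff_isUnit_det _).mp (isUnit_denS hM hZ)).ne_zero

theorem matActS_eq_of_mul {M : Matrix (Fin 2 ⊕ Fin 2) (Fin 2 ⊕ Fin 2) ℤ}
    (hM : M ∈ SiegelModularGroup 2) {Z : Matrix (Fin 2) (Fin 2) ℂ}
    (hZ : Z ∈ SiegelUpperHalfSpace 2) {W : Matrix (Fin 2) (Fin 2) ℂ}
    (h : numS M Z = W * denS M Z) : matActS M Z = W := by
  rw [matActS_eq_mul, h, Matrix.mul_nonsing_inv_cancel_right]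
  exact (Matrix.isUnit_iff_isUnit_det _).mp (isUnit_denS hM hZ)

theorem matActS_mul_denS {M : Matrix (Fin 2 ⊕ Fin 2) (Fin 2 ⊕ Fin 2) ℤ}
    (hM : M ∈ SiegelModularGroup 2) {Z : Matrix (Fin 2) (Fin 2) ℂ}
    (hZ : Z ∈ SiegelUpperHalfSpace 2) : matActS M Z * denS M Z = numS M Z := by
  rw [matActS_eq_mul, Matrix.nonsing_inv_mul_cancel_right]
  exact (Matrix.isUnit_iff_isUnit_det _).mp (isUnit_denS hM hZ)

theorem matActS_mem {M : Matrix (Fin 2 ⊕ Fin 2) (Fin 2 ⊕ Fin 2) ℤ}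
    (hM : M ∈ SiegelModularGroup 2) {Z : Matrix (Fin 2) (Fin 2) ℂ}
    (hZ : Z ∈ SiegelUpperHalfSpace 2) : matActS M Z ∈ SiegelUpperHalfSpace 2 := by
  have hu := isUnit_denS hM hZ
  have hd := (Matrix.isUnit_iff_isUnit_det _).mp hu
  have hd' : IsUnit (denS M Z)ᵀ.det := by rwa [Matrix.det_transpose]
  have hd'' : IsUnit (denS M Z)ᴴ.det := by
    rw [Matrix.det_conjTranspose]
    exact hd.star
  have h2 := denS_conjTranspose_mul hM Z
  have h1 := denS_transpose_mul hM hZ.1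
  constructor
  · rw [Matrix.IsSymm, matActS_eq_mul, transpose_mul, transpose_nonsing_inv]
    have e : (numS M Z)ᵀ = (denS M Z)ᵀ * numS M Z * (denS M Z)⁻¹ := by
      rw [h1, Matrix.mul_nonsing_inv_cancel_right _ _ hd]
    rw [e, Matrix.mul_assoc, Matrix.nonsing_inv_mul_cancel_left _ _ hd']
  · have e : matActS M Z - (matActS M Z)ᴴ = (denS M Z)⁻¹ᴴ * (Z - Zᴴ) * (denS M Z)⁻¹ := by
      rw [← h2, matActS_eq_mul, conjTranspose_mul, Matrix.mul_sub, Matrix.sub_mul,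
        conjTranspose_nonsing_inv]
      congr 1
      · rw [Matrix.nonsing_inv_mul_cancel_left _ _ hd'']
      · rw [← Matrix.mul_assoc, Matrix.mul_nonsing_inv_cancel_right _ _ hd]
    rw [e, map_div_eq_smul, ← Matrix.smul_mul, ← Matrix.mul_smul, ← map_div_eq_smul]
    refine hZ.2.conjTranspose_mul_mul_same ?_
    rw [Matrix.mulVec_injective_iff_isUnit, Matrix.isUnit_nonsing_inv_iff]
    exact hu

theorem numS_mul (M₁ : Matrix (Fin 2 ⊕ Fin 2) (Fin 2 ⊕ Fin 2) ℤ)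
    {M₂ : Matrix (Fin 2 ⊕ Fin 2) (Fin 2 ⊕ Fin 2) ℤ}
    (hM : M₂ ∈ SiegelModularGroup 2) {Z : Matrix (Fin 2) (Fin 2) ℂ}
    (hZ : Z ∈ SiegelUpperHalfSpace 2) :
    numS (M₁ * M₂) Z = numS M₁ (matActS M₂ Z) * denS M₂ Z ∧
      denS (M₁ * M₂) Z = denS M₁ (matActS M₂ Z) * denS M₂ Z := by
  have h := matActS_mul_denS hM hZ
  have hm : (M₁ * M₂).map (fun a => (a : ℂ)) =
      M₁.map (fun a => (a : ℂ)) * M₂.map (fun a => (a : ℂ)) :=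
    Matrix.map_mul (f := Int.castRingHom ℂ)
  have h1 : numS M₁ (matActS M₂ Z) * denS M₂ Z =
      (M₁.map (fun a => (a : ℂ))).toBlocks₁₁ * numS M₂ Z +
        (M₁.map (fun a => (a : ℂ))).toBlocks₁₂ * denS M₂ Z := by
    rw [← h, numS, Matrix.add_mul, Matrix.mul_assoc]
  have h2 : denS M₁ (matActS M₂ Z) * denS M₂ Z =
      (M₁.map (fun a => (a : ℂ))).toBlocks₂₁ * numS M₂ Z +
        (M₁.map (fun a => (a : ℂ))).toBlocks₂₂ * denS M₂ Z := by
    rw [← h, denS, Matrix.add_mul, Matrix.mul_assoc]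
  rw [h1, h2]
  rw [← fromBlocks_toBlocks (M₁.map (fun a => (a : ℂ))),
    ← fromBlocks_toBlocks (M₂.map (fun a => (a : ℂ))), fromBlocks_multiply] at hm
  unfold numS denS
  rw [hm]
  simp only [toBlocks_fromBlocks₁₁, toBlocks_fromBlocks₁₂, toBlocks_fromBlocks₂₁,
    toBlocks_fromBlocks₂₂]
  constructor <;> noncomm_ring

theorem matActS_mul (M₁ : Matrix (Fin 2 ⊕ Fin 2) (Fin 2 ⊕ Fin 2) ℤ)
    {M₂ : Matrix (Fin 2 ⊕ Fin 2) (Fin 2 ⊕ Fin 2) ℤ}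
    (hM₂ : M₂ ∈ SiegelModularGroup 2) {Z : Matrix (Fin 2) (Fin 2) ℂ}
    (hZ : Z ∈ SiegelUpperHalfSpace 2) :
    matActS (M₁ * M₂) Z = matActS M₁ (matActS M₂ Z) := by
  obtain ⟨h1, h2⟩ := numS_mul M₁ hM₂ hZ
  rw [matActS_eq_mul (M₁ * M₂), h1, h2, Matrix.mul_inv_rev, ← Matrix.mul_assoc,
    Matrix.mul_nonsing_inv_cancel_right, ← matActS_eq_mul]
  exact (Matrix.isUnit_iff_isUnit_det _).mp (isUnit_denS hM₂ hZ)

theorem det_denS_mul (M₁ : Matrix (Fin 2 ⊕ Fin 2) (Fin 2 ⊕ Fin 2) ℤ)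
    {M₂ : Matrix (Fin 2 ⊕ Fin 2) (Fin 2 ⊕ Fin 2) ℤ}
    (hM₂ : M₂ ∈ SiegelModularGroup 2) {Z : Matrix (Fin 2) (Fin 2) ℂ}
    (hZ : Z ∈ SiegelUpperHalfSpace 2) :
    (denS (M₁ * M₂) Z).det = (denS M₁ (matActS M₂ Z)).det * (denS M₂ Z).det := by
  rw [(numS_mul M₁ hM₂ hZ).2, Matrix.det_mul]

theorem mul_mem_siegelModularGroup {M₁ M₂ : Matrix (Fin 2 ⊕ Fin 2) (Fin 2 ⊕ Fin 2) ℤ}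
    (hM₁ : M₁ ∈ SiegelModularGroup 2) (hM₂ : M₂ ∈ SiegelModularGroup 2) :
    M₁ * M₂ ∈ SiegelModularGroup 2 := by
  have h1 : M₁ᵀ * Jn 2 * M₁ = Jn 2 := hM₁
  have h2 : M₂ᵀ * Jn 2 * M₂ = Jn 2 := hM₂
  change (M₁ * M₂)ᵀ * Jn 2 * (M₁ * M₂) = Jn 2
  rw [transpose_mul]
  calc M₂ᵀ * M₁ᵀ * Jn 2 * (M₁ * M₂) = M₂ᵀ * (M₁ᵀ * Jn 2 * M₁) * M₂ := by
        simp only [Matrix.mul_assoc]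
    _ = _ := by rw [h1, h2]

end

section

/-- The symmetric matrix with coordinates `w` in the tube domain. -/
def symMat (w : Fin 3 → ℂ) : Matrix (Fin 2) (Fin 2) ℂ := !![w 0, w 1; w 1, w 2]

theorem symMat_mem {w : Fin 3 → ℂ} (hw : w ∈ tube) : symMat w ∈ SiegelUpperHalfSpace 2 := by
  obtain ⟨h0, h1⟩ := mem_tube.mp hw
  constructor
  · ext i j
    fin_cases i <;> fin_cases j <;> rfl
  · have e : ((symMat w - (symMat w)ᴴ).map (fun x => x / (2 * I))) =
        !![((w 0).im : ℂ), ((w 1).im : ℂ); ((w 1).im : ℂ), ((w 2).im : ℂ)] := by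
      have key : ∀ z : ℂ, (z - (starRingEnd ℂ) z) / (2 * I) = (z.im : ℂ) := by
        intro z
        rw [Complex.sub_conj, mul_comm (2 : ℂ) I]
        field_simp
        push_cast
        ring
      ext i j
      fin_cases i <;> fin_cases j <;> simpa [symMat] using key _
    rw [e]
    refine Matrix.PosDef.of_dotProduct_mulVec_pos ?_ ?_
    · ext i j
      fin_cases i <;> fin_cases j <;> simp
    · intro x hx
      set a := (w 0).im
      set b := (w 1).im
      set c := (w 2).im
      have e2 : star x ⬝ᵥ (!![(a : ℂ), (b : ℂ); (b : ℂ), (c : ℂ)] *ᵥ x) =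
          ((a * Complex.normSq (x 0) + 2 * b * (x 0 * (starRingEnd ℂ) (x 1)).re
            + c * Complex.normSq (x 1) : ℝ) : ℂ) := by
        apply Complex.ext
        · simp [dotProduct, Matrix.mulVec, Fin.sum_univ_two, Complex.normSq_apply]
          ring
        · simp [dotProduct, Matrix.mulVec, Fin.sum_univ_two, Complex.normSq_apply]
          ring
      rw [e2]
      have hx' : x 0 ≠ 0 ∨ x 1 ≠ 0 := by
        by_contra! h
        exact hx (by ext i; fin_cases i <;> simp [h.1, h.2])
      have hpos : 0 < a * (a * Complex.normSq (x 0) + 2 * b * (x 0 * (starRingEnd ℂ) (x 1)).re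
            + c * Complex.normSq (x 1)) := by
        have e3 : a * (a * Complex.normSq (x 0) + 2 * b * (x 0 * (starRingEnd ℂ) (x 1)).re
            + c * Complex.normSq (x 1)) = Complex.normSq (a * x 0 + b * x 1) +
              (a * c - b ^ 2) * Complex.normSq (x 1) := by
          simp [Complex.normSq_apply]
          ring
        rw [e3]
        by_cases hx1 : x 1 = 0
        · have hx0 := hx'.resolve_right (by simpa using hx1)
          have : 0 < Complex.normSq (a * x 0 + b * x 1) := by
            rw [hx1, mul_zero, add_zero]
            exact Complex.normSq_pos.mpr (mul_ne_zero (by exact_mod_cast h0.ne') hx0)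
          have h2 : 0 ≤ (a * c - b ^ 2) * Complex.normSq (x 1) :=
            mul_nonneg (by linarith) (Complex.normSq_nonneg _)
          linarith
        · have h2 : 0 < (a * c - b ^ 2) * Complex.normSq (x 1) :=
            mul_pos (by linarith) (Complex.normSq_pos.mpr hx1)
          linarith [Complex.normSq_nonneg (a * x 0 + b * x 1)]
      have := pos_of_mul_pos_right hpos h0.le
      exact_mod_cast this

section Orbit

variable {k : ℤ} {Γ : Set (Matrix (Fin 2 ⊕ Fin 2) (Fin 2 ⊕ Fin 2) ℤ)} {N : ℕ}

/-- The translate `f|_k M` of a Siegel modular form by a symplectic matrix. -/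
def slash (f : SiegelModularForm 2 k Γ N) (M : Matrix (Fin 2 ⊕ Fin 2) (Fin 2 ⊕ Fin 2) ℤ)
    (Z : Matrix (Fin 2) (Fin 2) ℂ) : ℂ :=
  ((denS M Z).det ^ k)⁻¹ * f.toFun (matActS M Z)

theorem slash_mul_left (hsub : Γ ⊆ SiegelModularGroup 2) (f : SiegelModularForm 2 k Γ N)
    {g M : Matrix (Fin 2 ⊕ Fin 2) (Fin 2 ⊕ Fin 2) ℤ} (hg : g ∈ Γ)
    (hM : M ∈ SiegelModularGroup 2) {Z : Matrix (Fin 2) (Fin 2) ℂ}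
    (hZ : Z ∈ SiegelUpperHalfSpace 2) : slash f (g * M) Z = slash f M Z := by
  have h := f.transform g hg _ (matActS_mem hM hZ)
  change _ = (denS g (matActS M Z)).det ^ k * _ at h
  rw [slash, slash, matActS_mul g hM hZ, h, det_denS_mul g hM hZ, mul_zpow]
  have h1 := zpow_ne_zero k (det_denS_ne_zero (hsub hg) (matActS_mem hM hZ))
  have h2 := zpow_ne_zero k (det_denS_ne_zero hM hZ)
  field_simp

theorem slash_matActS (f : SiegelModularForm 2 k Γ N)
    {M M' : Matrix (Fin 2 ⊕ Fin 2) (Fin 2 ⊕ Fin 2) ℤ} 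
    (hM' : M' ∈ SiegelModularGroup 2) {Z : Matrix (Fin 2) (Fin 2) ℂ}
    (hZ : Z ∈ SiegelUpperHalfSpace 2) :
    slash f M (matActS M' Z) = (denS M' Z).det ^ k * slash f (M * M') Z := by
  rw [slash, slash, matActS_mul M hM' hZ, det_denS_mul M hM' hZ, mul_zpow]
  have h2 := zpow_ne_zero k (det_denS_ne_zero hM' hZ)
  field_simp

theorem slash_one (f : SiegelModularForm 2 k Γ N) (Z : Matrix (Fin 2) (Fin 2) ℂ) :
    slash f 1 Z = f.toFun Z := by
  have h1 : ((1 : Matrix (Fin 2 ⊕ Fin 2) (Fin 2 ⊕ Fin 2) ℤ).map (fun a => (a : ℂ))) =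
      fromBlocks 1 0 0 1 := by
    rw [fromBlocks_one]
    exact Matrix.map_one _ Int.cast_zero Int.cast_one
  have h2 : denS 1 Z = 1 := by
    rw [denS, h1, toBlocks_fromBlocks₂₁, toBlocks_fromBlocks₂₂, Matrix.zero_mul, zero_add]
  have h3 : numS 1 Z = Z := by
    rw [numS, h1, toBlocks_fromBlocks₁₁, toBlocks_fromBlocks₁₂, Matrix.one_mul, add_zero]
  rw [slash, matActS_eq_mul, h2, h3]
  simp

/-- The elementary symmetric functions of the translates of `f`. -/
def symFun (f : SiegelModularForm 2 k Γ N) {t : ℕ}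
    (reps : Fin t → Matrix (Fin 2 ⊕ Fin 2) (Fin 2 ⊕ Fin 2) ℤ) (j : ℕ)
    (Z : Matrix (Fin 2) (Fin 2) ℂ) : ℂ :=
  ∑ s ∈ Finset.powersetCard j Finset.univ, ∏ i ∈ s, slash f (reps i) Z

variable {t : ℕ} {reps : Fin t → Matrix (Fin 2 ⊕ Fin 2) (Fin 2 ⊕ Fin 2) ℤ}

theorem sum_powersetCard_prod_comp {t : ℕ} {σ : Fin t → Fin t} (hσ : Function.Bijective σ)
    (G : Fin t → ℂ) (j : ℕ) :
    ∑ s ∈ Finset.powersetCard j Finset.univ, ∏ i ∈ s, G (σ i) =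
      ∑ s ∈ Finset.powersetCard j Finset.univ, ∏ i ∈ s, G i := by
  rw [← Finset.esymm_map_val, ← Finset.esymm_map_val]
  congr 1
  conv_rhs => rw [← Multiset.map_univ_val_equiv (Equiv.ofBijective σ hσ), Multiset.map_map]
  rfl

theorem isUnit_of_mem_siegelModularGroup {M : Matrix (Fin 2 ⊕ Fin 2) (Fin 2 ⊕ Fin 2) ℤ}
    (hM : M ∈ SiegelModularGroup 2) : IsUnit M := by
  have h : Mᵀ * Jn 2 * M = Jn 2 := hM
  have hJ : IsUnit (Jn 2).det := Matrix.isUnit_det_J (Fin 2) ℤ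
  rw [← h, Matrix.det_mul] at hJ
  exact (Matrix.isUnit_iff_isUnit_det _).mpr (isUnit_of_mul_isUnit_right hJ)

theorem exists_bijective_coset
    (hone : (1 : Matrix (Fin 2 ⊕ Fin 2) (Fin 2 ⊕ Fin 2) ℤ) ∈ Γ)
    (hmulmem : ∀ M₁ ∈ Γ, ∀ M₂ ∈ Γ, M₁ * M₂ ∈ Γ)
    (hinv : ∀ M ∈ Γ, ∃ M' ∈ Γ, M * M' = 1 ∧ M' * M = 1)
    (hreps : ∀ i, reps i ∈ SiegelModularGroup 2)
    (hindex : ∀ M ∈ SiegelModularGroup 2, ∃! i : Fin t, ∃ g ∈ Γ, M = g * reps i)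
    {M : Matrix (Fin 2 ⊕ Fin 2) (Fin 2 ⊕ Fin 2) ℤ} (hM : M ∈ SiegelModularGroup 2) :
    ∃ σ : Fin t → Fin t, Function.Bijective σ ∧ ∀ i, ∃ g ∈ Γ, reps i * M = g * reps (σ i) := by
  have hex : ∀ i, ∃ i', ∃ g ∈ Γ, reps i * M = g * reps i' :=
    fun i => (hindex _ (mul_mem_siegelModularGroup (hreps i) hM)).exists
  choose σ hσ using hex
  refine ⟨σ, Finite.injective_iff_bijective.mp fun i i' he => ?_, hσ⟩
  obtain ⟨g, hg, h1⟩ := hσ i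
  obtain ⟨g', hg', h2⟩ := hσ i'
  obtain ⟨g'', hg'', h3, h4⟩ := hinv g' hg'
  have h5 : reps i = (g * g'') * reps i' := by
    refine (isUnit_of_mem_siegelModularGroup hM).mul_right_cancel ?_
    rw [h1, he, Matrix.mul_assoc (g * g''), h2, Matrix.mul_assoc g, ← Matrix.mul_assoc g'', h4,
      Matrix.one_mul]
  exact (hindex _ (hreps i)).unique ⟨1, hone, (Matrix.one_mul _).symm⟩
    ⟨_, hmulmem _ hg _ hg'', h5⟩

theorem symFun_matActS (hsub : Γ ⊆ SiegelModularGroup 2)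
    (hreps : ∀ i, reps i ∈ SiegelModularGroup 2) (f : SiegelModularForm 2 k Γ N) (j : ℕ)
    {M : Matrix (Fin 2 ⊕ Fin 2) (Fin 2 ⊕ Fin 2) ℤ} (hM : M ∈ SiegelModularGroup 2)
    {σ : Fin t → Fin t} (hbij : Function.Bijective σ)
    (hσ : ∀ i, ∃ g ∈ Γ, reps i * M = g * reps (σ i))
    {Z : Matrix (Fin 2) (Fin 2) ℂ} (hZ : Z ∈ SiegelUpperHalfSpace 2) :
    symFun f reps j (matActS M Z) = (denS M Z).det ^ ((j : ℤ) * k) * symFun f reps j Z := by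
  have h1 : ∀ i, slash f (reps i) (matActS M Z) =
      (denS M Z).det ^ k * slash f (reps (σ i)) Z := by
    intro i
    obtain ⟨g, hg, h⟩ := hσ i
    rw [slash_matActS f hM hZ, h, slash_mul_left hsub f hg (hreps _) hZ]
  rw [symFun, symFun, ← sum_powersetCard_prod_comp hbij (fun i => slash f (reps i) Z) j,
    Finset.mul_sum]
  refine Finset.sum_congr rfl fun s hs => ?_
  rw [Finset.prod_congr rfl fun i _ => h1 i, Finset.prod_mul_distrib, Finset.prod_const,
    (Finset.mem_powersetCard.mp hs).2, mul_comm (j : ℤ) k, _root_.zpow_mul, zpow_natCast]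

theorem sum_symFun (hsub : Γ ⊆ SiegelModularGroup 2)
    (hreps : ∀ i, reps i ∈ SiegelModularGroup 2)
    (hindex : ∀ M ∈ SiegelModularGroup 2, ∃! i : Fin t, ∃ g ∈ Γ, M = g * reps i)
    (f : SiegelModularForm 2 k Γ N)
    {Z : Matrix (Fin 2) (Fin 2) ℂ} (hZ : Z ∈ SiegelUpperHalfSpace 2) :
    ∑ j ∈ Finset.range (t + 1), (-1) ^ j * symFun f reps j Z * f.toFun Z ^ (t - j) = 0 := by
  have h1mem : (1 : Matrix (Fin 2 ⊕ Fin 2) (Fin 2 ⊕ Fin 2) ℤ) ∈ SiegelModularGroup 2 := by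
    change 1ᵀ * Jn 2 * 1 = Jn 2
    simp
  obtain ⟨i, g, hg, h⟩ := (hindex 1 h1mem).exists
  have h0 : f.toFun Z = slash f (reps i) Z := by
    rw [← slash_one f Z, h, slash_mul_left hsub f hg (hreps i) hZ]
  have h1 := Multiset.prod_X_sub_X_eq_sum_esymm
    ((Finset.univ : Finset (Fin t)).val.map fun i => slash f (reps i) Z)
  have h2 := congrArg (Polynomial.eval (f.toFun Z)) h1
  rw [Polynomial.eval_finsetSum] at h2
  simp only [Multiset.card_map, Finset.card_val, Finset.card_univ, Fintype.card_fin,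
    Finset.esymm_map_val, Multiset.map_map, Polynomial.eval_mul, Polynomial.eval_pow,
    Polynomial.eval_neg, Polynomial.eval_one, Polynomial.eval_C, Polynomial.eval_X] at h2
  rw [Polynomial.eval_multiset_prod, Multiset.map_map, Multiset.prod_eq_zero] at h2
  · rw [h2]
    refine Finset.sum_congr rfl fun j _ => ?_
    rw [symFun, mul_assoc]
  · rw [Multiset.mem_map]
    exact ⟨i, Finset.mem_univ_val i, by simp [h0]⟩

theorem differentiableOn_slash (f : SiegelModularForm 2 k Γ N)
    {M : Matrix (Fin 2 ⊕ Fin 2) (Fin 2 ⊕ Fin 2) ℤ} (hM : M ∈ SiegelModularGroup 2) :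
    DifferentiableOn ℂ (fun w => slash f M (symMat w)) tube := by
  have hsym : ∀ i j, Differentiable ℂ (fun w : Fin 3 → ℂ => symMat w i j) := by
    intro i j
    fin_cases i <;> fin_cases j <;> simp [symMat] <;> fun_prop
  have hden : ∀ i j, Differentiable ℂ (fun w : Fin 3 → ℂ => denS M (symMat w) i j) := by
    intro i j
    simp only [denS, Matrix.add_apply, Matrix.mul_apply, Fin.sum_univ_two]
    fun_prop
  have hnum : ∀ i j, Differentiable ℂ (fun w : Fin 3 → ℂ => numS M (symMat w) i j) := by
    intro i j
    simp only [numS, Matrix.add_apply, Matrix.mul_apply, Fin.sum_univ_two]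
    fun_prop
  have hdet : Differentiable ℂ (fun w : Fin 3 → ℂ => (denS M (symMat w)).det) := by
    simp only [Matrix.det_fin_two]
    fun_prop
  have hne : ∀ w ∈ tube, (denS M (symMat w)).det ≠ 0 :=
    fun w hw => det_denS_ne_zero hM (symMat_mem hw)
  refine DifferentiableOn.mul ?_ ?_
  · refine DifferentiableOn.inv ?_ fun w hw => zpow_ne_zero k (hne w hw)
    intro w hw
    exact ((hdet w).zpow (Or.inl (hne w hw))).differentiableWithinAt
  · have hact : DifferentiableOn ℂ
        (fun w => (fun i j => matActS M (symMat w) i j : Fin 2 → Fin 2 → ℂ)) tube := by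
      rw [differentiableOn_pi]
      intro i
      rw [differentiableOn_pi]
      intro j
      have e : ∀ w, matActS M (symMat w) i j =
          ((denS M (symMat w)).det)⁻¹ * (numS M (symMat w) * (denS M (symMat w)).adjugate) i j := by
        intro w
        rw [matActS_eq_mul, Matrix.inv_def, Ring.inverse_eq_inv', Matrix.mul_smul,
          Matrix.smul_apply, smul_eq_mul]
      simp only [e]
      refine DifferentiableOn.mul (hdet.differentiableOn.inv hne)
        (Differentiable.differentiableOn ?_)
      simp only [Matrix.mul_apply, Fin.sum_univ_two, Matrix.adjugate_fin_two]
      fin_cases j <;> simp <;> fun_prop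
    exact f.holo.comp hact fun w hw => matActS_mem hM (symMat_mem hw)

theorem differentiableOn_symFun (hreps : ∀ i, reps i ∈ SiegelModularGroup 2)
    (f : SiegelModularForm 2 k Γ N) (j : ℕ) :
    DifferentiableOn ℂ (fun w => symFun f reps j (symMat w)) tube := by
  unfold symFun
  refine DifferentiableOn.fun_sum fun s hs => ?_
  clear hs
  induction s using Finset.induction_on with
  | empty => simp
  | insert i s hi ih =>
    simp only [Finset.prod_insert hi]
    exact (differentiableOn_slash f (hreps i)).mul ih

end Orbit

end

section

theorem fromBlocks_mem_siegelModularGroup {A B C D : Matrix (Fin 2) (Fin 2) ℤ}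
    (h1 : Aᵀ * C = Cᵀ * A) (h2 : Bᵀ * D = Dᵀ * B) (h3 : Aᵀ * D - Cᵀ * B = 1) :
    fromBlocks A B C D ∈ SiegelModularGroup 2 :=
  SymplecticGroup.mem_iff'.mp (SymplecticGroup.fromBlocks_mem_iff.mpr ⟨h1, h2, h3⟩)

theorem apply_symMat_of_fromBlocks {F : Matrix (Fin 2) (Fin 2) ℂ → ℂ} {K : ℤ}
    (hF : ∀ M ∈ SiegelModularGroup 2, ∀ Z ∈ SiegelUpperHalfSpace 2,
      F (matActS M Z) = (denS M Z).det ^ K * F Z)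
    {A B C D : Matrix (Fin 2) (Fin 2) ℤ}
    (h : fromBlocks A B C D ∈ SiegelModularGroup 2) {w w' : Fin 3 → ℂ} (hw : w ∈ tube) (d : ℂ)
    (hact : A.map (fun a => (a : ℂ)) * symMat w + B.map (fun a => (a : ℂ)) =
      symMat w' * (C.map (fun a => (a : ℂ)) * symMat w + D.map (fun a => (a : ℂ))))
    (hd : (C.map (fun a => (a : ℂ)) * symMat w + D.map (fun a => (a : ℂ))).det = d) :
    F (symMat w') = d ^ K * F (symMat w) := by
  have hden : denS (fromBlocks A B C D) (symMat w) =
      C.map (fun a => (a : ℂ)) * symMat w + D.map (fun a => (a : ℂ)) := rfl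
  have hnum : numS (fromBlocks A B C D) (symMat w) =
      A.map (fun a => (a : ℂ)) * symMat w + B.map (fun a => (a : ℂ)) := rfl
  rw [← matActS_eq_of_mul h (symMat_mem hw) (W := symMat w') (by rw [hnum, hact, hden]),
    hF _ h _ (symMat_mem hw), hden, hd]

theorem isLevelOne_of_transform {F : Matrix (Fin 2) (Fin 2) ℂ → ℂ} {K : ℤ} (hK : Even K)
    (hdiff : DifferentiableOn ℂ (fun w => F (symMat w)) tube)
    (hF : ∀ M ∈ SiegelModularGroup 2, ∀ Z ∈ SiegelUpperHalfSpace 2,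
      F (matActS M Z) = (denS M Z).det ^ K * F Z) :
    IsLevelOne K (fun w => F (symMat w)) where
  diff := hdiff
  periodic := by
    intro n w hw
    have hm : fromBlocks (1 : Matrix (Fin 2) (Fin 2) ℤ) !![n 0, n 1; n 1, n 2] 0 1 ∈
        SiegelModularGroup 2 := by
      refine fromBlocks_mem_siegelModularGroup (by simp) ?_ (by simp)
      ext i j
      fin_cases i <;> fin_cases j <;> simp
    have := apply_symMat_of_fromBlocks hF hm (w' := fun i => w i + n i) hw 1 (by
      ext i j
      fin_cases i <;> fin_cases j <;> simp [symMat, Matrix.mul_apply, Fin.sum_univ_two]) (by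
      simp [symMat])
    simpa using this
  swap := by
    intro w hw
    have hm : fromBlocks (!![0, 1; 1, 0] : Matrix (Fin 2) (Fin 2) ℤ) 0 0 !![0, 1; 1, 0] ∈
        SiegelModularGroup 2 := by
      refine fromBlocks_mem_siegelModularGroup (by simp) (by simp) (by decide)
    have := apply_symMat_of_fromBlocks hF hm (w' := ![w 2, w 1, w 0]) hw (-1) (by
      ext i j
      fin_cases i <;> fin_cases j <;> simp [symMat, Matrix.mul_apply, Fin.sum_univ_two]) (by
      simp [Matrix.det_fin_two])
    simpa [hK.neg_one_zpow] using this
  neg := by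
    intro w hw
    have hm : fromBlocks (!![1, 0; 0, -1] : Matrix (Fin 2) (Fin 2) ℤ) 0 0 !![1, 0; 0, -1] ∈
        SiegelModularGroup 2 := by
      refine fromBlocks_mem_siegelModularGroup (by simp) (by simp) (by decide)
    have := apply_symMat_of_fromBlocks hF hm (w' := ![w 0, -w 1, w 2]) hw (-1) (by
      ext i j
      fin_cases i <;> fin_cases j <;> simp [symMat, Matrix.mul_apply, Fin.sum_univ_two]) (by
      simp [Matrix.det_fin_two])
    simpa [hK.neg_one_zpow] using this
  shear := by
    intro w hw
    have hm : fromBlocks (!![1, 0; 1, 1] : Matrix (Fin 2) (Fin 2) ℤ) 0 0 !![1, -1; 0, 1] ∈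
        SiegelModularGroup 2 := by
      refine fromBlocks_mem_siegelModularGroup (by simp) (by simp) (by decide)
    have := apply_symMat_of_fromBlocks hF hm (w' := ![w 0, w 1 + w 0, w 2 + 2 * w 1 + w 0]) hw 1
      (by
      ext i j
      fin_cases i <;> fin_cases j <;>
        simp [symMat, Matrix.mul_apply, Fin.sum_univ_two] <;> ring) (by
      simp [Matrix.det_fin_two])
    simpa using this
  inversion := by
    intro w hw
    have h0 : w 0 ≠ 0 := ne_zero_of_im_pos (mem_tube.mp hw).1
    have hm : fromBlocks (!![0, 0; 0, 1] : Matrix (Fin 2) (Fin 2) ℤ) !![-1, 0; 0, 0]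
        !![1, 0; 0, 0] !![0, 0; 0, 1] ∈ SiegelModularGroup 2 := by
      refine fromBlocks_mem_siegelModularGroup (by decide) (by decide) (by decide)
    exact apply_symMat_of_fromBlocks hF hm hw (w 0) (by
      ext i j
      fin_cases i <;> fin_cases j <;> simp [symMat, Matrix.mul_apply, Fin.sum_univ_two] <;>
        field_simp <;> ring) (by
      simp [Matrix.det_fin_two, symMat, Matrix.mul_apply, Fin.sum_univ_two])

end

section

theorem exists_dvd_of_sum_eq_zero {R : Type*} [CommRing R] [NoZeroDivisors R] {φ : R} (hφ : φ ≠ 0)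
    {t : ℕ} {β : ℕ → R} (h : ∑ j ∈ Finset.range (t + 1), β j * φ ^ (t - j) = 0)
    (hne : ∃ j ≤ t, β j ≠ 0) : ∃ j, 1 ≤ j ∧ j ≤ t ∧ β j ≠ 0 ∧ φ ∣ β j := by
  induction t with
  | zero =>
    obtain ⟨j, hj, hne⟩ := hne
    obtain rfl : j = 0 := by omega
    simp at h
    exact absurd h hne
  | succ t ih =>
    rw [Finset.sum_range_succ] at h
    have h1 : ∑ j ∈ Finset.range (t + 1), β j * φ ^ (t + 1 - j) =
        φ * ∑ j ∈ Finset.range (t + 1), β j * φ ^ (t - j) := by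
      rw [Finset.mul_sum]
      refine Finset.sum_congr rfl fun j hj => ?_
      rw [Finset.mem_range] at hj
      rw [show t + 1 - j = (t - j) + 1 by omega, pow_succ]
      ring
    rw [h1, Nat.sub_self, pow_zero, mul_one] at h
    by_cases h0 : β (t + 1) = 0
    · rw [h0, add_zero] at h
      obtain ⟨j, hj1, hj2, hj3⟩ := ih ((mul_eq_zero.mp h).resolve_left hφ) (by
        obtain ⟨j, hj, hne⟩ := hne
        refine ⟨j, ?_, hne⟩
        rcases Nat.lt_or_ge t j with h | h
        · obtain rfl : j = t + 1 := by omega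
          exact absurd h0 hne
        · exact h)
      exact ⟨j, hj1, by omega, hj3⟩
    · exact ⟨t + 1, by omega, le_rfl, h0,
        ⟨-_, by rw [mul_neg]; exact eq_neg_of_add_eq_zero_right h⟩⟩

theorem toZMod_eq_zero_iff {p : ℕ} [Fact p.Prime] (x : ℤ_[p]) :
    PadicInt.toZMod x = 0 ↔ ‖x‖ < 1 := by
  rw [← RingHom.mem_ker, PadicInt.ker_toZMod, PadicInt.maximalIdeal_eq_span_p,
    PadicInt.norm_lt_one_iff_dvd, Ideal.mem_span_singleton]

theorem exists_reduction {p : ℕ} [Fact p.Prime] {t : ℕ} {P : ℕ → MvPowerSeries (Fin 3) ℚ}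
    {G : MvPowerSeries (Fin 3) ℚ}
    (hrel : ∑ j ∈ Finset.range (t + 1), P j * G ^ (t - j) = 0)
    (hG : ∀ α, ‖((MvPowerSeries.coeff α G : ℚ) : ℚ_[p])‖ ≤ 1)
    (hG' : ∃ α, ¬ ‖((MvPowerSeries.coeff α G : ℚ) : ℚ_[p])‖ < 1)
    {x : ℚ} (hx : x ≠ 0)
    (hP : ∀ j ≤ t, ∀ α, ‖((MvPowerSeries.coeff α (P j) : ℚ) : ℚ_[p])‖ ≤ ‖(x : ℚ_[p])‖)
    (hP' : ∃ j ≤ t, ∃ α, MvPowerSeries.coeff α (P j) = x) :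
    ∃ j, 1 ≤ j ∧ j ≤ t ∧
      (∃ α, ¬ ‖((MvPowerSeries.coeff α (P j) : ℚ) : ℚ_[p])‖ < ‖(x : ℚ_[p])‖) ∧
      ∀ α, (∀ β ≤ α, ‖((MvPowerSeries.coeff β G : ℚ) : ℚ_[p])‖ < 1) →
        ‖((MvPowerSeries.coeff α (P j) : ℚ) : ℚ_[p])‖ < ‖(x : ℚ_[p])‖ := by
  have hx' : (x : ℚ_[p]) ≠ 0 := by exact_mod_cast hx
  have hnx : 0 < ‖(x : ℚ_[p])‖ := norm_pos_iff.mpr hx'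
  let GZ : MvPowerSeries (Fin 3) ℤ_[p] := fun α =>
    ⟨((MvPowerSeries.coeff α G : ℚ) : ℚ_[p]), hG α⟩
  have hGZ : ∀ α, ((MvPowerSeries.coeff α GZ : ℤ_[p]) : ℚ_[p]) = MvPowerSeries.coeff α G :=
    fun α => rfl
  have hle : ∀ j ≤ t, ∀ α, ‖((MvPowerSeries.coeff α (P j) : ℚ) : ℚ_[p]) / x‖ ≤ 1 := by
    intro j hj α
    rw [norm_div, div_le_one hnx]
    exact hP j hj α
  have hex : ∀ j α, ∃ z : ℤ_[p], j ≤ t →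
      (z : ℚ_[p]) = ((MvPowerSeries.coeff α (P j) : ℚ) : ℚ_[p]) / x := by
    intro j α
    by_cases hj : j ≤ t
    · exact ⟨⟨_, hle j hj α⟩, fun _ => rfl⟩
    · exact ⟨0, fun h => absurd h hj⟩
  choose b hb using hex
  let B : ℕ → MvPowerSeries (Fin 3) ℤ_[p] := b
  have hB : ∀ j ≤ t, ∀ α, ((MvPowerSeries.coeff α (B j) : ℤ_[p]) : ℚ_[p]) =
      ((MvPowerSeries.coeff α (P j) : ℚ) : ℚ_[p]) / x := fun j hj α => hb j α hj
  have hBrel : ∑ j ∈ Finset.range (t + 1), B j * GZ ^ (t - j) = 0 := by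
    have hinj : Function.Injective (MvPowerSeries.map (σ := Fin 3)
        (PadicInt.Coe.ringHom (p := p))) := by
      intro u v huv
      ext α
      have := congrArg (MvPowerSeries.coeff α) huv
      rw [MvPowerSeries.coeff_map, MvPowerSeries.coeff_map] at this
      exact Subtype.coe_injective this
    apply hinj
    rw [map_zero, map_sum]
    have h1 := congrArg (MvPowerSeries.map (algebraMap ℚ ℚ_[p])) hrel
    rw [map_zero, map_sum] at h1
    have h2 : ∀ j ∈ Finset.range (t + 1),
        MvPowerSeries.map (PadicInt.Coe.ringHom (p := p)) (B j * GZ ^ (t - j)) =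
        MvPowerSeries.C (x : ℚ_[p])⁻¹ * MvPowerSeries.map (algebraMap ℚ ℚ_[p])
          (P j * G ^ (t - j)) := by
      intro j hj
      rw [Finset.mem_range] at hj
      rw [map_mul, map_mul, map_pow, map_pow, ← mul_assoc]
      congr 1
      · ext α
        rw [MvPowerSeries.coeff_C_mul, MvPowerSeries.coeff_map, MvPowerSeries.coeff_map]
        change ((MvPowerSeries.coeff α (B j) : ℤ_[p]) : ℚ_[p]) = _
        rw [hB j (by omega) α, div_eq_inv_mul]
        simp
    rw [Finset.sum_congr rfl h2, ← Finset.mul_sum, h1, mul_zero]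
  have hred := congrArg (MvPowerSeries.map (PadicInt.toZMod (p := p))) hBrel
  rw [map_zero, map_sum] at hred
  simp only [map_mul, map_pow] at hred
  have hφ : MvPowerSeries.map (PadicInt.toZMod (p := p)) GZ ≠ 0 := by
    intro h0
    obtain ⟨α, hα⟩ := hG'
    have := congrArg (MvPowerSeries.coeff α) h0
    rw [MvPowerSeries.coeff_map, map_zero, toZMod_eq_zero_iff, PadicInt.norm_def, hGZ] at this
    exact hα this
  have hcoef : ∀ j ≤ t, ∀ α, MvPowerSeries.coeff α
      (MvPowerSeries.map (PadicInt.toZMod (p := p)) (B j)) = 0 ↔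
      ‖((MvPowerSeries.coeff α (P j) : ℚ) : ℚ_[p])‖ < ‖(x : ℚ_[p])‖ := by
    intro j hj α
    rw [MvPowerSeries.coeff_map, toZMod_eq_zero_iff, PadicInt.norm_def, hB j hj, norm_div,
      div_lt_one hnx]
  obtain ⟨j, hj1, hj2, hj3, h, hj4⟩ := exists_dvd_of_sum_eq_zero hφ hred (by
    obtain ⟨j, hj, α, hα⟩ := hP'
    refine ⟨j, hj, fun h0 => ?_⟩
    have := (hcoef j hj α).mp (by rw [h0, map_zero])
    rw [hα] at this
    exact lt_irrefl _ this)
  refine ⟨j, hj1, hj2, ?_, fun α hα => ?_⟩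
  · by_contra! hall
    refine hj3 ?_
    ext α
    rw [map_zero]
    exact (hcoef j hj2 α).mpr (hall α)
  · rw [← hcoef j hj2 α, hj4, MvPowerSeries.coeff_mul]
    refine Finset.sum_eq_zero fun q hq => ?_
    rw [Finset.HasAntidiagonal.mem_antidiagonal] at hq
    have h1 := hα q.1 (by rw [← hq]; exact le_self_add)
    rw [MvPowerSeries.coeff_map, (toZMod_eq_zero_iff _).mpr, zero_mul]
    rwa [PadicInt.norm_def, hGZ]

/-- Apply a `ℚ`-linear functional to all coefficients of a power series. -/
def mapLin (π : ℂ →ₗ[ℚ] ℚ) (F : MvPowerSeries (Fin 3) ℂ) : MvPowerSeries (Fin 3) ℚ :=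
  fun α => π (MvPowerSeries.coeff α F)

theorem coeff_mapLin (π : ℂ →ₗ[ℚ] ℚ) (F : MvPowerSeries (Fin 3) ℂ) (α : Fin 3 →₀ ℕ) :
    MvPowerSeries.coeff α (mapLin π F) = π (MvPowerSeries.coeff α F) := rfl

theorem mapLin_mul (π : ℂ →ₗ[ℚ] ℚ) (F : MvPowerSeries (Fin 3) ℂ) (G : MvPowerSeries (Fin 3) ℚ) :
    mapLin π (F * MvPowerSeries.map (algebraMap ℚ ℂ) G) = mapLin π F * G := by
  ext α
  rw [coeff_mapLin, MvPowerSeries.coeff_mul, MvPowerSeries.coeff_mul, map_sum]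
  refine Finset.sum_congr rfl fun q _ => ?_
  rw [MvPowerSeries.coeff_map, coeff_mapLin, mul_comm, ← Algebra.smul_def, map_smul, smul_eq_mul,
    mul_comm]

theorem mapLin_relation (π : ℂ →ₗ[ℚ] ℚ) {t : ℕ} {C : ℕ → MvPowerSeries (Fin 3) ℂ}
    {G : MvPowerSeries (Fin 3) ℚ}
    (hrel : ∑ j ∈ Finset.range (t + 1),
      C j * MvPowerSeries.map (algebraMap ℚ ℂ) G ^ (t - j) = 0) :
    ∑ j ∈ Finset.range (t + 1), mapLin π (C j) * G ^ (t - j) = 0 := by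
  ext α
  have h := congrArg (fun F => π (MvPowerSeries.coeff α F)) hrel
  simp only [map_sum, map_zero] at h
  rw [map_sum, map_zero, ← h]
  refine Finset.sum_congr rfl fun j _ => ?_
  rw [← mapLin_mul, map_pow, coeff_mapLin]

theorem exists_linear_retraction : ∃ π : ℂ →ₗ[ℚ] ℚ, π 1 = 1 := by
  obtain ⟨π, hπ⟩ := LinearMap.exists_leftInverse_of_injective (Algebra.linearMap ℚ ℂ)
    (LinearMap.ker_eq_bot.mpr (algebraMap ℚ ℂ).injective)
  refine ⟨π, ?_⟩
  have := LinearMap.congr_fun hπ 1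
  simpa using this

/-- An additive subgroup of `ℂ` stable under division by `6`, as a module over `ℤ[1/6]`. -/
def submoduleOfInvSix (W : AddSubgroup ℂ) (h : ∀ y ∈ W, (6 : ℂ)⁻¹ * y ∈ W) : Submodule R6 ℂ where
  carrier := W
  add_mem' := W.add_mem
  zero_mem' := W.zero_mem
  smul_mem' c y hy := by
    have key : ∀ c ∈ R6, ∀ y ∈ W, c * y ∈ W := by
      intro c hc
      induction hc using Subring.closure_induction with
      | mem c hc =>
        rw [Set.mem_singleton_iff] at hc
        subst hc
        exact h
      | zero => intro y _; rw [zero_mul]; exact W.zero_mem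
      | one => intro y hy; rwa [one_mul]
      | add a b _ _ ha hb => intro y hy; rw [add_mul]; exact W.add_mem (ha y hy) (hb y hy)
      | neg a _ ha => intro y hy; rw [neg_mul]; exact W.neg_mem (ha y hy)
      | mul a b _ _ ha hb => intro y hy; rw [mul_assoc]; exact ha _ (hb y hy)
    exact key c c.2 y hy

theorem norm_inv_six_mul {p : ℕ} [Fact p.Prime] (hp5 : 5 ≤ p) (π : ℂ →ₗ[ℚ] ℚ) (y : ℂ) :
    ‖(π ((6 : ℂ)⁻¹ * y) : ℚ_[p])‖ = ‖(π y : ℚ_[p])‖ := by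
  have h1 : π ((6 : ℂ)⁻¹ * y) = (6 : ℚ)⁻¹ * π y := by
    rw [← smul_eq_mul (6 : ℚ)⁻¹, ← map_smul, Algebra.smul_def]
    simp
  have h6 : ‖(6 : ℚ_[p])‖ = 1 := by
    have h := Padic.norm_natCast_eq_one_iff (p := p) (n := 6)
    refine h.mpr ?_
    rw [(Fact.out : p.Prime).coprime_iff_not_dvd, show 6 = 2 * 3 from rfl,
      (Fact.out : p.Prime).dvd_mul]
    rintro (h | h)
    · exact absurd (Nat.le_of_dvd (by norm_num) h) (by omega)
    · exact absurd (Nat.le_of_dvd (by norm_num) h) (by omega)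
  rw [h1]
  push_cast
  rw [norm_mul, norm_inv, h6, inv_one, one_mul]

/-- The complex numbers with `π`-value of `p`-adic norm at most `ρ`. -/
def ballSubmodule {p : ℕ} [Fact p.Prime] (hp5 : 5 ≤ p) (π : ℂ →ₗ[ℚ] ℚ) (ρ : ℝ) (hρ : 0 ≤ ρ) :
    Submodule R6 ℂ :=
  submoduleOfInvSix
    { carrier := {y | ‖(π y : ℚ_[p])‖ ≤ ρ}
      zero_mem' := by simpa using hρ
      add_mem' := fun {a b} ha hb => by
        rw [Set.mem_ofPred_eq, map_add, Rat.cast_add]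
        exact (Padic.nonarchimedean _ _).trans (max_le ha hb)
      neg_mem' := fun {a} ha => by
        rw [Set.mem_ofPred_eq, map_neg, Rat.cast_neg, norm_neg]
        exact ha }
    (fun y hy => (norm_inv_six_mul hp5 π y).le.trans hy)

/-- The complex numbers with `π`-value of `p`-adic norm less than `ρ`. -/
def openBallSubmodule {p : ℕ} [Fact p.Prime] (hp5 : 5 ≤ p) (π : ℂ →ₗ[ℚ] ℚ) (ρ : ℝ) (hρ : 0 < ρ) :
    Submodule R6 ℂ :=
  submoduleOfInvSix
    { carrier := {y | ‖(π y : ℚ_[p])‖ < ρ}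
      zero_mem' := by simpa using hρ
      add_mem' := fun {a b} ha hb => by
        rw [Set.mem_ofPred_eq, map_add, Rat.cast_add]
        exact (Padic.nonarchimedean _ _).trans_lt (max_lt ha hb)
      neg_mem' := fun {a} ha => by
        rw [Set.mem_ofPred_eq, map_neg, Rat.cast_neg, norm_neg]
        exact ha }
    (fun y hy => (norm_inv_six_mul hp5 π y).le.trans_lt hy)

end

section

theorem monom_ex (u : Fin 3 → ℂ) (α : Fin 3 →₀ ℕ) :
    monom (fun i => ex (u i)) α = ex (∑ i, (α i : ℂ) * u i) := by
  rw [monom, Fin.prod_univ_three, Fin.sum_univ_three, ex_add, ex_add, ex_nat_mul, ex_nat_mul,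
    ex_nat_mul]

/-- The point of the tube domain with coordinates `(τ - z)/N, (τ' - z)/N, z/N`. -/
def tubePoint (N : ℕ) (u : Fin 3 → ℂ) : Fin 3 → ℂ :=
  ![N * (u 0 + u 2), N * u 2, N * (u 1 + u 2)]

theorem tubePoint_mem {N : ℕ} (hN : 1 ≤ N) {u : Fin 3 → ℂ} (hu : ∀ i, 0 < (u i).im) :
    tubePoint N u ∈ tube := by
  have h0 := hu 0
  have h1 := hu 1
  have h2 := hu 2
  have hN' : (0 : ℝ) < N := by exact_mod_cast hN
  rw [tubePoint, vec3_mem_tube]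
  simp only [mul_im, add_im, natCast_re, natCast_im, zero_mul, add_zero]
  refine ⟨by positivity, ?_⟩
  have : (N : ℝ) * ((u 0).im + (u 2).im) * (N * ((u 1).im + (u 2).im)) - (N * (u 2).im) ^ 2 =
      N ^ 2 * ((u 0).im * (u 1).im + (u 0).im * (u 2).im + (u 2).im * (u 1).im) := by ring
  have h3 : 0 < (N : ℝ) ^ 2 *
      ((u 0).im * (u 1).im + (u 0).im * (u 2).im + (u 2).im * (u 1).im) := by positivity
  linarith

/-- The Fourier index of a level one form attached to an exponent. -/
def expIndex (α : Fin 3 →₀ ℕ) : Fin 3 → ℤ := ![α 0, (α 2 : ℤ) - α 0 - α 1, α 1]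

theorem expIndex_injective : Function.Injective expIndex := by
  intro α β h
  have h0 : (α 0 : ℤ) = β 0 := congrFun h 0
  have h1 : (α 2 : ℤ) - α 0 - α 1 = (β 2 : ℤ) - β 0 - β 1 := congrFun h 1
  have h2 : (α 1 : ℤ) = β 1 := congrFun h 2
  ext i
  fin_cases i <;> simp <;> omega

theorem exists_expIndex_eq {n : Fin 3 → ℤ} (h0 : 0 ≤ n 0) (h2 : 0 ≤ n 2)
    (h1 : |n 1| ≤ n 0 + n 2) : ∃ α, expIndex α = n := by
  rw [abs_le] at h1
  refine ⟨Finsupp.equivFunOnFinite.symm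
    ![(n 0).toNat, (n 2).toNat, (n 0 + n 1 + n 2).toNat], ?_⟩
  funext i
  fin_cases i <;> simp [expIndex] <;> omega

/-- The exponent series, in `N`-th root variables, of a family of Fourier coefficients. -/
def levelSeries (N : ℕ) (a : (Fin 3 → ℤ) → ℂ) : MvPowerSeries (Fin 3) ℂ :=
  Function.extend (fun α : Fin 3 →₀ ℕ => N • α) (fun α => a (expIndex α)) 0

theorem nsmul_finsupp_injective {N : ℕ} (hN : 1 ≤ N) :
    Function.Injective (fun α : Fin 3 →₀ ℕ => N • α) := by
  intro α β h
  ext i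
  have := DFunLike.congr_fun h i
  simp only [Finsupp.smul_apply, smul_eq_mul] at this
  exact Nat.eq_of_mul_eq_mul_left hN this

theorem coeff_levelSeries {N : ℕ} (hN : 1 ≤ N) (a : (Fin 3 → ℤ) → ℂ) (α : Fin 3 →₀ ℕ) :
    MvPowerSeries.coeff (N • α) (levelSeries N a) = a (expIndex α) := by
  change Function.extend (fun α : Fin 3 →₀ ℕ => N • α) (fun α => a (expIndex α)) 0 _ = _
  exact (nsmul_finsupp_injective hN).extend_apply _ _ α

theorem coeff_levelSeries_eq_zero {N : ℕ} (a : (Fin 3 → ℤ) → ℂ) {β : Fin 3 →₀ ℕ}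
    (h : ¬ ∃ α, N • α = β) : MvPowerSeries.coeff β (levelSeries N a) = 0 := by
  change Function.extend (fun α : Fin 3 →₀ ℕ => N • α) (fun α => a (expIndex α)) 0 _ = _
  exact Function.extend_apply' _ _ β h

theorem evalsTo_levelSeries {N : ℕ} (hN : 1 ≤ N) {K : ℤ} {g : (Fin 3 → ℂ) → ℂ}
    {a : (Fin 3 → ℤ) → ℂ} (hg : IsLevelOne K g) (ha : IsFourier a g) {u : Fin 3 → ℂ}
    (hu : ∀ i, 0 < (u i).im) :
    EvalsTo (levelSeries N a) (fun i => ex (u i)) (g (tubePoint N u)) := by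
  refine ((nsmul_finsupp_injective hN).hasSum_iff fun β hβ => ?_).mp ?_
  · rw [coeff_levelSeries_eq_zero a hβ, zero_mul]
  · have h := (expIndex_injective.hasSum_iff fun n hn => ?_).mpr (ha _ (tubePoint_mem hN hu))
    · refine h.congr_fun fun α => ?_
      simp only [Function.comp_apply]
      rw [coeff_levelSeries hN, monom_ex]
      congr 2
      simp [Fin.sum_univ_three, expIndex, tubePoint]
      ring
    · rw [← vec3_eta n] at hn ⊢
      by_cases h0 : a ![n 0, n 1, n 2] = 0
      · rw [h0, zero_mul]
      · obtain ⟨h1, h2, h3⟩ := hg.coeff_support ha h0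
        exact absurd (exists_expIndex_eq (n := ![n 0, n 1, n 2]) h1 h2 h3) hn

/-- The Fourier index of a form of level `N` attached to an exponent. -/
def expMatrix (N : ℕ) (α : Fin 3 →₀ ℕ) : Matrix (Fin 2) (Fin 2) ℚ :=
  !![(α 0 : ℚ) / N, ((α 2 : ℚ) - α 0 - α 1) / N / 2; ((α 2 : ℚ) - α 0 - α 1) / N / 2, (α 1 : ℚ) / N]

theorem expMatrix_injective {N : ℕ} (hN : 1 ≤ N) : Function.Injective (expMatrix N) := by
  intro α β h
  have hN' : (N : ℚ) ≠ 0 := by positivity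
  have h0 : (α 0 : ℚ) / N = β 0 / N := congrFun (congrFun h 0) 0
  have h1 : ((α 2 : ℚ) - α 0 - α 1) / N / 2 = ((β 2 : ℚ) - β 0 - β 1) / N / 2 :=
    congrFun (congrFun h 0) 1
  have h2 : (α 1 : ℚ) / N = β 1 / N := congrFun (congrFun h 1) 1
  field_simp at h0 h1 h2
  have h3 : (α 2 : ℚ) = β 2 := by linarith
  norm_cast at h0 h2 h3
  ext i
  fin_cases i <;> simpa

theorem siegelLattice_relations {N : ℕ} {T : Matrix (Fin 2) (Fin 2) ℚ}
    (hT : T ∈ SiegelLattice 2 N) :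
    T 1 0 = T 0 1 ∧ 0 ≤ T 0 0 ∧ 0 ≤ T 1 1 ∧ T 0 1 ^ 2 ≤ T 0 0 * T 1 1 := by
  obtain ⟨h1, -, -, h4⟩ := hT
  have hs : T 1 0 = T 0 1 := h1.apply 0 1
  have hd := h4.det_nonneg
  rw [Matrix.det_fin_two] at hd
  simp only [Matrix.map_apply, hs] at hd
  have h00 := h4.diag_nonneg (i := 0)
  have h11 := h4.diag_nonneg (i := 1)
  simp only [Matrix.map_apply] at h00 h11
  norm_cast at h00 h11 hd
  exact ⟨hs, h00, h11, by nlinarith⟩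

theorem exists_expMatrix_eq {N : ℕ} (hN : 1 ≤ N) {T : Matrix (Fin 2) (Fin 2) ℚ}
    (hT : T ∈ SiegelLattice 2 N) : ∃ α, expMatrix N α = T := by
  obtain ⟨hs, h00, h11, hd⟩ := siegelLattice_relations hT
  have hN' : (0 : ℚ) < N := by positivity
  obtain ⟨x, hx⟩ := hT.2.1 0
  obtain ⟨y, hy⟩ := hT.2.1 1
  obtain ⟨z, hz⟩ := hT.2.2.1 0 1
  have hx0 : 0 ≤ x := by
    have : (0 : ℚ) ≤ x := by rw [← hx]; positivity
    exact_mod_cast this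
  have hy0 : 0 ≤ y := by
    have : (0 : ℚ) ≤ y := by rw [← hy]; positivity
    exact_mod_cast this
  have hsum : 0 ≤ x + y + z := by
    have h1 : 0 ≤ T 0 0 + T 1 1 + 2 * T 0 1 := by
      by_contra! hneg
      nlinarith [sq_nonneg (T 0 0 - T 1 1)]
    have : (0 : ℚ) ≤ x + y + z := by
      rw [← hx, ← hy, ← hz]
      nlinarith
    exact_mod_cast this
  refine ⟨Finsupp.equivFunOnFinite.symm ![x.toNat, y.toNat, (x + y + z).toNat], ?_⟩
  have ex0 : ((x.toNat : ℕ) : ℚ) = x := by exact_mod_cast Int.toNat_of_nonneg hx0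
  have ey0 : ((y.toNat : ℕ) : ℚ) = y := by exact_mod_cast Int.toNat_of_nonneg hy0
  have es0 : (((x + y + z).toNat : ℕ) : ℚ) = x + y + z := by
    exact_mod_cast Int.toNat_of_nonneg hsum
  ext i j
  fin_cases i <;> fin_cases j <;> simp [expMatrix, ex0, ey0, es0, hs] <;> field_simp <;> linarith

variable {k : ℤ} {Γ : Set (Matrix (Fin 2 ⊕ Fin 2) (Fin 2 ⊕ Fin 2) ℤ)} {N : ℕ}

/-- The exponent series of a Siegel modular form of level `N`. -/
def formSeries (f : SiegelModularForm 2 k Γ N) : MvPowerSeries (Fin 3) ℂ :=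
  fun α => f.coeff (expMatrix N α)

theorem coeff_formSeries (f : SiegelModularForm 2 k Γ N) (α : Fin 3 →₀ ℕ) :
    MvPowerSeries.coeff α (formSeries f) = f.coeff (expMatrix N α) := rfl

theorem evalsTo_formSeries (hN : 1 ≤ N) (f : SiegelModularForm 2 k Γ N) {u : Fin 3 → ℂ}
    (hu : ∀ i, 0 < (u i).im) :
    EvalsTo (formSeries f) (fun i => ex (u i)) (f.toFun (symMat (tubePoint N u))) := by
  have hN' : (N : ℂ) ≠ 0 := by exact_mod_cast (by omega : N ≠ 0)
  have h := f.expansion _ (symMat_mem (tubePoint_mem hN hu))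
  have h1 : HasSum (fun T : Matrix (Fin 2) (Fin 2) ℚ => f.coeff T * cexp (2 * Real.pi * I *
        ((T.map (fun q => (q : ℂ))) * symMat (tubePoint N u)).trace))
      (f.toFun (symMat (tubePoint N u))) := by
    refine (hasSum_subtype_iff_of_support_subset (s := SiegelLattice 2 N) fun T hT => ?_).mp h
    exact f.coeff_supported T (left_ne_zero_of_mul hT)
  have h2 := ((expMatrix_injective hN).hasSum_iff fun T hT => ?_).mpr h1
  · refine h2.congr_fun fun α => ?_
    simp only [Function.comp_apply]
    rw [coeff_formSeries, monom_ex, ex]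
    congr 3
    simp [Matrix.trace, Matrix.mul_apply, Fin.sum_univ_three, Fin.sum_univ_two, expMatrix, symMat,
      tubePoint]
    field_simp
    ring
  · by_cases h0 : f.coeff T = 0
    · rw [h0, zero_mul]
    · exact absurd (exists_expMatrix_eq hN (f.coeff_supported T h0)) hT

theorem formSeries_relation (hN : 1 ≤ N) (f : SiegelModularForm 2 k Γ N) {t : ℕ}
    {K : ℕ → ℤ} {g : ℕ → (Fin 3 → ℂ) → ℂ} {a : ℕ → (Fin 3 → ℤ) → ℂ}
    (hg : ∀ j, IsLevelOne (K j) (g j)) (ha : ∀ j, IsFourier (a j) (g j))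
    (hrel : ∀ w ∈ tube, ∑ j ∈ Finset.range (t + 1), g j w * f.toFun (symMat w) ^ (t - j) = 0) :
    ∑ j ∈ Finset.range (t + 1), levelSeries N (a j) * formSeries f ^ (t - j) = 0 := by
  refine eq_zero_of_evalsTo (fun _ => 1 / 2) (fun _ => by norm_num) fun x hx => ?_
  have hu : ∀ i, ∃ τ : ℂ, 0 < τ.im ∧ ex τ = x i := fun i => exists_ex_eq
    (norm_pos_iff.mp (by rw [hx]; norm_num)) (by rw [hx]; norm_num)
  choose u hu hux using hu
  obtain rfl : (fun i => ex (u i)) = x := funext hux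
  rw [← hrel _ (tubePoint_mem hN hu)]
  exact evalsTo_sum _ fun j _ => (evalsTo_levelSeries hN (hg j) (ha j) hu).mul
    ((evalsTo_formSeries hN f hu).pow _)

end

section

theorem isPIntegral_ratCast_iff {p : ℕ} [Fact p.Prime] (q : ℚ) :
    IsPIntegral p (q : ℂ) ↔ ‖(q : ℚ_[p])‖ ≤ 1 := by
  constructor
  · rintro ⟨a, b, hb, h⟩
    have h1 : (b : ℚ) * q = a := by exact_mod_cast h
    have h2 : (b : ℚ_[p]) * (q : ℚ_[p]) = a := by exact_mod_cast congrArg (Rat.cast (K := ℚ_[p])) h1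
    have h3 : ‖(b : ℚ_[p])‖ = 1 := le_antisymm (Padic.norm_int_le_one b)
      (not_lt.mp fun hlt => hb (Padic.norm_intCast_lt_one_iff.mp hlt))
    have h4 := Padic.norm_int_le_one (p := p) a
    rwa [← h2, norm_mul, h3, one_mul] at h4
  · intro h
    refine ⟨q.num, q.den, fun hd => ?_, ?_⟩
    · have h1 := PadicInt.isUnit_iff.mp (PadicInt.isUnit_den q h)
      have h2 := (Padic.norm_intCast_lt_one_iff (p := p) (k := (q.den : ℤ))).mpr hd
      rw [PadicInt.norm_def] at h1
      push_cast at h1 h2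
      exact h2.ne h1
    · exact_mod_cast Rat.den_mul_eq_num q

theorem modCongr_ratCast_iff {p : ℕ} [Fact p.Prime] (q : ℚ) :
    ModCongr p 1 (q : ℂ) 0 ↔ ‖(q : ℚ_[p])‖ < 1 := by
  have hp : (0 : ℝ) < p := by exact_mod_cast (Fact.out : p.Prime).pos
  have h : ((q : ℂ) - 0) / (p : ℂ) ^ 1 = ((q / p : ℚ) : ℂ) := by push_cast; ring
  rw [ModCongr, h, isPIntegral_ratCast_iff]
  have h1 := Padic.norm_le_pow_iff_norm_lt_pow_add_one (q : ℚ_[p]) (-1)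
  rw [neg_add_cancel, zpow_zero, _root_.zpow_neg_one] at h1
  rw [← h1, Rat.cast_div, norm_div, Rat.cast_natCast, Padic.norm_p, div_le_iff₀ (by positivity),
    one_mul]

theorem exists_ratCast_eq_of_isPIntegral {p : ℕ} {z : ℂ} (hz : IsPIntegral p z) :
    ∃ q : ℚ, (q : ℂ) = z := by
  obtain ⟨a, b, hb, h⟩ := hz
  have hb0 : (b : ℂ) ≠ 0 := by
    rintro h0
    obtain rfl : b = 0 := by exact_mod_cast h0
    exact hb (dvd_zero _)
  refine ⟨a / b, ?_⟩
  push_cast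
  rw [← h]
  field_simp

/-- A nonzero value of maximal `p`-adic size among the Fourier coefficients of finitely many level
one forms. -/
theorem exists_max_coeff {p : ℕ} [Fact p.Prime] (hp5 : 5 ≤ p) (π : ℂ →ₗ[ℚ] ℚ) (hπ : π 1 = 1)
    {t : ℕ} {K : ℕ → ℤ} (hK : ∀ j, Even (K j)) {g : ℕ → (Fin 3 → ℂ) → ℂ}
    {a : ℕ → (Fin 3 → ℤ) → ℂ} (hg : ∀ j, IsLevelOne (K j) (g j))
    (ha : ∀ j, IsFourier (a j) (g j)) (h0 : a 0 0 = 1) :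
    ∃ x : ℚ, x ≠ 0 ∧ (∀ j ≤ t, ∀ n, ‖(π (a j n) : ℚ_[p])‖ ≤ ‖(x : ℚ_[p])‖) ∧
      ∃ j ≤ t, ∃ α, π (a j (expIndex α)) = x := by
  set S : Set (ℕ × (Fin 3 → ℤ)) := {q | q.1 ≤ t ∧ a q.1 q.2 ≠ 0 ∧
    (10 * q.2 0 ≤ K q.1 ∧ 10 * q.2 2 ≤ K q.1 ∨ q = 0)} with hS
  have hsupp : ∀ j n, a j n ≠ 0 → 0 ≤ n 0 ∧ 0 ≤ n 2 ∧ |n 1| ≤ n 0 + n 2 := by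
    intro j n h
    rw [← vec3_eta n] at h
    exact (hg j).coeff_support (ha j) h
  have hfin : S.Finite := by
    obtain ⟨B, hB⟩ : ∃ B : ℤ, ∀ j ≤ t, |K j| ≤ B :=
      ⟨∑ j ∈ Finset.range (t + 1), |K j|, fun j hj =>
        Finset.single_le_sum (f := fun j => |K j|) (fun _ _ => abs_nonneg _)
          (Finset.mem_range.mpr (by omega))⟩
    refine ((Set.finite_Iic t).prod (Set.finite_Icc (fun _ : Fin 3 => -B) fun _ => B)).subset ?_
    rintro ⟨j, n⟩ ⟨hj, hne, hbox⟩
    obtain ⟨h1, h2, h3⟩ := hsupp j n hne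
    have h4 := hB j hj
    rw [abs_le] at h3 h4
    refine ⟨hj, fun i => ?_, fun i => ?_⟩ <;> rcases hbox with hbox | hbox
    · simp only at hbox; fin_cases i <;> simp <;> omega
    · obtain ⟨-, rfl⟩ := Prod.mk.inj hbox
      simp
      omega
    · simp only at hbox; fin_cases i <;> simp <;> omega
    · obtain ⟨-, rfl⟩ := Prod.mk.inj hbox
      simp
      omega
  have hmem : (0 : ℕ × (Fin 3 → ℤ)) ∈ S := ⟨Nat.zero_le _, by simp [h0], Or.inr rfl⟩
  obtain ⟨⟨j, n⟩, ⟨hj, hne, hbox⟩, hmax⟩ := Set.exists_max_image S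
    (fun q => ‖(π (a q.1 q.2) : ℚ_[p])‖) hfin ⟨_, hmem⟩
  refine ⟨π (a j n), ?_, ?_, j, hj, ?_⟩
  · rintro h
    have := hmax _ hmem
    simp [h, h0, hπ] at this
    linarith
  · intro i hi m
    refine (hg i).coeff_mem (ha i) (hK i)
      (ballSubmodule (p := p) hp5 π ‖(π (a j n) : ℚ_[p])‖ (norm_nonneg _)) (fun u r v hu hv => ?_) m
    change ‖(π (a i ![u, r, v]) : ℚ_[p])‖ ≤ _
    by_cases hz : a i ![u, r, v] = 0
    · rw [hz, map_zero, Rat.cast_zero, norm_zero]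
      exact norm_nonneg _
    · exact hmax (i, ![u, r, v]) ⟨hi, hz, Or.inl ⟨hu, hv⟩⟩
  · obtain ⟨h1, h2, h3⟩ := hsupp j n hne
    obtain ⟨α, hα⟩ := exists_expIndex_eq h1 h2 h3
    exact ⟨α, by rw [hα]⟩

variable {k : ℤ} {Γ : Set (Matrix (Fin 2 ⊕ Fin 2) (Fin 2 ⊕ Fin 2) ℤ)} {N t : ℕ}
  {reps : Fin t → Matrix (Fin 2 ⊕ Fin 2) (Fin 2 ⊕ Fin 2) ℤ}

theorem isLevelOne_symFun (hk : Even k) (hsub : Γ ⊆ SiegelModularGroup 2)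
    (hone : (1 : Matrix (Fin 2 ⊕ Fin 2) (Fin 2 ⊕ Fin 2) ℤ) ∈ Γ)
    (hmulmem : ∀ M₁ ∈ Γ, ∀ M₂ ∈ Γ, M₁ * M₂ ∈ Γ)
    (hinv : ∀ M ∈ Γ, ∃ M' ∈ Γ, M * M' = 1 ∧ M' * M = 1)
    (hreps : ∀ i, reps i ∈ SiegelModularGroup 2)
    (hindex : ∀ M ∈ SiegelModularGroup 2, ∃! i : Fin t, ∃ g ∈ Γ, M = g * reps i)
    (f : SiegelModularForm 2 k Γ N) (j : ℕ) :
    IsLevelOne (j * k) (fun w => (-1) ^ j * symFun f reps j (symMat w)) := by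
  refine isLevelOne_of_transform (F := fun Z => (-1) ^ j * symFun f reps j Z) (hk.mul_left _)
    ((differentiableOn_symFun hreps f j).const_mul _) fun M hM Z hZ => ?_
  obtain ⟨σ, hbij, hσ⟩ := exists_bijective_coset hone hmulmem hinv hreps hindex hM
  rw [symFun_matActS hsub hreps f j hM hbij hσ hZ]
  ring

theorem isFourier_one : IsFourier (Pi.single 0 1) fun _ => 1 := by
  intro w _
  convert hasSum_ite_eq (0 : Fin 3 → ℤ) (1 : ℂ) using 2 with n
  by_cases h : n = 0
  · subst h
    simp [ex]
  · simp [h]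

theorem exists_level_one_relation (hk : Even k) (hN : 1 ≤ N) (hsub : Γ ⊆ SiegelModularGroup 2)
    (hone : (1 : Matrix (Fin 2 ⊕ Fin 2) (Fin 2 ⊕ Fin 2) ℤ) ∈ Γ)
    (hmulmem : ∀ M₁ ∈ Γ, ∀ M₂ ∈ Γ, M₁ * M₂ ∈ Γ)
    (hinv : ∀ M ∈ Γ, ∃ M' ∈ Γ, M * M' = 1 ∧ M' * M = 1)
    (hreps : ∀ i, reps i ∈ SiegelModularGroup 2)
    (hindex : ∀ M ∈ SiegelModularGroup 2, ∃! i : Fin t, ∃ g ∈ Γ, M = g * reps i)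
    (f : SiegelModularForm 2 k Γ N) :
    ∃ (g : ℕ → (Fin 3 → ℂ) → ℂ) (a : ℕ → (Fin 3 → ℤ) → ℂ),
      (∀ j : ℕ, IsLevelOne (j * k) (g j)) ∧ (∀ j, IsFourier (a j) (g j)) ∧ a 0 0 = 1 ∧
      ∑ j ∈ Finset.range (t + 1), levelSeries N (a j) * formSeries f ^ (t - j) = 0 := by
  have hg := isLevelOne_symFun hk hsub hone hmulmem hinv hreps hindex f
  choose a ha using fun j => exists_fourier_expansion (hg j).diff (hg j).periodic
  refine ⟨_, a, hg, ha, ?_, formSeries_relation hN f hg ha fun w hw =>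
    sum_symFun hsub hreps hindex f (symMat_mem hw)⟩
  have h1 : IsFourier (a 0) fun _ => 1 := fun w hw => by simpa [symFun] using ha 0 w hw
  rw [h1.unique isFourier_one, Pi.single_eq_same]

end

end SiegelSturm

open SiegelSturm

/-- **Sturm-type theorem for Siegel modular forms of degree 2 on congruence
subgroups** (Theorem 3.2, Kikuta). Let `p ≥ 5` be prime, `k` even, and `Γ` a
congruence subgroup of `Γ₂ = Sp₂(ℤ)` of level `N` and index `t = [Γ₂ : Γ]`
(witnessed by a system of `t` right-coset representatives). If
`f ∈ M_k(Γ)_{ℤ_(p)}` satisfies `a_f([[m, r/2], [r/2, n]]) ≡ 0 (mod p)` for all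
(rational) `m, n, r` with `0 ≤ m ≤ (kt+2)/10`, `0 ≤ n ≤ (3kt+1)/30` and
`mn - r²/4 ≥ 0`, then all Fourier coefficients of `f` are `≡ 0 (mod p)`. -/
theorem sturm_siegel_degree_two_congruence_subgroup
    (p : ℕ) (hp : Nat.Prime p) (hp5 : 5 ≤ p) (k : ℤ) (hk : Even k)
    (Γ : Set (Matrix (Fin 2 ⊕ Fin 2) (Fin 2 ⊕ Fin 2) ℤ)) (N : ℕ) (hN : 1 ≤ N)
    (hsub : Γ ⊆ SiegelModularGroup 2)
    (hone : (1 : Matrix (Fin 2 ⊕ Fin 2) (Fin 2 ⊕ Fin 2) ℤ) ∈ Γ)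
    (hmulmem : ∀ M₁ ∈ Γ, ∀ M₂ ∈ Γ, M₁ * M₂ ∈ Γ)
    (hinv : ∀ M ∈ Γ, ∃ M' ∈ Γ, M * M' = 1 ∧ M' * M = 1)
    (hcongsub : ∀ M ∈ SiegelModularGroup 2,
      (∀ i j, (N : ℤ) ∣ (M i j - (1 : Matrix (Fin 2 ⊕ Fin 2) (Fin 2 ⊕ Fin 2) ℤ) i j)) →
      M ∈ Γ)
    (t : ℕ) (reps : Fin t → Matrix (Fin 2 ⊕ Fin 2) (Fin 2 ⊕ Fin 2) ℤ)
    (hreps : ∀ i, reps i ∈ SiegelModularGroup 2)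
    (hindex : ∀ M ∈ SiegelModularGroup 2, ∃! i : Fin t, ∃ g ∈ Γ, M = g * reps i)
    (f : SiegelModularForm 2 k Γ N)
    (hint : ∀ T, IsPIntegral p (f.coeff T))
    (hcong : ∀ m n r : ℚ,
      0 ≤ m → 10 * m ≤ (k : ℚ) * (t : ℚ) + 2 →
      0 ≤ n → 30 * n ≤ 3 * (k : ℚ) * (t : ℚ) + 1 →
      r ^ 2 / 4 ≤ m * n →
      ModCongr p 1 (f.coeff !![m, r / 2; r / 2, n]) 0) :
    ∀ T, ModCongr p 1 (f.coeff T) 0 := by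
  have : Fact p.Prime := ⟨hp⟩
  obtain ⟨π, hπ⟩ := exists_linear_retraction
  obtain ⟨g, a, hg, ha, h0, hrel⟩ :=
    exists_level_one_relation hk hN hsub hone hmulmem hinv hreps hindex f
  have hK : ∀ j : ℕ, Even ((j : ℤ) * k) := fun j => hk.mul_left _
  choose q hq using fun α => exists_ratCast_eq_of_isPIntegral (hint (expMatrix N α))
  let G : MvPowerSeries (Fin 3) ℚ := q
  have hG : MvPowerSeries.map (algebraMap ℚ ℂ) G = formSeries f := by
    ext α
    rw [MvPowerSeries.coeff_map, coeff_formSeries, ← hq]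
    rfl
  rw [← hG] at hrel
  have hiff : ∀ α, ModCongr p 1 (f.coeff (expMatrix N α)) 0 ↔ ‖(q α : ℚ_[p])‖ < 1 := fun α => by
    rw [← hq, modCongr_ratCast_iff]
  by_contra! hcontra
  obtain ⟨T, hT⟩ := hcontra
  have hT0 : f.coeff T ≠ 0 := fun h => hT (by
    rw [h]
    exact ⟨0, 1, fun h1 => hp.one_lt.ne' (by exact_mod_cast Int.eq_one_of_dvd_one (by simp) h1),
      by simp⟩)
  obtain ⟨α₀, rfl⟩ := exists_expMatrix_eq hN (f.coeff_supported T hT0)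
  rw [hiff] at hT
  obtain ⟨x, hx, hmax, j₀, hj₀, α₁, hα₁⟩ := exists_max_coeff (p := p) (t := t) hp5 π hπ hK hg ha h0
  have hxn : 0 < ‖(x : ℚ_[p])‖ := norm_pos_iff.mpr (by exact_mod_cast hx)
  have hcoeff : ∀ j β, (∃ n, MvPowerSeries.coeff β (mapLin π (levelSeries N (a j))) = π (a j n)) ∨
      MvPowerSeries.coeff β (mapLin π (levelSeries N (a j))) = 0 := by
    intro j β
    rw [coeff_mapLin]
    by_cases hβ : ∃ α, N • α = β
    · obtain ⟨α, rfl⟩ := hβ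
      exact Or.inl ⟨_, by rw [coeff_levelSeries hN]⟩
    · exact Or.inr (by rw [coeff_levelSeries_eq_zero _ hβ, map_zero])
  obtain ⟨j, hj1, hjt, ⟨β, hβ⟩, hlt⟩ := exists_reduction (p := p)
    (mapLin_relation π hrel)
    (fun α => (isPIntegral_ratCast_iff (q α)).mp (hq α ▸ hint _)) ⟨α₀, hT⟩ hx
    (fun j hj β => by
      rcases hcoeff j β with ⟨n, h⟩ | h
      · rw [h]
        exact hmax j hj n
      · rw [h, Rat.cast_zero, norm_zero]
        exact hxn.le)
    ⟨j₀, hj₀, N • α₁, by rw [coeff_mapLin, coeff_levelSeries hN, hα₁]⟩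
  have hall : ∀ n, ‖(π (a j n) : ℚ_[p])‖ < ‖(x : ℚ_[p])‖ := by
    refine (hg j).coeff_mem (ha j) (hK j) (openBallSubmodule (p := p) hp5 π _ hxn)
      fun u r v hu hv => ?_
    change ‖(π (a j ![u, r, v]) : ℚ_[p])‖ < _
    by_cases hz : a j ![u, r, v] = 0
    · simpa [hz] using hxn
    obtain ⟨h1, h2, h3⟩ := (hg j).coeff_support (ha j) hz
    obtain ⟨α, hα⟩ := exists_expIndex_eq (n := ![u, r, v]) h1 h2 h3
    have hlast := hlt (N • α) fun γ hγ => ?_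
    · rwa [coeff_mapLin, coeff_levelSeries hN, hα] at hlast
    change ‖(q γ : ℚ_[p])‖ < 1
    rw [← hiff]
    by_cases hγ0 : f.coeff (expMatrix N γ) = 0
    · rw [hγ0]
      simpa using (modCongr_ratCast_iff (p := p) 0).mpr (by simp)
    obtain ⟨-, s1, s2, s3⟩ := siegelLattice_relations (f.coeff_supported _ hγ0)
    have hN' : (0 : ℚ) < N := by exact_mod_cast hN
    have hu0 : (α 0 : ℤ) = u := congrFun hα 0
    have hv0 : (α 1 : ℤ) = v := congrFun hα 2
    have hk0 : 0 ≤ k := by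
      by_contra! hneg
      have : (j : ℤ) * k < 0 := mul_neg_of_pos_of_neg (by exact_mod_cast hj1) hneg
      omega
    have hjk : (j : ℤ) * k ≤ k * t := by
      rw [mul_comm k]
      exact mul_le_mul_of_nonneg_right (by exact_mod_cast hjt) hk0
    have hbound : ∀ i, (10 * α i : ℤ) ≤ k * t → 10 * ((γ i : ℚ) / N) ≤ k * t := by
      intro i hi
      have hγi : (γ i : ℚ) ≤ N * α i := by exact_mod_cast hγ i
      have hi' : (10 * α i : ℚ) ≤ k * t := by exact_mod_cast hi
      have : (γ i : ℚ) / N ≤ α i := by rw [div_le_iff₀ hN']; linarith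
      linarith
    have hb0 := hbound 0 (by omega)
    have hb1 := hbound 1 (by omega)
    refine hcong ((γ 0 : ℚ) / N) ((γ 1 : ℚ) / N) (((γ 2 : ℚ) - γ 0 - γ 1) / N) s1 (by linarith) s2
      (by linarith) ?_
    have s4 : (((γ 2 : ℚ) - γ 0 - γ 1) / N / 2) ^ 2 ≤ (γ 0 : ℚ) / N * ((γ 1 : ℚ) / N) := s3
    linarith [s4, div_pow (((γ 2 : ℚ) - γ 0 - γ 1) / N) 2 2]
  rcases hcoeff j β with ⟨n, h⟩ | h
  · exact hβ (h ▸ hall n)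
  · exact hβ (by rw [h]; simpa using hxn)

end
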